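/- Suppose Γ ⊂ ℂⁿ is a compact subset of a continuum of finite one-dimensional Hausdorff measure. Then the second Čech cohomology group of the polynomially convex hull of Γ with integer coefficients vanishes: H²(Γ̂,ℤ) = 0. -/

import Mathlib

/-! Čech cohomology with integer coefficients, defined via unindexed open covers. -/

namespace CechPaper

variable (X : Type*) [TopologicalSpace X]

/-- An (unindexed) open cover of `X`: a collection of open sets covering `X`. -/
def IsCover (𝒰 : Set (Set X)) : Prop :=
  (∀ U ∈ 𝒰, IsOpen U) ∧ ∀ x : X, ∃ U ∈ 𝒰, x ∈ U

/-- Čech `n`-cochains (with respect to covers by subsets of `X`) with integer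
coefficients: an integer for each `(n+1)`-tuple of sets. -/
abbrev Cochain (n : ℕ) := (Fin (n + 1) → Set X) → ℤ

/-- The Čech coboundary operator. -/
def coboundary {n : ℕ} (c : Cochain X n) : Cochain X (n + 1) := fun σ =>
  ∑ i : Fin (n + 2), (-1 : ℤ) ^ (i : ℕ) * c (σ ∘ i.succAbove)

/-- A tuple of sets is relevant for the cover `𝒰` if all its members belong to `𝒰`
and it is a simplex of the nerve of `𝒰`, i.e. the total intersection is nonempty. -/
def Relevant (𝒰 : Set (Set X)) {m : ℕ} (σ : Fin m → Set X) : Prop :=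
  (∀ j, σ j ∈ 𝒰) ∧ (⋂ j, σ j).Nonempty

/-- `c` is a cocycle on the nerve of the cover `𝒰`. -/
def IsCocycle (𝒰 : Set (Set X)) {n : ℕ} (c : Cochain X n) : Prop :=
  ∀ σ : Fin (n + 2) → Set X, Relevant X 𝒰 σ → coboundary X c σ = 0

/-- A representative of a degree `n+1` Čech cohomology class: an open cover
together with an `(n+1)`-cocycle on its nerve. -/
structure Elem (n : ℕ) where
  cov : Set (Set X)
  isCover : IsCover X cov
  coc : Cochain X (n + 1)
  isCocycle : IsCocycle X cov coc

/-- `𝒲` refines `𝒰` with refinement map `r`. -/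
def RefinesWith (𝒲 𝒰 : Set (Set X)) (r : Set X → Set X) : Prop :=
  ∀ W ∈ 𝒲, r W ∈ 𝒰 ∧ W ⊆ r W

/-- Two cover/cocycle pairs define the same Čech cohomology class iff on some common
refinement the difference of (the restrictions of) the cocycles is a coboundary. -/
def Rel {n : ℕ} (e₁ e₂ : Elem X n) : Prop :=
  ∃ (𝒲 : Set (Set X)) (r₁ r₂ : Set X → Set X) (b : Cochain X n),
    IsCover X 𝒲 ∧ RefinesWith X 𝒲 e₁.cov r₁ ∧ RefinesWith X 𝒲 e₂.cov r₂ ∧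
    ∀ σ : Fin (n + 2) → Set X, Relevant X 𝒲 σ →
      e₁.coc (r₁ ∘ σ) - e₂.coc (r₂ ∘ σ) = coboundary X b σ

/-- The Čech cohomology group `H^{n+1}(X, ℤ)` (as a set: the colimit over all open
covers, directed by refinement, of the cohomology of their nerves). -/
def CechHSucc (n : ℕ) := Quot (Rel X (n := n))

/-- The second Čech cohomology `H²(X, ℤ)` of `X` with integer coefficients. -/
abbrev CechH2 := CechHSucc X 1

/-- The covering dimension of `X` is at most `n`: every open cover admits an open
refinement such that no `n+2` distinct members of it have a common point. -/
def CovDimLE (n : ℕ) : Prop :=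
  ∀ 𝒰 : Set (Set X), IsCover X 𝒰 →
    ∃ 𝒱 : Set (Set X), IsCover X 𝒱 ∧ (∀ V ∈ 𝒱, ∃ U ∈ 𝒰, V ⊆ U) ∧
      ∀ T : Finset (Set X), ↑T ⊆ 𝒱 → (⋂₀ (T : Set (Set X))).Nonempty → T.card ≤ n + 1

end CechPaper

open MeasureTheory

noncomputable instance (n : ℕ) : MeasurableSpace (EuclideanSpace ℂ (Fin n)) := borel _
instance (n : ℕ) : BorelSpace (EuclideanSpace ℂ (Fin n)) := ⟨rfl⟩

/-- The polynomially convex hull of a bounded set `K ⊂ ℂⁿ`: all points at which every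
polynomial in `n` complex variables is bounded by its supremum over `K`. -/
def polyHull {n : ℕ} (K : Set (EuclideanSpace ℂ (Fin n))) : Set (EuclideanSpace ℂ (Fin n)) :=
  {z | ∀ p : MvPolynomial (Fin n) ℂ,
    ‖MvPolynomial.eval (fun i => z i) p‖ ≤
      sSup ((fun w => ‖MvPolynomial.eval (fun i => w i) p‖) '' K)}

open CechPaper

namespace SmallCochain

variable {X : Type*} [MetricSpace X]

/-- `φ` satisfies the cocycle identity on `ε`-small quadruples. -/
def Cocycle (φ : X → X → X → ℤ) (ε : ℝ) : Prop :=
  ∀ a b c d, dist a b < ε → dist a c < ε → dist a d < ε → dist b c < ε → dist b d < ε →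
    dist c d < ε → φ b c d - φ a c d + φ a b d - φ a b c = 0

/-- `φ` is a coboundary on sufficiently small triples of points of `Y`. -/
def Triv (φ : X → X → X → ℤ) (Y : Set X) : Prop :=
  ∃ ψ : X → X → ℤ, ∃ η > 0, ∀ a ∈ Y, ∀ b ∈ Y, ∀ c ∈ Y, dist a b < η → dist a c < η →
    dist b c < η → φ a b c = ψ b c - ψ a c + ψ a b

/-- `ψ` is a coboundary on sufficiently small pairs of points of `Y`. -/
def Cob (ψ : X → X → ℤ) (Y : Set X) : Prop :=
  ∃ e : X → ℤ, ∃ η > 0, ∀ a ∈ Y, ∀ b ∈ Y, dist a b < η → ψ a b = e b - e a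

/-- Every small `1`-cocycle on `Y` is a coboundary. -/
def HOneZero (Y : Set X) : Prop :=
  ∀ ψ : X → X → ℤ, ∀ η > 0, (∀ a ∈ Y, ∀ b ∈ Y, ∀ c ∈ Y, dist a b < η → dist a c < η →
    dist b c < η → ψ b c - ψ a c + ψ a b = 0) → Cob ψ Y

theorem exists_dist_lt_of_isCompact {Y₁ Y₂ : Set X} (h₁ : IsCompact Y₁) (h₂ : IsCompact Y₂)
    {α : ℝ} (hα : 0 < α) :
    ∃ β > 0, ∀ x ∈ Y₁, ∀ y ∈ Y₂, dist x y < β → ∃ q ∈ Y₁ ∩ Y₂, dist x q < α ∧ dist y q < α := by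
  by_contra! H
  have H' : ∀ n : ℕ, ∃ p : X × X, p.1 ∈ Y₁ ∧ p.2 ∈ Y₂ ∧ dist p.1 p.2 < 1 / ((n : ℝ) + 1) ∧
      ∀ q ∈ Y₁ ∩ Y₂, dist p.1 q < α → α ≤ dist p.2 q := by
    intro n
    obtain ⟨x, hx, y, hy, hxy, h⟩ := H (1 / ((n : ℝ) + 1)) (by positivity)
    exact ⟨(x, y), hx, hy, hxy, h⟩
  choose p hp1 hp2 hp3 hp4 using H'
  obtain ⟨⟨x, y⟩, hxy, s, hs, hlim⟩ :=
    (h₁.prod h₂).tendsto_subseq (x := p) (fun n => ⟨hp1 n, hp2 n⟩)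
  have l1 : Filter.Tendsto (fun n => (p (s n)).1) Filter.atTop (nhds x) :=
    (continuous_fst.tendsto _).comp hlim
  have l2 : Filter.Tendsto (fun n => (p (s n)).2) Filter.atTop (nhds y) :=
    (continuous_snd.tendsto _).comp hlim
  have l3 := l1.dist l2
  have l4 : Filter.Tendsto (fun n => dist (p (s n)).1 (p (s n)).2) Filter.atTop (nhds 0) := by
    refine squeeze_zero (fun _ => dist_nonneg) (fun n => (hp3 (s n)).le) ?_
    exact tendsto_one_div_add_atTop_nhds_zero_nat.comp hs.tendsto_atTop
  have hxy0 : x = y := dist_eq_zero.1 (tendsto_nhds_unique l3 l4)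
  subst hxy0
  have e1 := (Metric.tendsto_nhds.1 l1 α hα)
  have e2 := (Metric.tendsto_nhds.1 l2 α hα)
  obtain ⟨n, hn1, hn2⟩ := (e1.and e2).exists
  exact absurd hn2 (not_lt.2 (hp4 (s n) x hxy hn1))

theorem triv_of_small {φ : X → X → X → ℤ} {ε : ℝ} (hφ : Cocycle φ ε) {Y : Set X}
    (hY : ∀ x ∈ Y, ∀ y ∈ Y, dist x y < ε) : Triv φ Y := by
  rcases Y.eq_empty_or_nonempty with rfl | ⟨p, hp⟩
  · exact ⟨fun _ _ => 0, 1, one_pos, by simp⟩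
  · refine ⟨fun x y => φ p x y, 1, one_pos, fun a ha b hb c hc _ _ _ => ?_⟩
    have := hφ p a b c (hY _ hp _ ha) (hY _ hp _ hb) (hY _ hp _ hc) (hY _ ha _ hb) (hY _ ha _ hc)
      (hY _ hb _ hc)
    linarith

theorem Triv.union {φ : X → X → X → ℤ} {ε : ℝ} (hε : 0 < ε) (hφ : Cocycle φ ε) {Y₁ Y₂ : Set X}
    (hY₁ : IsCompact Y₁) (hY₂ : IsCompact Y₂) (h₁ : Triv φ Y₁) (h₂ : Triv φ Y₂)
    (h₀ : HOneZero (Y₁ ∩ Y₂)) : Triv φ (Y₁ ∪ Y₂) := by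
  classical
  obtain ⟨ψ₁, η₁, hη₁, H₁⟩ := h₁
  obtain ⟨ψ₂, η₂, hη₂, H₂⟩ := h₂
  obtain ⟨e, η₃, hη₃, H₃⟩ := h₀ (fun x y => ψ₁ x y - ψ₂ x y) (min η₁ η₂) (lt_min hη₁ hη₂) (by
    intro a ha b hb c hc hab hac hbc
    have := H₁ a ha.1 b hb.1 c hc.1 (hab.trans_le (min_le_left _ _))
      (hac.trans_le (min_le_left _ _)) (hbc.trans_le (min_le_left _ _))
    have := H₂ a ha.2 b hb.2 c hc.2 (hab.trans_le (min_le_right _ _))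
      (hac.trans_le (min_le_right _ _)) (hbc.trans_le (min_le_right _ _))
    linarith)
  obtain ⟨m, hm, hmε, hm1, hm2, hm3⟩ : ∃ m > 0, m ≤ ε ∧ m ≤ η₁ ∧ m ≤ η₂ ∧ m ≤ η₃ :=
    ⟨min ε (min η₁ (min η₂ η₃)), by positivity, by simp, by simp, by simp, by simp⟩
  obtain ⟨β, hβ, Hβ⟩ := exists_dist_lt_of_isCompact hY₁ hY₂ (α := m / 4) (by positivity)
  have hr : ∀ y : X, ∃ r : X, dist y r < m / 4 ∧
      ((∃ q ∈ Y₁ ∩ Y₂, dist y q < m / 4) → r ∈ Y₁ ∩ Y₂) ∧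
      ((¬ ∃ q ∈ Y₁ ∩ Y₂, dist y q < m / 4) → r = y) := by
    intro y
    by_cases h : ∃ q ∈ Y₁ ∩ Y₂, dist y q < m / 4
    · obtain ⟨q, hq, hd⟩ := h
      exact ⟨q, hd, fun _ => hq, fun h' => absurd ⟨q, hq, hd⟩ h'⟩
    · exact ⟨y, by simpa using by positivity, fun h' => absurd h' h, fun _ => rfl⟩
  choose ρ hρd hρ0 hρid using hr
  have hρ1 : ∀ y ∈ Y₁, ρ y ∈ Y₁ := fun y hy => by
    by_cases h : ∃ q ∈ Y₁ ∩ Y₂, dist y q < m / 4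
    · exact (hρ0 y h).1
    · rwa [hρid y h]
  have hρ2 : ∀ y ∈ Y₂, ρ y ∈ Y₂ := fun y hy => by
    by_cases h : ∃ q ∈ Y₁ ∩ Y₂, dist y q < m / 4
    · exact (hρ0 y h).2
    · rwa [hρid y h]
  have key : ∀ x ∈ Y₁ ∪ Y₂, ∀ y ∈ Y₁ ∪ Y₂, dist x y < β → ρ x ∉ Y₁ → ρ y ∈ Y₂ := by
    intro x hx y hy hxy hx1
    by_contra hy2
    have hxY : x ∈ Y₂ := hx.resolve_left fun h => hx1 (hρ1 x h)
    have hyY : y ∈ Y₁ := hy.resolve_right fun h => hy2 (hρ2 y h)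
    obtain ⟨q, hq, hq1, hq2⟩ := Hβ y hyY x hxY (by rwa [dist_comm])
    exact hx1 (hρ0 x ⟨q, hq, hq2⟩).1
  let Ψ : X → X → ℤ := fun x y =>
    if ρ x ∈ Y₁ ∧ ρ y ∈ Y₁ then ψ₁ (ρ x) (ρ y)
    else ψ₂ (ρ x) (ρ y) + (e (ρ y) - e (ρ x))
  let h : X → X → ℤ := fun x y => φ x (ρ x) (ρ y) - φ x y (ρ y)
  have hdd : ∀ {x y}, dist x y < m / 4 → dist (ρ x) (ρ y) < m := by
    intro x y hxy
    have a1 := dist_triangle4 (ρ x) x y (ρ y)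
    have a2 := hρd x
    have a3 := hρd y
    rw [dist_comm] at a2
    linarith
  have hdd' : ∀ {x y}, dist x y < m / 4 → dist x (ρ y) < m := by
    intro x y hxy
    have a1 := dist_triangle x y (ρ y)
    have a3 := hρd y
    linarith
  have hΨ : ∀ x y, dist x y < m / 4 → ρ x ∈ Y₂ → ρ y ∈ Y₂ →
      Ψ x y = ψ₂ (ρ x) (ρ y) + (e (ρ y) - e (ρ x)) := by
    intro x y hxy hx hy
    by_cases hc : ρ x ∈ Y₁ ∧ ρ y ∈ Y₁
    · have := H₃ (ρ x) ⟨hc.1, hx⟩ (ρ y) ⟨hc.2, hy⟩ ((hdd hxy).trans_le hm3)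
      simp only [Ψ, if_pos hc]
      linarith
    · simp only [Ψ, if_neg hc]
  refine ⟨fun x y => Ψ x y - h x y, min β (m / 4), by positivity, ?_⟩
  intro a ha b hb c hc hab hac hbc
  obtain ⟨hab1, hab2⟩ := lt_min_iff.1 hab
  obtain ⟨hac1, hac2⟩ := lt_min_iff.1 hac
  obtain ⟨hbc1, hbc2⟩ := lt_min_iff.1 hbc
  have hΨδ : φ (ρ a) (ρ b) (ρ c) = Ψ b c - Ψ a c + Ψ a b := by
    by_cases hall : ρ a ∈ Y₁ ∧ ρ b ∈ Y₁ ∧ ρ c ∈ Y₁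
    · obtain ⟨ra, rb, rc⟩ := hall
      simp only [Ψ, ra, rb, rc, and_self, if_true]
      exact H₁ _ ra _ rb _ rc ((hdd hab2).trans_le hm1) ((hdd hac2).trans_le hm1)
        ((hdd hbc2).trans_le hm1)
    · have hall2 : ρ a ∈ Y₂ ∧ ρ b ∈ Y₂ ∧ ρ c ∈ Y₂ := by
        have hba1 := dist_comm a b ▸ hab1
        have hca1 := dist_comm a c ▸ hac1
        have hcb1 := dist_comm b c ▸ hbc1
        by_cases ra : ρ a ∈ Y₁
        · by_cases rb : ρ b ∈ Y₁
          · have rc : ρ c ∉ Y₁ := fun h => hall ⟨ra, rb, h⟩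
            exact ⟨key c hc a ha hca1 rc, key c hc b hb hcb1 rc,
              key c hc c hc (by simpa using hβ) rc⟩
          · exact ⟨key b hb a ha hba1 rb, key b hb b hb (by simpa using hβ) rb,
              key b hb c hc hbc1 rb⟩
        · exact ⟨key a ha a ha (by simpa using hβ) ra, key a ha b hb hab1 ra,
            key a ha c hc hac1 ra⟩
      obtain ⟨ra, rb, rc⟩ := hall2
      rw [hΨ b c hbc2 rb rc, hΨ a c hac2 ra rc, hΨ a b hab2 ra rb,
        H₂ _ ra _ rb _ rc ((hdd hab2).trans_le hm2) ((hdd hac2).trans_le hm2)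
        ((hdd hbc2).trans_le hm2)]
      ring
  have hs : ∀ x : X, dist x x < m / 4 := fun x => by rw [dist_self]; linarith
  have q1 := hφ a (ρ a) (ρ b) (ρ c) ((hdd' (hs a)).trans_le hmε) ((hdd' hab2).trans_le hmε)
    ((hdd' hac2).trans_le hmε) ((hdd hab2).trans_le hmε) ((hdd hac2).trans_le hmε)
    ((hdd hbc2).trans_le hmε)
  have q2 := hφ a b (ρ b) (ρ c) (by linarith) ((hdd' hab2).trans_le hmε)
    ((hdd' hac2).trans_le hmε) ((hdd' (hs b)).trans_le hmε) ((hdd' hbc2).trans_le hmε)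
    ((hdd hbc2).trans_le hmε)
  have q3 := hφ a b c (ρ c) (by linarith) (by linarith) ((hdd' hac2).trans_le hmε) (by linarith)
    ((hdd' hbc2).trans_le hmε) ((hdd' (hs c)).trans_le hmε)
  simp only [h]
  linarith

/-- A set that can be cut into small pieces along closed sets without first cohomology
carries only trivial small `2`-cocycles. -/
theorem triv_of_thin [CompactSpace X] {φ : X → X → X → ℤ} {ε : ℝ} (hε : 0 < ε)
    (hφ : Cocycle φ ε) {g : X → ℝ} (hg : Continuous g) {D : Set ℝ} (hD : Dense D)
    (hH : ∀ t ∈ D, ∀ Y : Set X, IsClosed Y → Y ⊆ g ⁻¹' {t} → HOneZero Y) {δ : ℝ} (hδ : 0 < δ)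
    {Y : Set X} (hY : IsClosed Y)
    (hthin : ∀ Y' ⊆ Y, IsClosed Y' → (∀ x ∈ Y', ∀ y ∈ Y', |g x - g y| < δ) → Triv φ Y') :
    Triv φ Y := by
  have main : ∀ n : ℕ, ∀ a : ℝ, ∀ Z ⊆ Y, IsClosed Z →
      (∀ x ∈ Z, a < g x ∧ g x < a + (n + 1) * (δ / 2)) → Triv φ Z := by
    intro n
    induction n with
    | zero =>
      intro a Z hZ hZc hb
      refine hthin Z hZ hZc fun x hx y hy => ?_
      have := hb x hx
      have := hb y hy
      rw [abs_lt]
      constructor <;> (norm_num at *; linarith)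
    | succ n ih =>
      intro a Z hZ hZc hb
      obtain ⟨t, ht, ht1, ht2⟩ := hD.exists_between
        (show a + n * (δ / 2) < a + (n + 1) * (δ / 2) by nlinarith)
      have hc1 : IsClosed (Z ∩ {x | g x ≤ t}) := hZc.inter (isClosed_le hg continuous_const)
      have hc2 : IsClosed (Z ∩ {x | t ≤ g x}) := hZc.inter (isClosed_le continuous_const hg)
      have hU : Z = (Z ∩ {x | g x ≤ t}) ∪ (Z ∩ {x | t ≤ g x}) := by
        ext x
        have := le_total (g x) t
        simp only [Set.mem_union, Set.mem_inter_iff, Set.mem_ofPred_eq]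
        tauto
      rw [hU]
      refine Triv.union hε hφ hc1.isCompact hc2.isCompact ?_ ?_ ?_
      · exact ih a _ (Set.inter_subset_left.trans hZ) hc1
          fun x hx => ⟨(hb x hx.1).1, lt_of_le_of_lt hx.2 ht2⟩
      · refine hthin _ (Set.inter_subset_left.trans hZ) hc2 fun x hx y hy => ?_
        have h1 := (hb x hx.1).2
        have h2 := (hb y hy.1).2
        have h3 : t ≤ g x := hx.2
        have h4 : t ≤ g y := hy.2
        push_cast at h1 h2
        rw [abs_lt]
        constructor <;> linarith
      · refine hH t ht _ (hc1.inter hc2) fun x hx => ?_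
        exact le_antisymm hx.1.2 hx.2.2
  obtain ⟨B, hB⟩ : ∃ B, ∀ x, |g x| ≤ B := by
    obtain ⟨B, hB⟩ := (isCompact_range hg).isBounded.exists_norm_le
    exact ⟨B, fun x => hB _ ⟨x, rfl⟩⟩
  obtain ⟨n, hn⟩ := exists_nat_gt ((2 * B + 2) / (δ / 2))
  rw [div_lt_iff₀ (by positivity)] at hn
  refine main n (-B - 1) Y subset_rfl hY fun x _ => ?_
  have := abs_le.1 (hB x)
  constructor <;> nlinarith

theorem triv_univ [CompactSpace X] {φ : X → X → X → ℤ} {ε : ℝ} (hε : 0 < ε)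
    (hφ : Cocycle φ ε) {m : ℕ} (g : Fin m → X → ℝ) (hg : ∀ i, Continuous (g i))
    (hsep : ∃ δ > 0, ∀ x y, (∀ i, |g i x - g i y| < δ) → dist x y < ε)
    (hH : ∀ i, ∃ D : Set ℝ, Dense D ∧
      ∀ t ∈ D, ∀ Y : Set X, IsClosed Y → Y ⊆ g i ⁻¹' {t} → HOneZero Y) :
    Triv φ Set.univ := by
  obtain ⟨δ, hδ, hsep⟩ := hsep
  have main : ∀ s : Finset (Fin m), ∀ Y : Set X, IsClosed Y →
      (∀ i ∉ s, ∀ x ∈ Y, ∀ y ∈ Y, |g i x - g i y| < δ) → Triv φ Y := by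
    intro s
    induction s using Finset.induction_on with
    | empty =>
      intro Y _ h
      exact triv_of_small hφ fun x hx y hy => hsep x y fun i => h i (by simp) x hx y hy
    | insert j s hj ih =>
      intro Y hY h
      obtain ⟨D, hD, hDH⟩ := hH j
      refine triv_of_thin hε hφ (hg j) hD hDH hδ hY fun Y' hY' hc hthin => ih Y' hc ?_
      intro i hi x hx y hy
      by_cases hij : i = j
      · subst hij; exact hthin x hx y hy
      · exact h i (by simp [hij, hi]) x (hY' hx) y (hY' hy)
  exact main Finset.univ _ isClosed_univ (by simp)

end SmallCochain

theorem Set.Finite.exists_dist_separated {X : Type*} [MetricSpace X] {s : Set X} (hs : s.Finite) :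
    ∃ r > 0, ∀ p ∈ s, ∀ q ∈ s, dist p q < r → p = q := by
  obtain ⟨C, hC, h⟩ := hs.relatively_discrete
  have hm : min C 1 ≠ ⊤ := (min_le_right C 1).trans_lt ENNReal.one_lt_top |>.ne
  have hm0 : 0 < min C 1 := lt_min hC one_pos
  refine ⟨(min C 1).toReal, ENNReal.toReal_pos hm0.ne' hm, fun p hp q hq hpq => ?_⟩
  by_contra hne
  have h1 := (min_le_left C 1).trans (h p hp q hq hne)
  rw [edist_dist, ← ENNReal.ofReal_toReal hm, ENNReal.ofReal_le_ofReal_iff dist_nonneg] at h1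
  linarith

namespace SmallCochain

variable {X : Type*} [MetricSpace X]

theorem exists_uniform_near_fiber [CompactSpace X] {Y : Set X} (hY : IsClosed Y) {g : X → ℝ}
    (hg : Continuous g) (τ : ℝ) {r : ℝ} (hr : 0 < r) :
    ∃ κ > 0, ∀ y ∈ Y, |g y - τ| < κ → ∃ p ∈ Y, g p = τ ∧ dist y p < r := by
  let U : Set X := {y | ∃ p ∈ Y, g p = τ ∧ dist y p < r}
  have hU : IsOpen U := by
    have : U = ⋃ p ∈ {p | p ∈ Y ∧ g p = τ}, Metric.ball p r := by
      ext y; simp [U, and_assoc]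
    rw [this]
    exact isOpen_biUnion fun _ _ => Metric.isOpen_ball
  have hC : IsCompact (Y \ U) := (hY.sdiff hU).isCompact
  rcases (Y \ U).eq_empty_or_nonempty with h | h
  · refine ⟨1, one_pos, fun y hy _ => ?_⟩
    by_contra hn
    exact (Set.eq_empty_iff_forall_notMem.1 h) y ⟨hy, hn⟩
  · obtain ⟨y₀, hy₀, hmin⟩ := hC.exists_isMinOn h
      (f := fun y => |g y - τ|) (by fun_prop)
    have hpos : 0 < |g y₀ - τ| := by
      rw [abs_pos, sub_ne_zero]
      intro h0
      exact hy₀.2 ⟨y₀, hy₀.1, h0, by simpa using hr⟩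
    refine ⟨_, hpos, fun y hy hlt => ?_⟩
    by_contra hn
    exact absurd hlt (not_lt.2 (hmin (show y ∈ Y \ U from ⟨hy, hn⟩)))

theorem cob_extend [CompactSpace X] {Y : Set X} (hY : IsClosed Y) {g : X → ℝ}
    (hg : Continuous g) (τ : ℝ) (hfin : {p ∈ Y | g p = τ}.Finite)
    (huniq : ∃ ρ > 0, ∃ δ > 0, ∀ s, 0 < s → s < δ → ∀ p ∈ Y, g p = τ → ∀ x ∈ Y, ∀ y ∈ Y,
      g x = τ - s → g y = τ - s → dist x p < ρ → dist y p < ρ → x = y)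
    {ψ : X → X → ℤ} {η : ℝ} (hη : 0 < η) (hψ : ∀ a ∈ Y, ∀ b ∈ Y, ∀ c ∈ Y, dist a b < η →
      dist a c < η → dist b c < η → ψ b c - ψ a c + ψ a b = 0) :
    ∃ κ > 0, ∀ a, τ - κ < a → a < τ → Cob ψ (Y ∩ {y | g y ≤ a}) →
      ∀ b, b < τ + κ → Cob ψ (Y ∩ {y | g y ≤ b}) := by
  classical
  obtain ⟨ρ, hρ, δ, hδ, huniq⟩ := huniq
  obtain ⟨r₀, hr₀, hsep⟩ := hfin.exists_dist_separated
  obtain ⟨r, hr, hrρ, hrη, hrr⟩ : ∃ r > 0, r ≤ ρ ∧ 2 * r ≤ η ∧ 3 * r ≤ r₀ :=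
    ⟨min ρ (min (η / 2) (r₀ / 3)), by positivity, by simp, by
      have : min ρ (min (η / 2) (r₀ / 3)) ≤ η / 2 := by simp
      linarith, by
      have : min ρ (min (η / 2) (r₀ / 3)) ≤ r₀ / 3 := by simp
      linarith⟩
  obtain ⟨κ, hκ, hnear⟩ := exists_uniform_near_fiber hY hg τ hr
  have hpc : ∀ y, ∃ p, y ∈ Y → |g y - τ| < κ → p ∈ Y ∧ g p = τ ∧ dist y p < r := by
    intro y
    by_cases h : y ∈ Y ∧ |g y - τ| < κ
    · obtain ⟨p, hp⟩ := hnear y h.1 h.2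
      exact ⟨p, fun _ _ => hp⟩
    · exact ⟨y, fun h1 h2 => absurd ⟨h1, h2⟩ h⟩
  choose P hP using hpc
  refine ⟨min κ δ, lt_min hκ hδ, ?_⟩
  rintro a ha1 ha2 ⟨e₁, η₁, hη₁, he₁⟩ b hb
  have haκ : τ - κ < a := by have := min_le_left κ δ; linarith
  have haδ : τ - δ < a := by have := min_le_right κ δ; linarith
  have hbκ : b < τ + κ := by have := min_le_left κ δ; linarith
  have hqc : ∀ p, ∃ q, ∀ q' ∈ Y, g q' = a → dist q' p < r → q = q' ∨ p ∉ Y ∨ g p ≠ τ := by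
    intro p
    by_cases h : ∃ q ∈ Y, g q = a ∧ dist q p < r
    · obtain ⟨q, hq, hqa, hqd⟩ := h
      refine ⟨q, fun q' hq' hqa' hqd' => ?_⟩
      by_cases hp : p ∈ Y ∧ g p = τ
      · left
        exact huniq (τ - a) (by linarith) (by linarith) p hp.1 hp.2 q hq q' hq' (by linarith)
          (by linarith) (by linarith) (by linarith)
      · right; tauto
    · push Not at h
      exact ⟨p, fun q' hq' hqa' hqd' => absurd hqd' (not_lt.2 (h q' hq' hqa'))⟩
  choose Q hQ using hqc
  let e : X → ℤ := fun y => if g y ≤ a then e₁ y else ψ (P y) y + (e₁ (Q (P y)) - ψ (P y) (Q (P y)))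
  obtain ⟨β, hβ, Hβ⟩ := exists_dist_lt_of_isCompact
    (Y₁ := Y ∩ {y | g y ≤ a}) (Y₂ := Y ∩ {y | a ≤ g y})
    (hY.inter (isClosed_le hg continuous_const)).isCompact
    (hY.inter (isClosed_le continuous_const hg)).isCompact (α := min r η₁) (by positivity)
  have hself : ∀ x ∈ Y, ψ x x = 0 := fun x hx => by
    have := hψ x hx x hx x hx (by simpa using hη) (by simpa using hη) (by simpa using hη)
    linarith
  have hanti : ∀ x ∈ Y, ∀ y ∈ Y, dist x y < η → ψ y x = - ψ x y := fun x hx y hy hxy => by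
    have := hψ x hx y hy x hx hxy (by simpa using hη) (by rwa [dist_comm])
    have := hself x hx
    linarith
  have hPP : ∀ y ∈ Y, a < g y → g y ≤ b → P y ∈ Y ∧ g (P y) = τ ∧ dist y (P y) < r :=
    fun y hy h1 h2 => hP y hy (by rw [abs_lt]; constructor <;> linarith)
  have mixed : ∀ x ∈ Y, ∀ y ∈ Y, g x ≤ a → a < g y → g y ≤ b → dist x y < β →
      dist x y < r → ψ x y = e y - e x := by
    intro x hx y hy hxa hya hyb hxy hxyr
    obtain ⟨q, hq, hq1, hq2⟩ := Hβ x ⟨hx, hxa⟩ y ⟨hy, hya.le⟩ hxy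
    have hqa : g q = a := le_antisymm hq.1.2 hq.2.2
    obtain ⟨hp1, hp2, hp3⟩ := hPP y hy hya hyb
    obtain ⟨hp1', hp2', hp3'⟩ := hP q hq.1.1 (by rw [abs_lt]; constructor <;> linarith)
    have hq1r := hq1.trans_le (min_le_left _ _)
    have hq2r := hq2.trans_le (min_le_left _ _)
    have hpp : P y = P q := by
      refine hsep _ ⟨hp1, hp2⟩ _ ⟨hp1', hp2'⟩ ?_
      have t1 := dist_triangle4 (P y) y q (P q)
      have t2 := dist_comm (P y) y
      linarith
    have hQq : Q (P y) = q := by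
      rcases hQ (P y) q hq.1.1 hqa (by rw [hpp]; exact hp3') with h | h | h
      · exact h
      · exact absurd hp1 h
      · exact absurd hp2 h
    have ex : e x = e₁ x := if_pos hxa
    have ey : e y = ψ (P y) y + (e₁ q - ψ (P y) q) := by
      simp only [e, if_neg (not_le.2 hya), hQq]
    have h1 := he₁ x ⟨hx, hxa⟩ q ⟨hq.1.1, hqa.le⟩ (hq1.trans_le (min_le_right _ _))
    have t2 := dist_comm (P y) y
    have t3 := dist_comm (P q) q
    have t4 := dist_comm q y
    have h2 := hψ (P y) hp1 q hq.1.1 y hy (by rw [hpp]; linarith) (by linarith) (by linarith)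
    have h3 := hψ x hx q hq.1.1 y hy (by linarith) (by linarith) (by linarith)
    rw [ex, ey]
    linarith
  refine ⟨e, min η₁ (min β r), by positivity, ?_⟩
  intro x hx y hy hxy
  obtain ⟨hxy1, hxyβr⟩ := lt_min_iff.1 hxy
  obtain ⟨hxyβ, hxyr⟩ := lt_min_iff.1 hxyβr
  have hx2 : g x ≤ b := hx.2
  have hy2 : g y ≤ b := hy.2
  rcases le_or_gt (g x) a with hxa | hxa <;> rcases le_or_gt (g y) a with hya | hya
  · simp only [e, if_pos hxa, if_pos hya]
    exact he₁ x ⟨hx.1, hxa⟩ y ⟨hy.1, hya⟩ hxy1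
  · exact mixed x hx.1 y hy.1 hxa hya hy2 hxyβ hxyr
  · have h1 := mixed y hy.1 x hx.1 hya hxa hx2 (by rwa [dist_comm]) (by rwa [dist_comm])
    have h2 := hanti x hx.1 y hy.1 (by linarith)
    linarith
  · obtain ⟨hp1, hp2, hp3⟩ := hPP x hx.1 hxa hx2
    obtain ⟨hp1', hp2', hp3'⟩ := hPP y hy.1 hya hy2
    have t2 := dist_comm (P x) x
    have t3 := dist_comm (P y) y
    have hpp : P x = P y := by
      refine hsep _ ⟨hp1, hp2⟩ _ ⟨hp1', hp2'⟩ ?_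
      have t1 := dist_triangle4 (P x) x y (P y)
      linarith
    simp only [e, if_neg (not_le.2 hxa), if_neg (not_le.2 hya), ← hpp]
    have h2 := hψ (P x) hp1 x hx.1 y hy.1 (by linarith) (by rw [hpp]; linarith) (by linarith)
    linarith

theorem hOneZero_of_fibers [CompactSpace X] {Y : Set X} (hY : IsClosed Y) {g : X → ℝ}
    (hg : Continuous g) (hfin : ∀ τ, {p ∈ Y | g p = τ}.Finite)
    (huniq : ∀ τ, ∃ ρ > 0, ∃ δ > 0, ∀ s, 0 < s → s < δ → ∀ p ∈ Y, g p = τ → ∀ x ∈ Y, ∀ y ∈ Y,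
      g x = τ - s → g y = τ - s → dist x p < ρ → dist y p < ρ → x = y) : HOneZero Y := by
  intro ψ η hη hψ
  obtain ⟨B, hB⟩ : ∃ B, ∀ x, |g x| ≤ B := by
    obtain ⟨B, hB⟩ := (isCompact_range hg).isBounded.exists_norm_le
    exact ⟨B, fun x => hB _ ⟨x, rfl⟩⟩
  let T : Set ℝ := {τ | Cob ψ (Y ∩ {y | g y ≤ τ})}
  have hdown : ∀ a ∈ T, ∀ b ≤ a, b ∈ T := by
    rintro a ⟨e, η, hη, h⟩ b hb
    exact ⟨e, η, hη, fun x hx y hy => h x ⟨hx.1, le_trans hx.2 hb⟩ y ⟨hy.1, le_trans hy.2 hb⟩⟩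
  have hne : T.Nonempty := by
    refine ⟨-B - 1, fun _ => 0, 1, one_pos, fun x hx => ?_⟩
    have := (abs_le.1 (hB x)).1
    have h2 : g x ≤ -B - 1 := hx.2
    linarith
  by_cases hbdd : BddAbove T
  · exfalso
    obtain ⟨κ, hκ, h⟩ := cob_extend hY hg (sSup T) (hfin _) (huniq _) hη hψ
    obtain ⟨a, haT, ha⟩ := exists_lt_of_lt_csSup hne (show sSup T - κ < sSup T by linarith)
    have ha' := le_csSup hbdd haT
    have hmem : (sSup T + κ / 2) ∈ T := by
      refine h ((sSup T - κ + a) / 2) (by linarith) (by linarith) ?_ _ (by linarith)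
      exact hdown a haT _ (by linarith)
    have := le_csSup hbdd hmem
    linarith
  · rw [not_bddAbove_iff] at hbdd
    obtain ⟨b, ⟨e, η', hη', h⟩, hb⟩ := hbdd B
    have hle : ∀ x, g x ≤ b := fun x => ((abs_le.1 (hB x)).2).trans hb.le
    exact ⟨e, η', hη', fun x hx y hy => h x ⟨hx, hle x⟩ y ⟨hy, hle y⟩⟩

end SmallCochain

namespace SmallCochain

open CechPaper

variable {X : Type*} [MetricSpace X]

theorem exists_cocycle_of_elem [CompactSpace X] (e : Elem X 1) :
    ∃ ε > 0, ∃ U : X → Set X, (∀ x, U x ∈ e.cov ∧ Metric.ball x ε ⊆ U x) ∧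
      Cocycle (fun a b c => e.coc ![U a, U b, U c]) ε := by
  obtain ⟨ε, hε, h⟩ := lebesgue_number_lemma_of_metric_sUnion (s := (Set.univ : Set X))
    isCompact_univ e.isCover.1 (fun x _ => by
      obtain ⟨U, hU, hx⟩ := e.isCover.2 x
      exact ⟨U, hU, hx⟩)
  choose U hU using fun x => h x (Set.mem_univ x)
  refine ⟨ε, hε, U, hU, ?_⟩
  intro a b c d hab hac had hbc hbd hcd
  have hrel : Relevant X e.cov ![U a, U b, U c, U d] := by
    refine ⟨fun j => ?_, a, ?_⟩
    · fin_cases j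
      exacts [(hU a).1, (hU b).1, (hU c).1, (hU d).1]
    · rw [Set.mem_iInter]
      intro j
      fin_cases j
      exacts [(hU a).2 (Metric.mem_ball_self hε), (hU b).2 hab, (hU c).2 hac, (hU d).2 had]
  have hco := e.isCocycle _ hrel
  have f0 : ![U a, U b, U c, U d] ∘ Fin.succAbove (0 : Fin 4) = ![U b, U c, U d] := by
    ext j : 1; fin_cases j <;> rfl
  have f1 : ![U a, U b, U c, U d] ∘ Fin.succAbove (1 : Fin 4) = ![U a, U c, U d] := by
    ext j : 1; fin_cases j <;> rfl
  have f2 : ![U a, U b, U c, U d] ∘ Fin.succAbove (2 : Fin 4) = ![U a, U b, U d] := by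
    ext j : 1; fin_cases j <;> rfl
  have f3 : ![U a, U b, U c, U d] ∘ Fin.succAbove (3 : Fin 4) = ![U a, U b, U c] := by
    ext j : 1; fin_cases j <;> rfl
  simp only [coboundary] at hco
  erw [Fin.sum_univ_four] at hco
  erw [f0, f1, f2, f3] at hco
  norm_num at hco
  linarith

theorem cechH2_subsingleton [CompactSpace X]
    (h : ∀ (φ : X → X → X → ℤ) (ε : ℝ), 0 < ε → Cocycle φ ε → Triv φ Set.univ) :
    Subsingleton (CechH2 X) := by
  classical
  refine ⟨fun a b => Quot.induction_on₂ a b fun e₁ e₂ => Quot.sound ?_⟩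
  obtain ⟨ε₁, hε₁, U₁, hU₁, hc₁⟩ := exists_cocycle_of_elem e₁
  obtain ⟨ε₂, hε₂, U₂, hU₂, hc₂⟩ := exists_cocycle_of_elem e₂
  obtain ⟨ψ, η, hη, hψ⟩ := h
    (fun a b c => e₁.coc ![U₁ a, U₁ b, U₁ c] - e₂.coc ![U₂ a, U₂ b, U₂ c]) (min ε₁ ε₂)
    (lt_min hε₁ hε₂) (by
      intro a b c d hab hac had hbc hbd hcd
      rw [lt_min_iff] at hab hac had hbc hbd hcd
      have h1 := hc₁ a b c d hab.1 hac.1 had.1 hbc.1 hbd.1 hcd.1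
      have h2 := hc₂ a b c d hab.2 hac.2 had.2 hbc.2 hbd.2 hcd.2
      dsimp only at h1 h2 ⊢
      linarith)
  obtain ⟨r, hr, hr1, hr2, hr3⟩ : ∃ r > 0, r ≤ ε₁ ∧ r ≤ ε₂ ∧ 2 * r ≤ η :=
    ⟨min (min ε₁ ε₂) (η / 2), by positivity, by simp, by simp, by
      have := min_le_right (min ε₁ ε₂) (η / 2); linarith⟩
  have hctr : ∀ W : Set X, ∃ x : Option X, W ∈ Set.range (fun x : X => Metric.ball x r) →
      ∃ y, x = some y ∧ W = Metric.ball y r := by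
    intro W
    by_cases hW : W ∈ Set.range (fun x : X => Metric.ball x r)
    · obtain ⟨y, hy⟩ := hW
      exact ⟨some y, fun _ => ⟨y, rfl, hy.symm⟩⟩
    · exact ⟨none, fun h => absurd h hW⟩
  choose ctr hctr using hctr
  let R : (X → Set X) → Set X → Set X := fun U W => (ctr W).elim ∅ U
  refine ⟨Set.range fun x : X => Metric.ball x r, R U₁, R U₂,
    fun τ => (ctr (τ 0)).elim 0 fun x => (ctr (τ 1)).elim 0 fun y => ψ x y, ?_, ?_, ?_, ?_⟩
  · refine ⟨?_, fun x => ⟨_, ⟨x, rfl⟩, Metric.mem_ball_self hr⟩⟩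
    rintro _ ⟨x, rfl⟩
    exact Metric.isOpen_ball
  · intro W hW
    obtain ⟨y, hy, hWy⟩ := hctr W hW
    simp only [R, hy, Option.elim]
    exact ⟨(hU₁ y).1, hWy ▸ (Metric.ball_subset_ball hr1).trans (hU₁ y).2⟩
  · intro W hW
    obtain ⟨y, hy, hWy⟩ := hctr W hW
    simp only [R, hy, Option.elim]
    exact ⟨(hU₂ y).1, hWy ▸ (Metric.ball_subset_ball hr2).trans (hU₂ y).2⟩
  · rintro σ ⟨hσ, z, hz⟩
    rw [Set.mem_iInter] at hz
    choose x hx hxb using fun j => hctr (σ j) (hσ j)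
    have hd : ∀ i j, dist (x i) (x j) < η := by
      intro i j
      have h1 := hz i
      have h2 := hz j
      rw [hxb i, Metric.mem_ball] at h1
      rw [hxb j, Metric.mem_ball] at h2
      have := dist_triangle_left (x i) (x j) z
      linarith
    have key := hψ (x 0) trivial (x 1) trivial (x 2) trivial (hd _ _) (hd _ _) (hd _ _)
    have g1 : R U₁ ∘ σ = ![U₁ (x 0), U₁ (x 1), U₁ (x 2)] := by
      ext j : 1; fin_cases j <;> simp [R, hx]
    have g2 : R U₂ ∘ σ = ![U₂ (x 0), U₂ (x 1), U₂ (x 2)] := by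
      ext j : 1; fin_cases j <;> simp [R, hx]
    rw [g1, g2]
    simp only [coboundary]
    erw [Fin.sum_univ_three]
    have s00 : (Fin.succAbove (0 : Fin 3) (0 : Fin 2)) = 1 := rfl
    have s01 : (Fin.succAbove (0 : Fin 3) (1 : Fin 2)) = 2 := rfl
    simp only [Function.comp]
    erw [s00, s01]
    simp only [hx, Option.elim]
    dsimp only at key
    rw [key]
    norm_num
    rfl

end SmallCochain

namespace ContinuumParam

open MeasureTheory Set Metric

variable {α : Type*} [MetricSpace α]

theorem le_hausdorffMeasure_inter_ball [MeasurableSpace α] [BorelSpace α] {E : Set α}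
    (hE : IsPreconnected E) {x y : α} (hx : x ∈ E) (hy : y ∈ E) {r : ℝ} (hr : r ≤ dist x y) :
    ENNReal.ofReal r ≤ μH[1] (E ∩ ball x r) := by
  have hsub : Ico 0 r ⊆ (fun z => dist z x) '' (E ∩ ball x r) := by
    intro s hs
    have h := hE.intermediate_value hx hy (f := fun z => dist z x) (by fun_prop)
    obtain ⟨z, hz, hzs⟩ := h (show s ∈ Icc (dist x x) (dist y x) from
      ⟨by simpa using hs.1, by rw [dist_comm]; exact hs.2.le.trans hr⟩)
    refine ⟨z, ⟨hz, ?_⟩, hzs⟩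
    rw [mem_ball]
    dsimp only at hzs
    rw [hzs]; exact hs.2
  calc ENNReal.ofReal r = volume (Ico 0 r) := by simp
    _ = μH[1] (Ico 0 r) := by rw [hausdorffMeasure_real]
    _ ≤ μH[1] ((fun z => dist z x) '' (E ∩ ball x r)) := measure_mono hsub
    _ ≤ μH[1] (E ∩ ball x r) := by
      have h1 : LipschitzWith 1 (fun z : α => dist z x) := LipschitzWith.dist_left x
      simpa using h1.hausdorffMeasure_image_le zero_le_one (E ∩ ball x r)

theorem card_mul_le [MeasurableSpace α] [BorelSpace α] {E : Set α} (hEc : IsCompact E)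
    (hE : IsPreconnected E) (hlen : μH[1] E < ⊤) {ε : ℝ} (hε : 0 < ε) {S : Finset α}
    (hS : ∀ x ∈ S, x ∈ E) (hsep : ∀ x ∈ S, ∀ y ∈ S, x ≠ y → ε ≤ dist x y) (h2 : 2 ≤ S.card) :
    S.card * (ε / 2) ≤ (μH[1] E).toReal := by
  have hball : ∀ x ∈ S, ENNReal.ofReal (ε / 2) ≤ μH[1] (E ∩ ball x (ε / 2)) := by
    intro x hx
    obtain ⟨y, hy, hyx⟩ := Finset.exists_mem_ne h2 x
    refine le_hausdorffMeasure_inter_ball hE (hS x hx) (hS y hy) ?_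
    have := hsep x hx y hy hyx.symm
    linarith
  have hdisj : PairwiseDisjoint (S : Set α) (fun x => E ∩ ball x (ε / 2)) := by
    intro x hx y hy hxy
    refine Disjoint.mono inter_subset_right inter_subset_right (ball_disjoint_ball ?_)
    have := hsep x hx y hy hxy
    linarith
  have hsum : (S.card : ENNReal) * ENNReal.ofReal (ε / 2) ≤ μH[1] E := by
    calc (S.card : ENNReal) * ENNReal.ofReal (ε / 2) = ∑ x ∈ S, ENNReal.ofReal (ε / 2) := by simp
      _ ≤ ∑ x ∈ S, μH[1] (E ∩ ball x (ε / 2)) := Finset.sum_le_sum hball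
      _ = μH[1] (⋃ x ∈ S, E ∩ ball x (ε / 2)) :=
        (measure_biUnion_finset hdisj fun x _ => hEc.measurableSet.inter measurableSet_ball).symm
      _ ≤ μH[1] E := measure_mono (iUnion₂_subset fun x _ => inter_subset_left)
  have := ENNReal.toReal_mono hlen.ne hsum
  rwa [ENNReal.toReal_mul, ENNReal.toReal_natCast, ENNReal.toReal_ofReal (by positivity)] at this

theorem exists_maximal_separated [MeasurableSpace α] [BorelSpace α] {E : Set α}
    (hEc : IsCompact E) (hE : IsConnected E) (hlen : μH[1] E < ⊤) {ε : ℝ} (hε : 0 < ε) :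
    ∃ S : Finset α, S.Nonempty ∧ (∀ x ∈ S, x ∈ E) ∧ (∀ x ∈ E, ∃ y ∈ S, dist x y < ε) ∧
      (S.card - 1) * ε ≤ 2 * (μH[1] E).toReal := by
  classical
  let P : ℕ → Prop := fun k => ∃ S : Finset α, S.card = k ∧ (∀ x ∈ S, x ∈ E) ∧
    ∀ x ∈ S, ∀ y ∈ S, x ≠ y → ε ≤ dist x y
  have hb : ∀ k, P k → (k - 1 : ℝ) * ε ≤ 2 * (μH[1] E).toReal := by
    rintro k ⟨S, rfl, hS, hsep⟩
    rcases lt_or_ge S.card 2 with h | h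
    · have h1 : (S.card : ℝ) ≤ 1 := by exact_mod_cast Nat.lt_succ_iff.1 h
      have : (S.card - 1 : ℝ) * ε ≤ 0 := mul_nonpos_of_nonpos_of_nonneg (by linarith) hε.le
      exact this.trans (by positivity)
    · have := card_mul_le hEc hE.isPreconnected hlen hε hS hsep h
      nlinarith
  obtain ⟨N, hN⟩ := exists_nat_gt (2 * (μH[1] E).toReal / ε + 1)
  have hbN : ∀ k, P k → k ≤ N := by
    intro k hk
    have h1 := hb k hk
    rw [← le_div_iff₀ hε] at h1
    have : (k : ℝ) < N := by linarith
    exact_mod_cast this.le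
  obtain ⟨p, hp⟩ := hE.nonempty
  have hP1 : P 1 := ⟨{p}, by simp, by simpa using hp, by simp⟩
  have hspec : P (Nat.findGreatest P N) := Nat.findGreatest_spec (hbN 1 hP1) hP1
  have h1le : 1 ≤ Nat.findGreatest P N := Nat.le_findGreatest (hbN 1 hP1) hP1
  have hbnd := hb _ hspec
  obtain ⟨S, hcard, hS, hsep⟩ := hspec
  refine ⟨S, Finset.card_pos.1 (by omega), hS, ?_, by rw [hcard]; exact hbnd⟩
  intro x hx
  by_contra! hn
  have hxS : x ∉ S := fun h => by have := hn x h; rw [dist_self] at this; linarith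
  have hPs : P (S.card + 1) := by
    refine ⟨insert x S, Finset.card_insert_of_notMem hxS, ?_, ?_⟩
    · intro y hy
      rcases Finset.mem_insert.1 hy with rfl | hy
      exacts [hx, hS y hy]
    · intro y hy z hz hyz
      rcases Finset.mem_insert.1 hy with rfl | hyS <;> rcases Finset.mem_insert.1 hz with rfl | hzS
      · exact absurd rfl hyz
      · exact hn z hzS
      · rw [dist_comm]; exact hn y hyS
      · exact hsep y hyS z hzS hyz
  have := Nat.le_findGreatest (hbN _ hPs) hPs
  omega

theorem exists_walk {E : Set α} (hE : IsPreconnected E) {ε : ℝ} {S : Finset α} (hne : S.Nonempty)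
    (hS : ∀ x ∈ S, x ∈ E) (hcov : ∀ x ∈ E, ∃ y ∈ S, dist x y < ε) :
    ∃ l : List α, l.IsChain (fun a b => dist a b ≤ 2 * ε) ∧ (∀ x, x ∈ l ↔ x ∈ S) ∧
      l.length + 1 ≤ 2 * S.card := by
  classical
  obtain ⟨p, hp⟩ := hne
  have main : ∀ n : ℕ, n + 1 ≤ S.card → ∃ l : List α, l.IsChain (fun a b => dist a b ≤ 2 * ε) ∧
      (∀ x ∈ l, x ∈ S) ∧ l.toFinset.card = n + 1 ∧ l.length = 2 * n + 1 := by
    intro n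
    induction n with
    | zero => intro _; exact ⟨[p], by simp, by simpa using hp, by simp, by simp⟩
    | succ n ih =>
      intro hn
      obtain ⟨l, hl, hlS, hlc, hll⟩ := ih (by omega)
      obtain ⟨a, ha, b, hbS, hbl, hab⟩ :
          ∃ a ∈ l, ∃ b ∈ S, b ∉ l ∧ dist a b ≤ 2 * ε := by
        by_contra! hcon
        let U : Set α := ⋃ a ∈ l.toFinset, closedBall a ε
        let V : Set α := ⋃ b ∈ S \ l.toFinset, closedBall b ε
        have hU : IsClosed U := l.toFinset.finite_toSet.isClosed_biUnion fun _ _ =>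
          isClosed_closedBall
        have hV : IsClosed V :=
          (S \ l.toFinset).finite_toSet.isClosed_biUnion fun _ _ => isClosed_closedBall
        have hε : 0 < ε := by
          obtain ⟨y, _, hy⟩ := hcov p (hS p hp)
          exact dist_nonneg.trans_lt hy
        have hsub : E ⊆ U ∪ V := by
          intro x hx
          obtain ⟨y, hy, hxy⟩ := hcov x hx
          by_cases h : y ∈ l
          · exact Or.inl (mem_biUnion (show y ∈ l.toFinset by simpa using h) hxy.le)
          · exact Or.inr (mem_biUnion (show y ∈ S \ l.toFinset by simp [hy, h]) hxy.le)
        obtain ⟨a, ha⟩ : ∃ a, a ∈ l := List.exists_mem_of_ne_nil l (by rintro rfl; simp at hll)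
        obtain ⟨b, hb⟩ : (S \ l.toFinset).Nonempty := by
          rw [← Finset.card_pos]
          have := Finset.le_card_sdiff l.toFinset S
          omega
        have hb' := Finset.mem_sdiff.1 hb
        obtain ⟨z, _, hzU, hzV⟩ := isPreconnected_closed_iff.1 hE U V hU hV hsub
          ⟨a, hS a (hlS a ha), mem_biUnion (show a ∈ l.toFinset by simpa using ha)
            (mem_closedBall_self hε.le)⟩
          ⟨b, hS b hb'.1, mem_biUnion hb (mem_closedBall_self hε.le)⟩
        simp only [U, V, mem_iUnion, mem_closedBall, exists_prop] at hzU hzV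
        obtain ⟨a', ha', haz⟩ := hzU
        obtain ⟨b', hb', hbz⟩ := hzV
        rw [Finset.mem_sdiff, List.mem_toFinset] at hb'
        have := hcon a' (by simpa using ha') b' hb'.1 hb'.2
        have := dist_triangle_left a' b' z
        linarith
      obtain ⟨l₁, l₂, rfl⟩ := List.append_of_mem ha
      refine ⟨l₁ ++ a :: b :: a :: l₂, ?_, ?_, ?_, ?_⟩
      · rw [List.isChain_append_cons_cons]
        rw [List.isChain_split] at hl
        refine ⟨hl.1, hab, ?_⟩
        rw [List.isChain_cons_cons]
        exact ⟨by rwa [dist_comm], hl.2⟩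
      · intro x hx
        simp only [List.mem_append, List.mem_cons] at hx
        rcases hx with h | rfl | rfl | rfl | h
        · exact hlS x (by simp [h])
        · exact hlS _ (by simp)
        · exact hbS
        · exact hlS _ (by simp)
        · exact hlS x (by simp [h])
      · have : (l₁ ++ a :: b :: a :: l₂).toFinset = insert b (l₁ ++ a :: l₂).toFinset := by
          ext x; simp
        rw [this, Finset.card_insert_of_notMem (by rwa [List.mem_toFinset]), hlc]
      · simp at hll ⊢; omega
  have hc : 0 < S.card := Finset.card_pos.2 ⟨p, hp⟩
  obtain ⟨l, h1, h2, h3, h4⟩ := main (S.card - 1) (by omega)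
  refine ⟨l, h1, fun x => ⟨h2 x, fun hx => ?_⟩, by omega⟩
  have : l.toFinset = S := Finset.eq_of_subset_of_card_le (fun y hy => h2 y (by simpa using hy))
    (by omega)
  rw [← this] at hx
  simpa using hx

end ContinuumParam

namespace ContinuumParam

open MeasureTheory Set Metric

variable {α : Type*} [MetricSpace α]

theorem exists_walk_fun [MeasurableSpace α] [BorelSpace α] {E : Set α}
    (hEc : IsCompact E) (hE : IsConnected E) (hlen : μH[1] E < ⊤) {ε : ℝ} (hε : 0 < ε) :
    ∃ M : ℕ, ∃ w : ℕ → α, (∀ i, w i ∈ E) ∧ (∀ i < M, dist (w i) (w (i + 1)) ≤ 2 * ε) ∧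
      (∀ x ∈ E, ∃ i ≤ M, dist x (w i) < ε) ∧ M * ε ≤ 4 * (μH[1] E).toReal := by
  obtain ⟨S, hne, hS, hcov, hcard⟩ := exists_maximal_separated hEc hE hlen hε
  obtain ⟨l, hl, hlS, hll⟩ := exists_walk hE.isPreconnected hne hS hcov
  obtain ⟨p, hp⟩ := hE.nonempty
  obtain ⟨q, hq⟩ := hne
  have hpos : 0 < l.length := List.length_pos_of_mem ((hlS q).2 hq)
  refine ⟨l.length - 1, fun i => l.getD i p, ?_, ?_, ?_, ?_⟩
  · intro i
    dsimp only
    rcases lt_or_ge i l.length with h | h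
    · rw [List.getD_eq_getElem _ _ h]
      exact hS _ ((hlS _).1 (List.getElem_mem h))
    · rw [List.getD_eq_default _ _ h]; exact hp
  · intro i hi
    dsimp only
    rw [List.getD_eq_getElem _ _ (by omega : i < l.length),
      List.getD_eq_getElem _ _ (by omega : i + 1 < l.length)]
    exact List.isChain_iff_getElem.1 hl i (by omega)
  · intro x hx
    obtain ⟨y, hy, hxy⟩ := hcov x hx
    obtain ⟨i, hi, rfl⟩ := List.mem_iff_getElem.1 ((hlS y).2 hy)
    refine ⟨i, by omega, ?_⟩
    dsimp only
    rwa [List.getD_eq_getElem _ _ hi]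
  · have h1 : ((l.length - 1 : ℕ) : ℝ) ≤ 2 * (S.card - 1) := by
      have h2 : 1 ≤ S.card := Finset.card_pos.2 ⟨q, hq⟩
      have : l.length - 1 ≤ 2 * (S.card - 1) := by omega
      calc ((l.length - 1 : ℕ) : ℝ) ≤ ((2 * (S.card - 1) : ℕ) : ℝ) := by exact_mod_cast this
        _ = 2 * (S.card - 1) := by push_cast [h2]; ring
    nlinarith

theorem dist_walk_le {w : ℕ → α} {M : ℕ} {ε : ℝ}
    (hw : ∀ i < M, dist (w i) (w (i + 1)) ≤ 2 * ε) {i j : ℕ} (hij : i ≤ j) (hj : j ≤ M) :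
    dist (w i) (w j) ≤ 2 * ε * (j - i) := by
  induction j, hij using Nat.le_induction with
  | base => simp
  | succ j hij ih =>
    have h1 := ih (by omega)
    have h2 := hw j (by omega)
    have := dist_triangle (w i) (w j) (w (j + 1))
    push_cast
    nlinarith

theorem exists_lipschitz_param [MeasurableSpace α] [BorelSpace α] {E : Set α}
    (hEc : IsCompact E) (hE : IsConnected E) (hlen : μH[1] E < ⊤) :
    ∃ K : NNReal, ∃ γ : ℝ → α, LipschitzWith K γ ∧ E ⊆ γ '' Icc 0 1 := by
  have hε : ∀ n : ℕ, (0 : ℝ) < 1 / (n + 1) := fun n => by positivity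
  choose M w hwE hwd hwc hM using fun n => exists_walk_fun hEc hE hlen (hε n)
  let L : ℝ := 8 * (μH[1] E).toReal
  let γ : ℕ → ℝ → α := fun n τ => w n ⌊τ * M n⌋₊
  have hfl : ∀ n, ∀ τ ∈ Icc (0 : ℝ) 1, ⌊τ * M n⌋₊ ≤ M n := by
    intro n τ hτ
    refine Nat.floor_le_of_le ?_
    have : (0 : ℝ) ≤ M n := by positivity
    nlinarith [hτ.2]
  have hγ : ∀ n, ∀ τ ∈ Icc (0 : ℝ) 1, ∀ τ' ∈ Icc (0 : ℝ) 1, τ ≤ τ' →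
      dist (γ n τ) (γ n τ') ≤ L * (τ' - τ) + 2 * (1 / (n + 1)) := by
    intro n τ hτ τ' hτ' hle
    have hMn : (0 : ℝ) ≤ M n := by positivity
    have h1 := dist_walk_le (hwd n) (Nat.floor_mono (mul_le_mul_of_nonneg_right hle hMn))
      (hfl n τ' hτ')
    have h2 : (⌊τ' * M n⌋₊ : ℝ) ≤ τ' * M n := Nat.floor_le (mul_nonneg hτ'.1 hMn)
    have h3 : τ * M n < ⌊τ * M n⌋₊ + 1 := Nat.lt_floor_add_one _
    have h4 := hM n
    have h5 := hε n
    calc dist (γ n τ) (γ n τ') ≤ 2 * (1 / (n + 1)) * (⌊τ' * M n⌋₊ - ⌊τ * M n⌋₊) := h1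
      _ ≤ 2 * (1 / (n + 1)) * ((τ' - τ) * M n + 1) := by gcongr; linarith
      _ = 2 * (M n * (1 / (n + 1))) * (τ' - τ) + 2 * (1 / (n + 1)) := by ring
      _ ≤ 2 * (4 * (μH[1] E).toReal) * (τ' - τ) + 2 * (1 / (n + 1)) := by
        gcongr
      _ = L * (τ' - τ) + 2 * (1 / (n + 1)) := by simp only [L]; ring
  let 𝒰 : Ultrafilter ℕ := Ultrafilter.of Filter.atTop
  have h𝒰 : (𝒰 : Filter ℕ) ≤ Filter.atTop := Ultrafilter.of_le _
  have hlim : ∀ τ, ∃ x ∈ E, Filter.Tendsto (fun n => γ n τ) 𝒰 (nhds x) := by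
    intro τ
    obtain ⟨x, hx, h⟩ := hEc.ultrafilter_le_nhds (𝒰.map fun n => γ n τ) 
      (Filter.le_principal_iff.2 (Filter.mem_map.2 (Filter.Eventually.of_forall fun n => hwE n _)))
    exact ⟨x, hx, h⟩
  choose Γ hΓE hΓ using hlim
  have hε0 : Filter.Tendsto (fun n : ℕ => (1 : ℝ) / (n + 1)) 𝒰 (nhds 0) :=
    tendsto_one_div_add_atTop_nhds_zero_nat.mono_left h𝒰
  have hL : 0 ≤ L := by positivity
  have hlip' : ∀ τ ∈ Icc (0 : ℝ) 1, ∀ τ' ∈ Icc (0 : ℝ) 1, τ ≤ τ' →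
      dist (Γ τ) (Γ τ') ≤ L * (τ' - τ) := by
    intro τ hτ τ' hτ' hle
    have h1 := (hΓ τ).dist (hΓ τ')
    have h2 : Filter.Tendsto (fun n : ℕ => L * (τ' - τ) + 2 * (1 / ((n : ℝ) + 1))) 𝒰
        (nhds (L * (τ' - τ) + 2 * 0)) := (hε0.const_mul 2).const_add _
    rw [mul_zero, add_zero] at h2
    exact le_of_tendsto_of_tendsto' h1 h2 fun n => hγ n τ hτ τ' hτ' hle
  have hlip : LipschitzOnWith L.toNNReal Γ (Icc 0 1) := by
    refine LipschitzOnWith.of_dist_le_mul fun τ hτ τ' hτ' => ?_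
    rw [Real.coe_toNNReal _ hL, Real.dist_eq]
    rcases le_total τ τ' with h | h
    · rw [abs_sub_comm, abs_of_nonneg (by linarith)]
      exact hlip' τ hτ τ' hτ' h
    · rw [dist_comm, abs_of_nonneg (by linarith)]
      exact hlip' τ' hτ' τ hτ h
  refine ⟨L.toNNReal, fun τ => Γ (projIcc 0 1 zero_le_one τ), ?_, ?_⟩
  · have := hlip.to_restrict.comp (LipschitzWith.projIcc (zero_le_one' ℝ))
    rw [mul_one] at this
    exact this
  · intro x hx
    choose i hi hxi using fun n => hwc n x hx
    let τ : ℕ → ℝ := fun n => (i n : ℝ) / M n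
    have hτ : ∀ n, τ n ∈ Icc (0 : ℝ) 1 := fun n =>
      ⟨by positivity, div_le_one_of_le₀ (by exact_mod_cast hi n) (by positivity)⟩
    have hγτ : ∀ n, γ n (τ n) = w n (i n) := by
      intro n
      have : ⌊τ n * M n⌋₊ = i n := by
        rcases Nat.eq_zero_or_pos (M n) with h0 | h0
        · have := hi n
          simp [τ, h0]; omega
        · have : τ n * M n = i n := by simp only [τ]; field_simp
          rw [this, Nat.floor_natCast]
      simp only [γ, this]
    obtain ⟨σ, hσ, hτσ⟩ := isCompact_Icc.ultrafilter_le_nhds (𝒰.map τ) 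
      (Filter.le_principal_iff.2 (Filter.mem_map.2 (Filter.Eventually.of_forall hτ)))
    have hτσ' : Filter.Tendsto τ 𝒰 (nhds σ) := hτσ
    refine ⟨σ, hσ, ?_⟩
    dsimp only
    rw [projIcc_of_mem _ hσ]
    have hb : ∀ n, dist (γ n σ) x ≤ L * |τ n - σ| + 3 * (1 / (n + 1)) := by
      intro n
      have h1 := hxi n
      rw [← hγτ n, dist_comm] at h1
      have h2 : dist (γ n σ) (γ n (τ n)) ≤ L * |τ n - σ| + 2 * (1 / (n + 1)) := by
        rcases le_total σ (τ n) with h | h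
        · rw [abs_of_nonneg (by linarith)]
          exact hγ n σ hσ _ (hτ n) h
        · rw [dist_comm, abs_sub_comm, abs_of_nonneg (by linarith)]
          exact hγ n _ (hτ n) σ hσ h
      have := dist_triangle (γ n σ) (γ n (τ n)) x
      linarith
    have h0 : Filter.Tendsto (fun n : ℕ => L * |τ n - σ| + 3 * (1 / ((n : ℝ) + 1))) 𝒰
        (nhds (L * |σ - σ| + 3 * 0)) :=
      (((hτσ'.sub_const σ).abs).const_mul L).add (hε0.const_mul 3)
    have h1 := (hΓ σ).dist (tendsto_const_nhds (x := x))
    have h2 := le_of_tendsto_of_tendsto' h1 h0 hb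
    simp only [sub_self, abs_zero, mul_zero, add_zero] at h2
    exact dist_le_zero.1 h2

end ContinuumParam

section

open MeasureTheory Set Metric Filter Topology

theorem LipschitzWith.volume_image_eq_zero {φ : ℝ → ℝ} {K : NNReal} (hφ : LipschitzWith K φ)
    {N : Set ℝ} (hN : volume N = 0) : volume (φ '' N) = 0 := by
  have := hφ.hausdorffMeasure_image_le zero_le_one N
  rw [hausdorffMeasure_real, hN, mul_zero] at this
  exact le_antisymm this zero_le

theorem LipschitzWith.ae_regular_value {φ : ℝ → ℝ} {K : NNReal} (hφ : LipschitzWith K φ) :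
    ∀ᵐ t, ∀ τ, φ τ = t → DifferentiableAt ℝ φ τ ∧ deriv φ τ ≠ 0 := by
  have h1 : volume (φ '' {τ | ¬ DifferentiableAt ℝ φ τ}) = 0 :=
    hφ.volume_image_eq_zero hφ.ae_differentiableAt
  have h2 : volume (φ '' {τ | DifferentiableAt ℝ φ τ ∧ deriv φ τ = 0}) = 0 := by
    refine addHaar_image_eq_zero_of_det_fderivWithin_eq_zero volume (f' := fun _ => 0) ?_ ?_
    · rintro τ ⟨hd, h0⟩
      have := hd.hasDerivAt.hasFDerivAt
      rw [h0] at this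
      rw [ContinuousLinearMap.toSpanSingleton_zero] at this
      exact this.hasFDerivWithinAt
    · intro τ _
      simp [ContinuousLinearMap.det]
  have h3 := measure_union_null h1 h2
  have h4 : ∀ᵐ t, t ∉ φ '' {τ | ¬ DifferentiableAt ℝ φ τ} ∪
      φ '' {τ | DifferentiableAt ℝ φ τ ∧ deriv φ τ = 0} := measure_eq_zero_iff_ae_notMem.1 h3
  filter_upwards [h4] with t ht τ hτ
  by_cases hd : DifferentiableAt ℝ φ τ
  · exact ⟨hd, fun h0 => ht (Or.inr ⟨τ, ⟨hd, h0⟩, hτ⟩)⟩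
  · exact absurd (Or.inl ⟨τ, hd, hτ⟩) ht

theorem LipschitzWith.ae_finite_fiber {φ : ℝ → ℝ} {K : NNReal} (hφ : LipschitzWith K φ) :
    ∀ᵐ t, {τ ∈ Icc (0 : ℝ) 1 | φ τ = t}.Finite := by
  filter_upwards [hφ.ae_regular_value] with t ht
  have hc : IsCompact {τ ∈ Icc (0 : ℝ) 1 | φ τ = t} :=
    isCompact_Icc.inter_right (isClosed_eq hφ.continuous continuous_const)
  refine hc.finite (isDiscrete_iff_nhdsNE.2 fun τ hτ => ?_)
  obtain ⟨hd, h0⟩ := ht τ hτ.2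
  have h1 := hd.hasDerivAt.eventually_ne (c := φ τ) h0
  rw [Filter.inf_principal_eq_bot]
  filter_upwards [h1] with z hz hzS
  exact hz (hzS.2.trans hτ.2.symm)

theorem LipschitzWith.ae_cone {F : ℝ → ℂ} {K : NNReal} (hF : LipschitzWith K F) :
    ∀ᵐ t, ∀ c : ℂ, c.re = t → ∃ κ > 0, ∃ h > 0, ∀ τ ∈ Icc (0 : ℝ) 1, ‖F τ - c‖ < h →
      κ * |(F τ - c).im| ≤ |(F τ - c).re| := by
  have hre : LipschitzWith K (fun τ => (F τ).re) := by
    have : LipschitzWith 1 Complex.re := by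
      refine LipschitzWith.of_dist_le_mul fun x y => ?_
      rw [Real.dist_eq, ← Complex.sub_re, dist_eq_norm]
      simpa using Complex.abs_re_le_norm (x - y)
    have := this.comp hF
    rw [one_mul] at this
    exact this
  filter_upwards [hre.ae_regular_value] with t ht c hc
  have main : ∃ κ > 0, ∃ h > 0, ∀ τ ∈ Icc (0 : ℝ) 1, ‖F τ - c‖ < h →
      κ * |(F τ - c).im| ≤ |(F τ - c).re| := by
    refine isCompact_Icc.induction_on (p := fun s => ∃ κ > 0, ∃ h > 0, ∀ τ ∈ s, ‖F τ - c‖ < h →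
      κ * |(F τ - c).im| ≤ |(F τ - c).re|) ⟨1, one_pos, 1, one_pos, by simp⟩ ?_ ?_ ?_
    · rintro s s' hs ⟨κ, hκ, h, hh, H⟩
      exact ⟨κ, hκ, h, hh, fun τ hτ => H τ (hs hτ)⟩
    · rintro s s' ⟨κ, hκ, h, hh, H⟩ ⟨κ', hκ', h', hh', H'⟩
      refine ⟨min κ κ', lt_min hκ hκ', min h h', lt_min hh hh', ?_⟩
      rintro τ (hτ | hτ) hlt
      · exact (mul_le_mul_of_nonneg_right (min_le_left _ _) (abs_nonneg _)).trans
          (H τ hτ (hlt.trans_le (min_le_left _ _)))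
      · exact (mul_le_mul_of_nonneg_right (min_le_right _ _) (abs_nonneg _)).trans
          (H' τ hτ (hlt.trans_le (min_le_right _ _)))
    · intro τ _
      by_cases hFc : F τ = c
      · obtain ⟨hd, h0⟩ := ht τ (by rw [hFc, hc])
        set d := deriv (fun τ => (F τ).re) τ
        have hK : 0 < |d| / (2 * (K + 1)) := by positivity
        have hev : ∀ᶠ x in 𝓝 τ, |d| / 2 * |x - τ| ≤ |(F x - c).re| := by
          have := (hasDerivAt_iff_isLittleO.1 hd.hasDerivAt).def
            (show 0 < |d| / 2 by positivity)
          filter_upwards [this] with x hx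
          simp only [Real.norm_eq_abs, smul_eq_mul] at hx
          have h1 : (F x - c).re = (F x).re - (F τ).re := by rw [hFc]; simp
          rw [h1]
          have h2 := abs_sub_abs_le_abs_sub ((x - τ) * d) ((F x).re - (F τ).re)
          rw [abs_mul, abs_sub_comm ((x - τ) * d)] at h2
          nlinarith
        refine ⟨_, mem_nhdsWithin_of_mem_nhds hev, |d| / (2 * (K + 1)), hK, 1, one_pos, ?_⟩
        intro x hx _
        refine le_trans ?_ (hx : _ ≤ _)
        have h3 : |(F x - c).im| ≤ K * |x - τ| := by
          refine (Complex.abs_im_le_norm _).trans ?_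
          have := hF.dist_le_mul x τ
          rwa [dist_eq_norm, hFc, Real.dist_eq] at this
        have hK0 : (0 : ℝ) ≤ K := K.2
        calc |d| / (2 * (K + 1)) * |(F x - c).im| ≤ |d| / (2 * (K + 1)) * ((K + 1) * |x - τ|) := by
              gcongr
              nlinarith [abs_nonneg (x - τ)]
          _ = |d| / 2 * |x - τ| := by field_simp
      · have hpos : 0 < ‖F τ - c‖ := norm_pos_iff.2 (sub_ne_zero.2 hFc)
        have hev : ∀ᶠ x in 𝓝 τ, ‖F τ - c‖ / 2 < ‖F x - c‖ := by
          have hcont : Continuous fun x => ‖F x - c‖ := by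
            have := hF.continuous
            fun_prop
          exact hcont.continuousAt.eventually (lt_mem_nhds (by linarith))
        refine ⟨_, mem_nhdsWithin_of_mem_nhds hev, 1, one_pos, ‖F τ - c‖ / 2, by positivity, ?_⟩
        intro x hx hlt
        exact absurd hlt (not_lt.2 (hx : _ < _).le)
  exact main

end

section

open MeasureTheory Set Metric Filter Topology

/-- A linear functional on polynomials dominated by the maximum over a nonempty compact space
extends to a probability measure. -/
theorem exists_probability_of_le {V α : Type*} [AddCommGroup V] [Module ℝ V] [TopologicalSpace α]
    [CompactSpace α] [T2Space α] [MeasurableSpace α] [BorelSpace α]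
    (A : V →ₗ[ℝ] C(α, ℝ)) (φ : V →ₗ[ℝ] ℝ) (h : ∀ v C, (∀ x, A v x ≤ C) → φ v ≤ C)
    (v₁ : V) (hv₁ : A v₁ = 1) (hφ₁ : φ v₁ = 1) :
    ∃ μ : Measure α, IsProbabilityMeasure μ ∧ ∀ v, ∫ x, A v x ∂μ = φ v := by
  have hne : Nonempty α := by
    by_contra hα
    rw [not_nonempty_iff] at hα
    have := h v₁ 0 (fun x => (hα.false x).elim)
    linarith
  have hbdd : ∀ u : C(α, ℝ), BddAbove (range u) := fun u =>
    (isCompact_range u.continuous).bddAbove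
  obtain ⟨s, hs⟩ := A.rangeRestrict.exists_rightInverse_of_surjective A.range_rangeRestrict
  have hAs : ∀ u : LinearMap.range A, A (s u) = u := fun u => by
    have := LinearMap.congr_fun hs u
    exact congrArg Subtype.val this
  obtain ⟨g, hg1, hg2⟩ := exists_extension_of_le_sublinear
    ⟨LinearMap.range A, φ ∘ₗ s⟩ (fun u : C(α, ℝ) => ⨆ x, u x)
    (fun c hc u => by simp [Real.mul_iSup_of_nonneg hc.le])
    (fun u w => ciSup_le fun x => add_le_add (le_ciSup (hbdd u) x) (le_ciSup (hbdd w) x))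
    (fun u => h _ _ fun x => by
      rw [hAs]
      exact le_ciSup (hbdd _) x)
  have hker : ∀ v, A v = 0 → φ v = 0 := by
    intro v hv
    have h1 := h v 0 (by simp [hv])
    have h2 := h (-v) 0 (by simp [hv])
    rw [map_neg] at h2
    linarith
  have hgA : ∀ v, g (A v) = φ v := by
    intro v
    have h1 := hg1 ⟨A v, v, rfl⟩
    have h2 := hker (s ⟨A v, v, rfl⟩ - v) (by rw [map_sub, hAs, sub_self])
    rw [map_sub, sub_eq_zero] at h2
    exact h1.trans h2
  have hpos : ∀ u : C(α, ℝ), 0 ≤ u → 0 ≤ g u := by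
    intro u hu
    have h1 : g (-u) ≤ _ := hg2 (-u)
    have h2 : (⨆ x, (-u) x) ≤ 0 := ciSup_le fun x => by
      have := hu x
      simpa using this
    rw [map_neg] at h1
    linarith
  let Λ : CompactlySupportedContinuousMap α ℝ →ₚ[ℝ] ℝ :=
    PositiveLinearMap.mk₀ (g ∘ₗ
      { toFun := fun u => u.toContinuousMap, map_add' := fun _ _ => rfl,
        map_smul' := fun _ _ => rfl }) (fun u hu => hpos _ fun x => hu x)
  have hInt : ∀ v, ∫ x, A v x ∂(RealRMK.rieszMeasure Λ) = φ v := fun v =>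
    (RealRMK.integral_rieszMeasure Λ
      (CompactlySupportedContinuousMap.continuousMapEquiv (A v))).trans (hgA v)
  refine ⟨RealRMK.rieszMeasure Λ, ⟨?_⟩, hInt⟩
  have h1 := hInt v₁
  simp only [hv₁, hφ₁, ContinuousMap.one_apply, integral_const, smul_eq_mul, mul_one,
    Measure.real] at h1
  rwa [ENNReal.toReal_eq_one_iff] at h1

section Poly

variable {n : ℕ}

/-- Evaluation of a polynomial at a point of `ℂⁿ`. -/
noncomputable def polyEval (p : MvPolynomial (Fin n) ℂ) (x : EuclideanSpace ℂ (Fin n)) : ℂ :=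
  MvPolynomial.eval (fun i => x i) p

theorem polyEval_real_smul (c : ℝ) (p : MvPolynomial (Fin n) ℂ) (x : EuclideanSpace ℂ (Fin n)) :
    polyEval (c • p) x = c * polyEval p x := by
  rw [RCLike.real_smul_eq_coe_smul (K := ℂ) c p, polyEval, MvPolynomial.smul_eval]
  rfl

theorem continuous_polyEval (p : MvPolynomial (Fin n) ℂ) : Continuous (polyEval p) := by
  have : Continuous fun x : EuclideanSpace ℂ (Fin n) => fun i => x i := by fun_prop
  exact (MvPolynomial.continuous_eval p).comp this

theorem norm_polyEval_le {Γ : Set (EuclideanSpace ℂ (Fin n))} {x : EuclideanSpace ℂ (Fin n)}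
    (hx : x ∈ polyHull Γ) (p : MvPolynomial (Fin n) ℂ) {C : ℝ} (hC : 0 ≤ C)
    (h : ∀ y ∈ Γ, ‖polyEval p y‖ ≤ C) : ‖polyEval p x‖ ≤ C := by
  refine (hx p).trans (Real.sSup_le ?_ hC)
  rintro _ ⟨y, hy, rfl⟩
  exact h y hy

theorem re_polyEval_le {Γ : Set (EuclideanSpace ℂ (Fin n))} (hΓ : IsCompact Γ)
    {x : EuclideanSpace ℂ (Fin n)}
    (hx : x ∈ polyHull Γ) (p : MvPolynomial (Fin n) ℂ) {C : ℝ}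
    (h : ∀ y ∈ Γ, (polyEval p y).re ≤ C) : (polyEval p x).re ≤ C := by
  by_contra! hlt
  obtain ⟨b, hb⟩ := hΓ.exists_bound_of_continuousOn (continuous_polyEval p).continuousOn
  set d := (polyEval p x).re - C with hd
  have hd0 : 0 < d := by linarith
  set R : ℝ := max |b| |C| + |C| + b ^ 2 / d with hR
  have hR1 : |b| ≤ R := by
    have := le_max_left |b| |C|
    have : 0 ≤ b ^ 2 / d := by positivity
    linarith [abs_nonneg C]
  have hRC : |C| ≤ R := by
    have := le_max_right |b| |C|
    have : 0 ≤ b ^ 2 / d := by positivity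
    linarith [abs_nonneg C]
  have hR2 : b ^ 2 ≤ d * (R + C) := by
    have h1 : b ^ 2 / d ≤ R + C := by
      have := neg_abs_le C
      have := (abs_nonneg b).trans (le_max_left |b| |C|)
      linarith
    rwa [div_le_iff₀ hd0, mul_comm] at h1
  have hRC' : 0 ≤ R + C := by linarith [neg_abs_le C]
  have key := norm_polyEval_le hx (p + MvPolynomial.C (R : ℂ))
    (C := Real.sqrt ((R + C) ^ 2 + b ^ 2)) (Real.sqrt_nonneg _) ?_
  · have h1 : polyEval (p + MvPolynomial.C (R : ℂ)) x = polyEval p x + R := by simp [polyEval]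
    rw [h1] at key
    have h2 := (Complex.re_le_norm _).trans key
    have h3 : (polyEval p x + (R : ℂ)).re = R + C + d := by
      simp [hd]; ring
    rw [h3] at h2
    have h4 := Real.le_sqrt' (by linarith) |>.1 h2
    nlinarith
  · intro y hy
    have h1 : polyEval (p + MvPolynomial.C (R : ℂ)) y = polyEval p y + R := by simp [polyEval]
    rw [h1]
    refine Real.le_sqrt_of_sq_le ?_
    rw [Complex.sq_norm, Complex.normSq_apply]
    have h2 := hb y hy
    have h3 := (Complex.abs_re_le_norm (polyEval p y)).trans h2
    have h4 := (Complex.abs_im_le_norm (polyEval p y)).trans h2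
    have h5 := h y hy
    simp only [Complex.add_re, Complex.ofReal_re, Complex.add_im, Complex.ofReal_im, add_zero]
    have h6 : (polyEval p y).im * (polyEval p y).im ≤ b ^ 2 := by
      nlinarith [abs_mul_abs_self (polyEval p y).im, abs_nonneg (polyEval p y).im]
    have h7 : 0 ≤ (polyEval p y).re + R := by
      have := neg_abs_le (polyEval p y).re
      have := le_abs_self b
      linarith
    nlinarith

theorem exists_repr_measure {Γ : Set (EuclideanSpace ℂ (Fin n))} (hΓ : IsCompact Γ)
    {x : EuclideanSpace ℂ (Fin n)} (hx : x ∈ polyHull Γ) :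
    ∃ μ : Measure Γ, IsProbabilityMeasure μ ∧ ∀ p, ∫ y : Γ, polyEval p y ∂μ = polyEval p x := by
  have : CompactSpace Γ := isCompact_iff_compactSpace.1 hΓ
  let A : MvPolynomial (Fin n) ℂ →ₗ[ℝ] C(Γ, ℝ) :=
    { toFun := fun p => ⟨fun y => (polyEval p y).re, by
        have := continuous_polyEval p
        fun_prop⟩
      map_add' := fun p q => by ext; simp [polyEval]
      map_smul' := fun c p => by ext; simp [polyEval_real_smul] }
  let φ : MvPolynomial (Fin n) ℂ →ₗ[ℝ] ℝ :=
    { toFun := fun p => (polyEval p x).re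
      map_add' := fun p q => by simp [polyEval]
      map_smul' := fun c p => by simp [polyEval_real_smul] }
  obtain ⟨μ, hμ, h⟩ := exists_probability_of_le A φ
    (fun p C hC => re_polyEval_le hΓ hx p fun y hy => hC ⟨y, hy⟩) 1
    (by ext; simp [A, polyEval]) (by simp [φ, polyEval])
  have hre : ∀ p, ∫ y : Γ, (polyEval p y).re ∂μ = (polyEval p x).re := h
  refine ⟨μ, hμ, fun p => ?_⟩
  have hcont : Continuous fun y : Γ => polyEval p y :=
    (continuous_polyEval p).comp continuous_subtype_val
  have hInt : Integrable (fun y : Γ => polyEval p y) μ :=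
    hcont.integrable_of_hasCompactSupport (HasCompactSupport.of_compactSpace _)
  apply Complex.ext
  · rw [← hre p]
    exact (integral_re hInt).symm
  · have h1 := hre (MvPolynomial.C (-Complex.I) * p)
    have h2 : ∀ y, (polyEval (MvPolynomial.C (-Complex.I) * p) y).re = (polyEval p y).im := by
      intro y
      simp [polyEval]
    simp only [h2] at h1
    rw [← h1]
    exact (integral_im hInt).symm

end Poly

end

section

open MeasureTheory Set Metric Filter Topology

theorem eventually_norm_pow_le_of_spectralRadius_lt {B : Type*} [NormedRing B] [NormedAlgebra ℂ B]
    [CompleteSpace B] (a : B) {r : ℝ} (hr : 0 < r) (h : spectralRadius ℂ a < ENNReal.ofReal r) :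
    ∀ᶠ N : ℕ in atTop, ‖a ^ N‖ ≤ r ^ N := by
  have h1 := spectrum.pow_norm_pow_one_div_tendsto_nhds_spectralRadius a
  filter_upwards [h1.eventually_lt_const h, eventually_gt_atTop 0] with N hN hN0
  rw [ENNReal.ofReal_lt_ofReal_iff hr] at hN
  have h2 := Real.rpow_le_rpow (by positivity) hN.le (show (0 : ℝ) ≤ N by positivity)
  rwa [← Real.rpow_mul (norm_nonneg _), one_div,
    inv_mul_cancel₀ (by exact_mod_cast hN0.ne'), Real.rpow_one, Real.rpow_natCast] at h2

/-- If a continuous functional on a commutative Banach algebra annihilates an ideal, its values on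
powers of `a` are controlled by the size of `a` on the hull of the ideal. -/
theorem ContinuousLinearMap.eventually_norm_apply_pow_le {B : Type*} [NormedCommRing B]
    [NormedAlgebra ℂ B] [CompleteSpace B] [NormOneClass B] (φ : B →L[ℂ] ℂ) (a : B) {r₀ r : ℝ}
    (hr₀ : 0 ≤ r₀) (hr : r₀ < r)
    (h : ∀ χ : B →ₐ[ℂ] ℂ, (∀ b, ‖χ b‖ ≤ ‖b‖) → (∀ b, (∀ b', φ (b' * b) = 0) → χ b = 0) →
      ‖χ a‖ ≤ r₀) :
    ∀ᶠ N : ℕ in atTop, ‖φ (a ^ N)‖ ≤ r ^ N := by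
  let J : Ideal B :=
    { carrier := {b | ∀ b', φ (b' * b) = 0}
      add_mem' := fun {x y} hx hy b' => by rw [mul_add, map_add, hx, hy, add_zero]
      zero_mem' := fun b' => by simp
      smul_mem' := fun c x hx b' => by
        rw [smul_eq_mul, ← mul_assoc]
        exact hx _ }
  have hJ : IsClosed (J : Set B) := by
    have : (J : Set B) = ⋂ b', (fun b => φ (b' * b)) ⁻¹' {0} := by
      ext b
      simp only [mem_iInter]
      exact Iff.rfl
    rw [this]
    refine isClosed_iInter fun b' => isClosed_singleton.preimage ?_
    fun_prop
  by_cases htop : J = ⊤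
  · refine Eventually.of_forall fun N => ?_
    have h1 : a ^ N ∈ J := by simp [htop]
    have h2 : φ (1 * a ^ N) = 0 := h1 1
    rw [one_mul] at h2
    rw [h2, norm_zero]
    exact pow_nonneg (hr₀.trans hr.le) _
  have hnt : Nontrivial (B ⧸ J) := Ideal.Quotient.nontrivial_iff.2 htop
  have hcs : CompleteSpace (B ⧸ J) := Submodule.Quotient.completeSpace J
  set r₁ := (r₀ + r) / 2 with hr₁
  have hr₁0 : 0 < r₁ := by linarith
  have hr0 : 0 < r := by linarith
  have hspec : spectralRadius ℂ (Ideal.Quotient.mk J a) < ENNReal.ofReal r₁ := by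
    refine lt_of_le_of_lt (b := ENNReal.ofReal r₀) ?_
      ((ENNReal.ofReal_lt_ofReal_iff hr₁0).2 (by linarith))
    refine iSup₂_le fun z hz => ?_
    obtain ⟨χ, rfl⟩ := WeakDual.CharacterSpace.mem_spectrum_iff_exists.1 hz
    have h1 : ∀ b, ‖(WeakDual.CharacterSpace.toAlgHom χ) (Ideal.Quotient.mk J b)‖ ≤ ‖b‖ := by
      intro b
      refine (AlgHom.norm_apply_le_self_mul_norm_one _ _).trans ?_
      have h2 := Ideal.Quotient.norm_mk_le J b
      have h3 : ‖Ideal.Quotient.mk J 1‖ ≤ 1 := (Ideal.Quotient.norm_mk_le J 1).trans_eq norm_one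
      rw [map_one] at h3
      calc _ ≤ ‖b‖ * 1 := by gcongr
        _ = ‖b‖ := mul_one _
    have h2 := h ((WeakDual.CharacterSpace.toAlgHom χ).comp (Ideal.Quotient.mkₐ ℂ J)) h1
      (fun b hb => by
        have : Ideal.Quotient.mk J b = 0 := Ideal.Quotient.eq_zero_iff_mem.2 hb
        simp [this])
    rw [← ENNReal.ofReal_coe_nnreal]
    exact ENNReal.ofReal_le_ofReal h2
  have h1 := eventually_norm_pow_le_of_spectralRadius_lt _ hr₁0 hspec
  have h2 : ∀ᶠ N : ℕ in atTop, ‖φ‖ * 2 * r₁ ^ N ≤ r ^ N := by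
    have h3 : Tendsto (fun N : ℕ => ‖φ‖ * 2 * (r₁ / r) ^ N) atTop (𝓝 (‖φ‖ * 2 * 0)) :=
      (tendsto_pow_atTop_nhds_zero_of_lt_one (by positivity)
        ((div_lt_one (by linarith)).2 (by linarith))).const_mul _
    rw [mul_zero] at h3
    filter_upwards [h3.eventually_le_const one_pos] with N hN
    rw [div_pow, mul_div_assoc', div_le_one (by positivity)] at hN
    exact hN
  filter_upwards [h1, h2] with N hN hN2
  obtain ⟨b, hb, hb2⟩ := Ideal.Quotient.norm_mk_lt (Ideal.Quotient.mk J a ^ N)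
    (pow_pos hr₁0 N)
  have h4 : φ (1 * (b - a ^ N)) = 0 := by
    have : b - a ^ N ∈ J := by
      rw [← Ideal.Quotient.eq_zero_iff_mem, map_sub, hb, map_pow, sub_self]
    exact this 1
  rw [one_mul, map_sub, sub_eq_zero] at h4
  rw [← h4]
  calc ‖φ b‖ ≤ ‖φ‖ * ‖b‖ := φ.le_opNorm b
    _ ≤ ‖φ‖ * (2 * r₁ ^ N) := by gcongr; linarith
    _ = ‖φ‖ * 2 * r₁ ^ N := by ring
    _ ≤ r ^ N := hN2

end

section

open MeasureTheory Set Metric Filter Topology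

section Tuple

variable {n m : ℕ}

/-- Evaluation of a polynomial at an `m`-tuple of points of `ℂⁿ`. -/
noncomputable def tupleEval (G : MvPolynomial (Fin m × Fin n) ℂ)
    (x : Fin m → EuclideanSpace ℂ (Fin n)) : ℂ :=
  MvPolynomial.eval (fun ij => x ij.1 ij.2) G

/-- The polynomial `p` in the `i`-th block of variables. -/
noncomputable def polyAt (i : Fin m) (p : MvPolynomial (Fin n) ℂ) :
    MvPolynomial (Fin m × Fin n) ℂ :=
  MvPolynomial.rename (fun j => (i, j)) p

theorem continuous_tupleEval (G : MvPolynomial (Fin m × Fin n) ℂ) :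
    Continuous (tupleEval G : (Fin m → EuclideanSpace ℂ (Fin n)) → ℂ) := by
  have : Continuous fun x : Fin m → EuclideanSpace ℂ (Fin n) =>
      fun ij : Fin m × Fin n => x ij.1 ij.2 := by fun_prop
  exact (MvPolynomial.continuous_eval G).comp this

theorem tupleEval_polyAt (i : Fin m) (p : MvPolynomial (Fin n) ℂ)
    (x : Fin m → EuclideanSpace ℂ (Fin n)) : tupleEval (polyAt i p) x = polyEval p (x i) := by
  simp only [tupleEval, polyAt, polyEval, MvPolynomial.eval_rename]
  rfl

theorem exists_continuousLinearMap_extend {P W : Type*} [AddCommGroup P] [Module ℂ P]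
    [NormedAddCommGroup W] [NormedSpace ℂ W] (A : P →ₗ[ℂ] W) (ν : P →ₗ[ℂ] ℂ) {c : ℝ}
    (h : ∀ p, ‖ν p‖ ≤ c * ‖A p‖) : ∃ φ : W →L[ℂ] ℂ, ∀ p, φ (A p) = ν p := by
  obtain ⟨s, hs⟩ := A.rangeRestrict.exists_rightInverse_of_surjective A.range_rangeRestrict
  have hAs : ∀ u : LinearMap.range A, A (s u) = u := fun u => by
    have := LinearMap.congr_fun hs u
    exact congrArg Subtype.val this
  obtain ⟨φ, hφ, -⟩ := exists_extension_norm_eq (LinearMap.range A)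
    ((ν ∘ₗ s).mkContinuous c fun u => by
      have := h (s u)
      rw [hAs] at this
      exact this)
  refine ⟨φ, fun p => ?_⟩
  have h1 := hφ ⟨A p, p, rfl⟩
  have h2 : ν (s ⟨A p, p, rfl⟩ - p) = 0 := by
    have := h (s ⟨A p, p, rfl⟩ - p)
    rw [map_sub A, hAs, sub_self, norm_zero, mul_zero] at this
    exact norm_le_zero_iff.1 this
  rw [map_sub, sub_eq_zero] at h2
  exact h1.trans h2

theorem eventually_norm_pow_le_of_hull {Γ : Set (EuclideanSpace ℂ (Fin n))} (hΓ : IsCompact Γ)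
    (hne : Γ.Nonempty) (f : MvPolynomial (Fin n) ℂ) (w : ℂ)
    (ν : MvPolynomial (Fin m × Fin n) ℂ →ₗ[ℂ] ℂ) {c : ℝ}
    (hν : ∀ p C, 0 ≤ C → (∀ x : Fin m → EuclideanSpace ℂ (Fin n), (∀ i, x i ∈ Γ) →
      ‖tupleEval p x‖ ≤ C) → ‖ν p‖ ≤ c * C)
    (hkill : ∀ p i, ν (p * (polyAt i f - MvPolynomial.C w)) = 0)
    (G : MvPolynomial (Fin m × Fin n) ℂ) {r₀ r : ℝ} (hr₀ : 0 ≤ r₀) (hr : r₀ < r)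
    (hG : ∀ x : Fin m → EuclideanSpace ℂ (Fin n),
      (∀ i, x i ∈ polyHull Γ ∧ polyEval f (x i) = w) → ‖tupleEval G x‖ ≤ r₀) :
    ∀ᶠ N : ℕ in atTop, ‖ν (G ^ N)‖ ≤ r ^ N := by
  have : CompactSpace Γ := isCompact_iff_compactSpace.1 hΓ
  have : Nonempty Γ := hne.to_subtype
  let A : MvPolynomial (Fin m × Fin n) ℂ →ₐ[ℂ] C(Fin m → Γ, ℂ) :=
    MvPolynomial.aeval fun ij => ⟨fun x => (x ij.1 : EuclideanSpace ℂ (Fin n)) ij.2, by fun_prop⟩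
  have hA : ∀ p (x : Fin m → Γ), A p x = tupleEval p fun i => (x i : EuclideanSpace ℂ (Fin n)) := by
    intro p x
    have : ((ContinuousMap.evalAlgHom ℂ ℂ x).comp A) = MvPolynomial.aeval
        (fun ij => (x ij.1 : EuclideanSpace ℂ (Fin n)) ij.2) := by
      refine MvPolynomial.algHom_ext fun ij => ?_
      simp [A]
    have h2 := AlgHom.congr_fun this p
    rw [MvPolynomial.aeval_eq_eval] at h2
    exact h2
  obtain ⟨φ, hφ⟩ := exists_continuousLinearMap_extend A.toLinearMap ν (c := c) (fun p =>
    hν p _ (norm_nonneg _) fun x hx => by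
      have h1 := (A p).norm_coe_le_norm fun i => ⟨x i, hx i⟩
      rw [hA] at h1
      exact h1)
  let S : Subalgebra ℂ C(Fin m → Γ, ℂ) := A.range.topologicalClosure
  have hS : IsClosed (S : Set C(Fin m → Γ, ℂ)) := A.range.isClosed_topologicalClosure
  have : CompleteSpace S := hS.completeSpace_coe
  have : NormOneClass S := ⟨norm_one (α := C(Fin m → Γ, ℂ))⟩
  have hmem : ∀ p, A p ∈ S := fun p => A.range.le_topologicalClosure ⟨p, rfl⟩
  let A' : MvPolynomial (Fin m × Fin n) ℂ →ₐ[ℂ] S := A.codRestrict S hmem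
  let φ' : S →L[ℂ] ℂ := φ.comp (Submodule.subtypeL (Subalgebra.toSubmodule S))
  have key := φ'.eventually_norm_apply_pow_le (A' G) hr₀ hr ?_
  · filter_upwards [key] with N hN
    have : φ' (A' G ^ N) = ν (G ^ N) := by
      rw [← hφ, ← map_pow]
      rfl
    rwa [this] at hN
  intro χ hχ hχ0
  let y : Fin m → EuclideanSpace ℂ (Fin n) := fun i =>
    WithLp.toLp 2 fun j => χ (A' (MvPolynomial.X (i, j)))
  have hy : ∀ p, χ (A' p) = tupleEval p y := by
    intro p
    have : χ.comp A' = MvPolynomial.aeval (fun ij : Fin m × Fin n => y ij.1 ij.2) := by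
      refine MvPolynomial.algHom_ext fun ij => ?_
      simp [y]
    have h2 := AlgHom.congr_fun this p
    rw [MvPolynomial.aeval_eq_eval] at h2
    exact h2
  rw [hy]
  refine hG y fun i => ⟨fun p => ?_, ?_⟩
  · have h1 := hχ (A' (polyAt i p))
    rw [hy, tupleEval_polyAt] at h1
    refine h1.trans ?_
    have h2 : ‖A' (polyAt i p)‖ = ‖A (polyAt i p)‖ := rfl
    rw [h2, ContinuousMap.norm_le_of_nonempty]
    intro x
    rw [hA, tupleEval_polyAt]
    refine le_csSup ?_ ⟨x i, (x i).2, rfl⟩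
    exact (hΓ.image (continuous_polyEval p).norm).bddAbove
  · have h1 : χ (A' (polyAt i f - MvPolynomial.C w)) = 0 := by
      refine hχ0 _ fun b => ?_
      obtain ⟨b, hb⟩ := b
      change φ (b * A (polyAt i f - MvPolynomial.C w)) = 0
      have hcl : IsClosed {b : C(Fin m → Γ, ℂ) | φ (b * A (polyAt i f - MvPolynomial.C w)) = 0} :=
        isClosed_eq (by fun_prop) continuous_const
      refine closure_minimal ?_ hcl hb
      rintro _ ⟨p, rfl⟩
      have h2 := hφ (p * (polyAt i f - MvPolynomial.C w))
      rw [hkill] at h2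
      rw [← h2]
      simp
    rw [hy] at h1
    have h2 : tupleEval (polyAt i f - MvPolynomial.C w) y = polyEval f (y i) - w := by
      rw [← tupleEval_polyAt]
      simp [tupleEval]
    rw [h2, sub_eq_zero] at h1
    exact h1

end Tuple

end

section

open MeasureTheory Set Metric Filter Topology

/-- Differentiation under the integral sign for locally bounded holomorphic integrands. -/
theorem differentiableOn_integral_of_locally_bounded {α : Type*} [MeasurableSpace α]
    {μ : Measure α} [IsFiniteMeasure μ] {H : ℂ → α → ℂ} {O : Set ℂ} (hO : IsOpen O)
    (hmeas : ∀ w ∈ O, AEStronglyMeasurable (H w) μ)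
    (hdiff : ∀ᵐ x ∂μ, DifferentiableOn ℂ (fun w => H w x) O)
    (hb : ∀ w₀ ∈ O, ∃ ε > 0, ∃ B : ℝ, ∀ᵐ x ∂μ, ∀ w ∈ ball w₀ ε, ‖H w x‖ ≤ B) :
    DifferentiableOn ℂ (fun w => ∫ x, H w x ∂μ) O := by
  intro w₀ hw₀
  obtain ⟨ε, hε, B, hB⟩ := hb w₀ hw₀
  obtain ⟨r, hr, hrO⟩ := Metric.isOpen_iff.1 hO w₀ hw₀
  set s := min ε r / 2 with hs
  have hs0 : 0 < s := by positivity
  have hsub : ∀ w ∈ ball w₀ s, closedBall w s ⊆ ball w₀ (min ε r) := by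
    intro w hw z hz
    rw [mem_ball] at hw ⊢
    rw [mem_closedBall] at hz
    have := dist_triangle z w w₀
    linarith
  have hO' : ball w₀ (min ε r) ⊆ O := (ball_subset_ball (min_le_right _ _)).trans hrO
  have hmem : w₀ ∈ ball w₀ s := mem_ball_self hs0
  have key := hasDerivAt_integral_of_dominated_loc_of_deriv_le (μ := μ) (F := H) (x₀ := w₀)
    (F' := fun (w : ℂ) (x : α) => deriv (fun z : ℂ => H z x) w) (bound := fun _ => B / s)
    (ball_mem_nhds w₀ hs0) ?_ ?_ ?_ ?_ (integrable_const _) ?_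
  · exact key.2.differentiableAt.differentiableWithinAt
  · filter_upwards [hO.mem_nhds hw₀] with w hw using hmeas w hw
  · refine Integrable.of_bound (hmeas w₀ hw₀) B ?_
    filter_upwards [hB] with x hx using hx w₀ (mem_ball_self hε)
  · have ht : Tendsto (fun k : ℕ => w₀ + (s / (k + 2) : ℝ)) atTop (𝓝[≠] w₀) := by
      refine tendsto_nhdsWithin_iff.2 ⟨?_, Eventually.of_forall fun k => ?_⟩
      · have h1 : Tendsto (fun k : ℕ => s / ((k : ℝ) + 2)) atTop (𝓝 0) :=
          Tendsto.div_atTop tendsto_const_nhds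
            (tendsto_atTop_add_const_right _ _ tendsto_natCast_atTop_atTop)
        have h2 := ((Complex.continuous_ofReal.tendsto 0).comp h1).const_add w₀
        simpa using h2
      · have : s / ((k : ℝ) + 2) ≠ 0 := by positivity
        simp only [mem_compl_iff, mem_singleton_iff, add_eq_left]
        exact_mod_cast this
    refine aestronglyMeasurable_of_tendsto_ae atTop
      (f := fun (k : ℕ) x => slope (fun w => H w x) w₀ (w₀ + (s / (k + 2) : ℝ))) ?_ ?_
    · intro k
      have hk : w₀ + ((s / (k + 2) : ℝ) : ℂ) ∈ O := by
        refine hO' ?_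
        rw [mem_ball, dist_eq_norm, add_sub_cancel_left, Complex.norm_real, Real.norm_eq_abs,
          abs_of_pos (by positivity)]
        have : s / ((k : ℝ) + 2) ≤ s := div_le_self hs0.le (by linarith [k.cast_nonneg (α := ℝ)])
        have : s < min ε r := by rw [hs]; have : 0 < min ε r := by positivity
                                 linarith
        linarith
      have h1 := ((hmeas _ hk).sub (hmeas _ hw₀)).const_smul
        ((w₀ + ((s / (k + 2) : ℝ) : ℂ) - w₀)⁻¹)
      exact h1
    · filter_upwards [hdiff] with x hx
      have h1 := ((hx w₀ hw₀).differentiableAt (hO.mem_nhds hw₀)).hasDerivAt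
      exact (hasDerivAt_iff_tendsto_slope.1 h1).comp ht
  · filter_upwards [hdiff, hB] with x hx hxB w hw
    refine Complex.norm_deriv_le_of_forall_mem_sphere_norm_le hs0 ?_ ?_
    · refine DifferentiableOn.diffContOnCl_ball (U := O) hx ?_
      exact (hsub w hw).trans hO'
    · intro z hz
      exact hxB z (ball_subset_ball (min_le_left _ _) (hsub w hw (sphere_subset_closedBall hz)))
  · filter_upwards [hdiff] with x hx w hw
    have hwO : w ∈ O := hO' (ball_subset_ball (by rw [hs]; have : 0 < min ε r := by positivity
                                                  linarith) hw)
    exact ((hx w hwO).differentiableAt (hO.mem_nhds hwO)).hasDerivAt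

end

section

open MeasureTheory Set Metric Filter Topology

section Family

variable {n m : ℕ}

/-- The `i`-th block of the monomial with exponent `s`. -/
noncomputable def monomialBlock (s : Fin m × Fin n →₀ ℕ) (i : Fin m) : MvPolynomial (Fin n) ℂ :=
  ∏ j, MvPolynomial.X j ^ s (i, j)

theorem tupleEval_monomial (s : Fin m × Fin n →₀ ℕ) (a : ℂ)
    (x : Fin m → EuclideanSpace ℂ (Fin n)) :
    tupleEval (MvPolynomial.monomial s a) x = a * ∏ i, polyEval (monomialBlock s i) (x i) := by
  simp only [tupleEval, polyEval, monomialBlock, MvPolynomial.eval_monomial, map_prod, map_pow,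
    MvPolynomial.eval_X]
  rw [Finsupp.prod_fintype _ _ (by simp), Fintype.prod_prod_type]

theorem integral_tupleEval_monomial {Γ : Set (EuclideanSpace ℂ (Fin n))}
    (μ : Fin m → Measure Γ) [∀ i, IsProbabilityMeasure (μ i)] (k : Fin m → Γ → ℂ)
    (s : Fin m × Fin n →₀ ℕ) (a : ℂ) :
    ∫ x : Fin m → Γ, tupleEval (MvPolynomial.monomial s a) (fun i => (x i : EuclideanSpace ℂ _)) *
      ∏ i, k i (x i) ∂(Measure.pi μ) =
      a * ∏ i, ∫ x : Γ, polyEval (monomialBlock s i) x * k i x ∂(μ i) := by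
  simp only [tupleEval_monomial, mul_assoc, ← Finset.prod_mul_distrib]
  rw [integral_const_mul]
  congr 1
  exact integral_fintype_prod_eq_prod (fun i (x : Γ) => polyEval (monomialBlock s i) x * k i x)

theorem continuous_tupleEval_coe {Γ : Set (EuclideanSpace ℂ (Fin n))}
    (G : MvPolynomial (Fin m × Fin n) ℂ) :
    Continuous fun x : Fin m → Γ => tupleEval G (fun i => (x i : EuclideanSpace ℂ _)) :=
  (continuous_tupleEval G).comp (by fun_prop)

theorem integrable_tupleEval_mul {Γ : Set (EuclideanSpace ℂ (Fin n))} [CompactSpace Γ]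
    (μ : Fin m → Measure Γ) [∀ i, IsProbabilityMeasure (μ i)] {k : Fin m → Γ → ℂ}
    (hk : ∀ i, Continuous (k i)) (p : MvPolynomial (Fin m × Fin n) ℂ) :
    Integrable (fun x : Fin m → Γ => tupleEval p (fun i => (x i : EuclideanSpace ℂ _)) *
      ∏ i, k i (x i)) (Measure.pi μ) := by
  have h1 := continuous_tupleEval_coe (Γ := Γ) p
  have : Continuous fun x : Fin m → Γ => tupleEval p (fun i => (x i : EuclideanSpace ℂ _)) *
      ∏ i, k i (x i) := by fun_prop
  exact this.integrable_of_hasCompactSupport (HasCompactSupport.of_compactSpace _)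

/-- Integration against a product density, as a linear functional on polynomials. -/
noncomputable def tupleIntegral {Γ : Set (EuclideanSpace ℂ (Fin n))} [CompactSpace Γ]
    (μ : Fin m → Measure Γ) [∀ i, IsProbabilityMeasure (μ i)] (k : Fin m → Γ → ℂ)
    (hk : ∀ i, Continuous (k i)) : MvPolynomial (Fin m × Fin n) ℂ →ₗ[ℂ] ℂ where
  toFun p := ∫ x : Fin m → Γ, tupleEval p (fun i => (x i : EuclideanSpace ℂ _)) *
      ∏ i, k i (x i) ∂(Measure.pi μ)
  map_add' p q := by
    rw [← integral_add (integrable_tupleEval_mul μ hk p) (integrable_tupleEval_mul μ hk q)]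
    simp [tupleEval, add_mul]
  map_smul' a p := by
    rw [RingHom.id_apply, smul_eq_mul, ← integral_const_mul]
    simp [tupleEval, mul_assoc]

theorem tupleIntegral_apply {Γ : Set (EuclideanSpace ℂ (Fin n))} [CompactSpace Γ]
    (μ : Fin m → Measure Γ) [∀ i, IsProbabilityMeasure (μ i)] (k : Fin m → Γ → ℂ)
    (hk : ∀ i, Continuous (k i)) (p : MvPolynomial (Fin m × Fin n) ℂ) :
    tupleIntegral μ k hk p = ∫ x : Fin m → Γ,
      tupleEval p (fun i => (x i : EuclideanSpace ℂ _)) * ∏ i, k i (x i) ∂(Measure.pi μ) := rfl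

theorem tupleIntegral_eq_zero {Γ : Set (EuclideanSpace ℂ (Fin n))} [CompactSpace Γ]
    (μ : Fin m → Measure Γ) [∀ i, IsProbabilityMeasure (μ i)] (k : Fin m → Γ → ℂ)
    (hk : ∀ i, Continuous (k i)) (i : Fin m)
    (h : ∀ p : MvPolynomial (Fin n) ℂ, ∫ x : Γ, polyEval p x * k i x ∂(μ i) = 0)
    (p : MvPolynomial (Fin m × Fin n) ℂ) :
    tupleIntegral μ k hk p = 0 := by
  induction p using MvPolynomial.induction_on' with
  | monomial s a =>
    rw [tupleIntegral_apply, integral_tupleEval_monomial,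
      Finset.prod_eq_zero (Finset.mem_univ i) (h _), mul_zero]
  | add p q hp hq => rw [map_add, hp, hq, add_zero]

theorem tupleIntegral_one {Γ : Set (EuclideanSpace ℂ (Fin n))} [CompactSpace Γ]
    (μ : Fin m → Measure Γ) [∀ i, IsProbabilityMeasure (μ i)]
    (y : Fin m → EuclideanSpace ℂ (Fin n))
    (h : ∀ i p, ∫ x : Γ, polyEval p x ∂(μ i) = polyEval p (y i))
    (p : MvPolynomial (Fin m × Fin n) ℂ) :
    tupleIntegral μ (fun _ _ => 1) (fun _ => continuous_const) p = tupleEval p y := by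
  induction p using MvPolynomial.induction_on' with
  | monomial s a =>
    rw [tupleIntegral_apply, tupleEval_monomial]
    refine (integral_tupleEval_monomial μ (fun _ _ => 1) s a).trans ?_
    simp [h]
  | add p q hp hq =>
    rw [map_add, hp, hq]
    simp [tupleEval]

theorem tupleEval_pow (G : MvPolynomial (Fin m × Fin n) ℂ) (N : ℕ)
    (x : Fin m → EuclideanSpace ℂ (Fin n)) : tupleEval (G ^ N) x = tupleEval G x ^ N := by
  simp [tupleEval]

end Family

end

section

open MeasureTheory Set Metric Filter Topology

section Family

variable {n m : ℕ}

theorem exists_analytic_family {Γ : Set (EuclideanSpace ℂ (Fin n))} (hΓ : IsCompact Γ)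
    (hne : Γ.Nonempty) (f : MvPolynomial (Fin n) ℂ) {O : Set ℂ} (hO : IsOpen O) {c : ℂ}
    (hc : c ∈ O) (y : Fin m → EuclideanSpace ℂ (Fin n)) (hy : ∀ i, y i ∈ polyHull Γ)
    (hyc : ∀ i, polyEval f (y i) = c) (G : MvPolynomial (Fin m × Fin n) ℂ) {M δ : ℝ}
    (hδ : 0 ≤ δ) (hM : ∀ x, (∀ i, x i ∈ Γ) → ‖tupleEval G x‖ ≤ M)
    (hG : ∀ x, (∀ i, x i ∈ Γ) → (∃ i, polyEval f (x i) ∈ O) → ‖tupleEval G x‖ ≤ δ) :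
    ∃ Φ : ℕ → ℂ → ℂ, (∀ N, DifferentiableOn ℂ (Φ N) O) ∧
      (∀ N, ‖tupleEval G y‖ ^ N - δ ^ N ≤ ‖Φ N c‖) ∧
      (∀ Q ⊆ O, IsCompact Q → ∃ A, 0 < A ∧ ∀ N, ∀ w ∈ Q, ‖Φ N w‖ ≤ A * M ^ N) ∧
      ∀ w ∈ O, w ∉ polyEval f '' Γ → ∀ r₀ r, 0 ≤ r₀ → r₀ < r → δ < r →
        (∀ x, (∀ i, x i ∈ polyHull Γ ∧ polyEval f (x i) = w) → ‖tupleEval G x‖ ≤ r₀) →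
        ∀ᶠ N in atTop, ‖Φ N w‖ ≤ r ^ N := by
  have : CompactSpace Γ := isCompact_iff_compactSpace.1 hΓ
  have hM0 : 0 ≤ M := by
    obtain ⟨x, hx⟩ := hne
    exact (norm_nonneg _).trans (hM (fun _ => x) fun _ => hx)
  choose μ hμ hμy using fun i => exists_repr_measure hΓ (hy i)
  have hcf : Continuous fun x : Γ => polyEval f x :=
    (continuous_polyEval f).comp continuous_subtype_val
  let ev : (Fin m → Γ) → ℂ := fun x => tupleEval G (fun i => (x i : EuclideanSpace ℂ _))
  have hev : Continuous ev := continuous_tupleEval_coe G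
  have hevM : ∀ x, ‖ev x‖ ≤ M := fun x => hM _ fun i => (x i).2
  let Out : Set (Fin m → Γ) := {x | ∀ i, polyEval f (x i) ∉ O}
  have hOut : IsClosed Out := by
    have : Out = ⋂ i, {x : Fin m → Γ | polyEval f (x i) ∈ Oᶜ} := by
      ext x; simp [Out]
    rw [this]
    refine isClosed_iInter fun i => ?_
    exact hO.isClosed_compl.preimage (hcf.comp (continuous_apply i))
  have hin : ∀ x ∈ Outᶜ, ‖ev x‖ ≤ δ := by
    intro x hx
    simp only [Out, mem_compl_iff, mem_ofPred_eq, not_forall, not_not] at hx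
    exact hG _ (fun i => (x i).2) hx
  let κ : ℂ → (Fin m → Γ) → ℂ := fun w x =>
    ∏ i, (polyEval f (x i) - c) / (polyEval f (x i) - w)
  have hκm : ∀ w, Measurable (κ w) := by
    intro w
    refine Finset.measurable_prod _ fun i _ => ?_
    have : Measurable fun x : Fin m → Γ => polyEval f (x i) :=
      (hcf.comp (continuous_apply i)).measurable
    exact (this.sub_const c).div (this.sub_const w)
  obtain ⟨R, hR0, hR⟩ : ∃ R, 0 < R ∧ ∀ x : Γ, ‖polyEval f x - c‖ ≤ R := by
    obtain ⟨R, hR⟩ := isCompact_univ.exists_bound_of_continuousOn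
      (hcf.sub (continuous_const (y := c))).continuousOn
    exact ⟨max R 1, by positivity, fun x => (hR x (mem_univ x)).trans (le_max_left _ _)⟩
  have hbd : ∀ Q ⊆ O, IsCompact Q → ∃ A, 0 < A ∧ ∀ w ∈ Q, ∀ x ∈ Out, ‖κ w x‖ ≤ A := by
    intro Q hQ hQc
    obtain ⟨ε, hε, h⟩ := hQc.exists_thickening_subset_open hO hQ
    refine ⟨(R / ε) ^ m, by positivity, fun w hw x hx => ?_⟩
    simp only [κ, norm_prod, norm_div]
    refine (Finset.prod_le_prod (g := fun _ => R / ε) (fun _ _ => by positivity)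
      fun i _ => ?_).trans (by simp [div_pow])
    have h1 : ε ≤ ‖polyEval f (x i) - w‖ := by
      by_contra! h2
      refine hx i (h (mem_thickening_iff.2 ⟨w, hw, ?_⟩))
      rwa [dist_eq_norm]
    exact div_le_div₀ hR0.le (hR _) hε h1
  let P := Measure.pi μ
  let Φ : ℕ → ℂ → ℂ := fun N w => ∫ x in Out, ev x ^ N * κ w x ∂P
  have hΦint : ∀ N, ∀ w ∈ O, IntegrableOn (fun x => ev x ^ N * κ w x) Out P := by
    intro N w hw
    obtain ⟨A, hA0, hA⟩ := hbd {w} (by simpa using hw) isCompact_singleton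
    refine Integrable.of_bound ((hev.pow N).measurable.mul (hκm w)).aestronglyMeasurable
      (M ^ N * A) ?_
    refine ae_restrict_of_forall_mem hOut.measurableSet fun x hx => ?_
    rw [norm_mul, norm_pow]
    exact mul_le_mul (pow_le_pow_left₀ (norm_nonneg _) (hevM x) N) (hA w rfl x hx)
      (norm_nonneg _) (by positivity)
  have hbound : ∀ Q ⊆ O, IsCompact Q → ∃ A, 0 < A ∧ ∀ N, ∀ w ∈ Q, ∀ x ∈ Out,
      ‖ev x ^ N * κ w x‖ ≤ A * M ^ N := by
    intro Q hQ hQc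
    obtain ⟨A, hA0, hA⟩ := hbd Q hQ hQc
    refine ⟨A, hA0, fun N w hw x hx => ?_⟩
    rw [norm_mul, norm_pow, mul_comm]
    exact mul_le_mul (hA w hw x hx) (pow_le_pow_left₀ (norm_nonneg _) (hevM x) N)
      (by positivity) hA0.le
  have hinN : ∀ (g : (Fin m → Γ) → ℂ) B N, 0 ≤ B → (∀ x ∈ Outᶜ, ‖g x‖ ≤ B) →
      ‖∫ x in Outᶜ, ev x ^ N * g x ∂P‖ ≤ δ ^ N * B := by
    intro g B N hB hg
    refine (norm_setIntegral_le_of_norm_le_const (C := δ ^ N * B) (measure_lt_top _ _)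
      fun x hx => ?_).trans ?_
    · rw [norm_mul, norm_pow]
      exact mul_le_mul (pow_le_pow_left₀ (norm_nonneg _) (hin x hx) N) (hg x hx)
        (norm_nonneg _) (by positivity)
    · exact mul_le_of_le_one_right (by positivity) measureReal_le_one
  have hsplit : ∀ g : (Fin m → Γ) → ℂ, Continuous g → ∀ N, ∫ x, ev x ^ N * g x ∂P =
      (∫ x in Out, ev x ^ N * g x ∂P) + ∫ x in Outᶜ, ev x ^ N * g x ∂P := by
    intro g hg N
    refine (integral_add_compl hOut.measurableSet ?_).symm
    exact ((hev.pow N).mul hg).integrable_of_hasCompactSupport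
      (HasCompactSupport.of_compactSpace _)
  refine ⟨Φ, fun N => ?_, fun N => ?_, fun Q hQ hQc => ?_, fun w hw hwK r₀ r hr₀ hr hδr hGw => ?_⟩
  · refine differentiableOn_integral_of_locally_bounded hO
      (fun w hw => (hΦint N w hw).aestronglyMeasurable) ?_ ?_
    · refine ae_restrict_of_forall_mem hOut.measurableSet fun x hx => ?_
      refine DifferentiableOn.const_mul ?_ _
      refine DifferentiableOn.fun_finsetProd fun i _ => ?_
      refine (differentiableOn_const _).div (by fun_prop) fun w hw => ?_
      intro h
      exact hx i (by rwa [sub_eq_zero.1 h])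
    · intro w₀ hw₀
      obtain ⟨ε, hε, h⟩ := Metric.nhds_basis_closedBall.mem_iff.1 (hO.mem_nhds hw₀)
      obtain ⟨A, -, hA⟩ := hbound _ h (isCompact_closedBall _ _)
      exact ⟨ε, hε, A * M ^ N, ae_restrict_of_forall_mem hOut.measurableSet fun x hx w hw =>
        hA N w (ball_subset_closedBall hw) x hx⟩
  · have h1 : ∫ x, ev x ^ N * 1 ∂P = tupleEval G y ^ N := by
      rw [← tupleEval_pow, ← tupleIntegral_one μ y hμy (G ^ N), tupleIntegral_apply]
      simp [tupleEval_pow, ev, P]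
    have h2 : Φ N c = ∫ x in Out, ev x ^ N * 1 ∂P := by
      refine setIntegral_congr_fun hOut.measurableSet fun x hx => ?_
      congr 1
      refine Finset.prod_eq_one fun i _ => div_self fun h => hx i ?_
      rwa [sub_eq_zero.1 h]
    have h3 := hinN (fun _ => 1) 1 N zero_le_one (by simp)
    have h4 := hsplit (fun _ => 1) continuous_const N
    rw [h1, ← h2] at h4
    rw [← norm_pow, h4]
    have := norm_add_le (Φ N c) (∫ x in Outᶜ, ev x ^ N * 1 ∂P)
    linarith
  · obtain ⟨A, hA0, hA⟩ := hbound Q hQ hQc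
    refine ⟨A, hA0, fun N w hw => ?_⟩
    refine (norm_setIntegral_le_of_norm_le_const (C := A * M ^ N) (measure_lt_top _ _)
      fun x hx => hA N w hw x hx).trans ?_
    exact mul_le_of_le_one_right (by positivity) measureReal_le_one
  · have hne' : ∀ x : Γ, polyEval f x - w ≠ 0 := fun x h =>
      hwK ⟨x, x.2, sub_eq_zero.1 h⟩
    have hkc : Continuous fun x : Γ => (polyEval f x - c) / (polyEval f x - w) :=
      (hcf.sub continuous_const).div (hcf.sub continuous_const) hne'
    let ν := tupleIntegral μ (fun _ (x : Γ) => (polyEval f x - c) / (polyEval f x - w))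
      (fun _ => hkc)
    have hκc : Continuous (κ w) := by
      refine continuous_finsetProd _ fun i _ => hkc.comp (continuous_apply i)
    obtain ⟨B, hB⟩ := isCompact_univ.exists_bound_of_continuousOn hκc.continuousOn
    have hB' : ∀ x, ‖κ w x‖ ≤ max B 0 := fun x => (hB x (mem_univ x)).trans (le_max_left _ _)
    obtain ⟨r', hr'1, hr'2⟩ := exists_between (max_lt hr hδr)
    have hr'0 : 0 ≤ r' := hr₀.trans ((le_max_left _ _).trans hr'1.le)
    have key := eventually_norm_pow_le_of_hull hΓ hne f w ν (c := max B 0) ?_ ?_ G hr₀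
      ((le_max_left _ _).trans_lt hr'1) hGw
    · have hlim : ∀ᶠ N : ℕ in atTop, (1 + max B 0) * (r' / r) ^ N ≤ 1 := by
        have hr0 : 0 < r := hr'0.trans_lt hr'2
        have : Tendsto (fun N : ℕ => (1 + max B 0) * (r' / r) ^ N) atTop
            (𝓝 ((1 + max B 0) * 0)) :=
          (tendsto_pow_atTop_nhds_zero_of_lt_one (by positivity)
            ((div_lt_one hr0).2 hr'2)).const_mul _
        rw [mul_zero] at this
        filter_upwards [this.eventually_lt_const zero_lt_one] with N hN using hN.le
      filter_upwards [key, hlim] with N h1 h2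
      have hr0 : 0 < r := hr'0.trans_lt hr'2
      have h3 : ν (G ^ N) = Φ N w + ∫ x in Outᶜ, ev x ^ N * κ w x ∂P := by
        refine Eq.trans ?_ (hsplit _ hκc N)
        rw [tupleIntegral_apply]
        simp [tupleEval_pow, ev, P, κ]
      have h4 := hinN (κ w) (max B 0) N (le_max_right _ _) fun x _ => hB' x
      have h5 : δ ^ N ≤ r' ^ N := pow_le_pow_left₀ hδ ((le_max_right _ _).trans hr'1.le) N
      have h6 : ‖Φ N w‖ ≤ ‖ν (G ^ N)‖ + ‖∫ x in Outᶜ, ev x ^ N * κ w x ∂P‖ := by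
        rw [h3]
        exact norm_le_add_norm_add _ _
      rw [div_pow, mul_div_assoc', div_le_one (by positivity)] at h2
      have h7 : δ ^ N * max B 0 ≤ r' ^ N * max B 0 :=
        mul_le_mul_of_nonneg_right h5 (le_max_right _ _)
      linarith
    · intro p C hC hp
      rw [tupleIntegral_apply]
      refine (norm_integral_le_of_norm_le_const (C := max B 0 * C)
        (Eventually.of_forall fun x => ?_)).trans (by simp)
      rw [norm_mul, mul_comm]
      exact mul_le_mul (hB' x) (hp _ fun i => (x i).2) (norm_nonneg _) (le_max_right _ _)
    · intro p i
      let k : Fin m → Γ → ℂ := Function.update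
        (fun _ (x : Γ) => (polyEval f x - c) / (polyEval f x - w)) i (fun x => polyEval f x - c)
      have hk : ∀ j, Continuous (k j) := by
        intro j
        rcases eq_or_ne j i with rfl | hj
        · simp only [k, Function.update_self]
          exact hcf.sub continuous_const
        · simpa [k, hj] using hkc
      have h1 : ν (p * (polyAt i f - MvPolynomial.C w)) = tupleIntegral μ k hk p := by
        simp only [ν, tupleIntegral_apply]
        congr 1 with x
        rw [← Finset.mul_prod_erase _ _ (Finset.mem_univ i),
          ← Finset.mul_prod_erase _ (fun j => k j (x j)) (Finset.mem_univ i)]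
        have h2 : ∏ j ∈ Finset.univ.erase i, k j (x j) = ∏ j ∈ Finset.univ.erase i,
            (polyEval f (x j) - c) / (polyEval f (x j) - w) := by
          refine Finset.prod_congr rfl fun j hj => ?_
          simp [k, Finset.ne_of_mem_erase hj]
        have h3 : tupleEval (p * (polyAt i f - MvPolynomial.C w))
            (fun i => (x i : EuclideanSpace ℂ _)) =
            tupleEval p (fun i => (x i : EuclideanSpace ℂ _)) * (polyEval f (x i) - w) := by
          rw [← tupleEval_polyAt i f fun i => (x i : EuclideanSpace ℂ _)]
          simp [tupleEval]
        rw [h2, h3]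
        have h4 := hne' (x i)
        simp only [k, Function.update_self]
        field_simp
      rw [h1]
      refine tupleIntegral_eq_zero μ k hk i (fun q => ?_) p
      simp only [k, Function.update_self]
      have h2 := hμy i (q * (f - MvPolynomial.C c))
      have h3 : ∀ x, polyEval (q * (f - MvPolynomial.C c)) x =
          polyEval q x * (polyEval f x - c) := by
        intro x; simp [polyEval]
      simp only [h3, hyc, sub_self, mul_zero] at h2
      exact h2

end Family

end

section

open MeasureTheory Set Metric Filter Topology Real

/-- Fatou's lemma in the form: bounded integrals prevent divergence to infinity. -/
theorem ae_exists_frequently_le_of_lintegral_le {α : Type*} [MeasurableSpace α] {μ : Measure α}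
    {u : ℕ → α → ENNReal} (hu : ∀ N, Measurable (u N)) {B : ENNReal} (hB : B ≠ ⊤)
    (h : ∀ N, ∫⁻ x, u N x ∂μ ≤ B) : ∀ᵐ x ∂μ, ∃ C : ENNReal, C ≠ ⊤ ∧ ∃ᶠ N in atTop, u N x ≤ C := by
  have h1 : ∫⁻ x, liminf (fun N => u N x) atTop ∂μ ≤ B := by
    refine (lintegral_liminf_le hu).trans ?_
    exact liminf_le_of_frequently_le' (Eventually.of_forall h).frequently
  have h2 := ae_lt_top (Measurable.liminf hu) (h1.trans_lt hB.lt_top).ne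
  filter_upwards [h2] with x hx
  obtain ⟨C, hC1, hC2⟩ := exists_between hx
  refine ⟨C, hC2.ne, ?_⟩
  exact (frequently_lt_of_liminf_lt (by isBoundedDefault) hC1).mono fun N hN => hN.le

/-- Jensen's inequality for analytic functions. -/
theorem AnalyticOnNhd.log_norm_le_circleAverage {c : ℂ} {R : ℝ} {f : ℂ → ℂ} (hR : 0 < R)
    (hf : AnalyticOnNhd ℂ f (closedBall c R)) (hc : f c ≠ 0) :
    Real.log ‖f c‖ ≤ circleAverage (fun z => Real.log ‖f z‖) c R := by
  have hf' : AnalyticOnNhd ℂ f (closedBall c |R|) := by rwa [abs_of_pos hR]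
  rw [hf'.circleAverage_log_norm hR.ne' hc]
  refine le_add_of_nonneg_left (finsum_nonneg fun u => ?_)
  by_cases hu : u ∈ closedBall c |R|
  · refine mul_nonneg ?_ ?_
    · exact_mod_cast MeromorphicOn.AnalyticOnNhd.divisor_nonneg hf' u
    · rw [mem_closedBall, dist_comm, dist_eq_norm, abs_of_pos hR] at hu
      rcases (norm_nonneg (c - u)).eq_or_lt with h | h
      · simp [← h]
      · exact Real.log_nonneg ((le_mul_inv_iff₀ h).2 (by linarith))
  · rw [Function.locallyFinsuppWithin.apply_eq_zero_of_notMem _ hu]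
    simp

/-- A sequence of analytic functions which is bounded below at the centre of a disc and is, for
almost every boundary point, eventually bounded by `exp (N * L)`. -/
theorem le_integral_of_eventually_norm_le_exp {Φ : ℕ → ℂ → ℂ} {c : ℂ} {R φ₀ l A M C : ℝ}
    {L : ℝ → ℝ} (hR : 0 < R) (hΦ : ∀ N, AnalyticOnNhd ℂ (Φ N) (closedBall c R))
    (hA : 0 < A) (hM : 0 < M) (hbd : ∀ N, ∀ z ∈ sphere c R, ‖Φ N z‖ ≤ A * M ^ N)
    (hlow : ∀ᶠ N : ℕ in atTop, exp (N * l) ≤ ‖Φ N c‖) (hL : Measurable L) (hLC : ∀ φ, |L φ| ≤ C)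
    (hev : ∀ᵐ φ, φ ∈ Ioc (φ₀ - π) (φ₀ + π) →
      ∀ᶠ N : ℕ in atTop, ‖Φ N (circleMap c R φ)‖ ≤ exp (N * L φ)) :
    l ≤ (2 * π)⁻¹ * ∫ φ in (φ₀ - π)..(φ₀ + π), L φ := by
  let g : ℕ → ℝ → ℝ := fun N φ => (N : ℝ)⁻¹ * log ‖Φ N (circleMap c R φ)‖
  let v : ℕ → ℝ → ℝ := fun N φ => max (g N φ - L φ) 0
  have hle : φ₀ - π ≤ φ₀ + π := by linarith [pi_pos]
  have hcont : ∀ N, Continuous fun φ => Φ N (circleMap c R φ) := fun N =>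
    ((hΦ N).continuousOn.mono sphere_subset_closedBall).comp_continuous (continuous_circleMap c R)
      (circleMap_mem_sphere c hR.le)
  have hgm : ∀ N, Measurable (g N) := fun N => by
    have := (hcont N).measurable.norm
    exact (Real.measurable_log.comp this).const_mul _
  have hvm : ∀ N, Measurable (v N) := fun N => ((hgm N).sub hL).max measurable_const
  have hub : ∀ N : ℕ, 1 ≤ N → ∀ φ, Φ N (circleMap c R φ) ≠ 0 → g N φ ≤ |log A| + |log M| := by
    intro N hN φ h0
    have hN' : (1 : ℝ) ≤ N := by exact_mod_cast hN
    have h1 : log ‖Φ N (circleMap c R φ)‖ ≤ log A + N * log M := by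
      rw [← Real.log_pow, ← Real.log_mul hA.ne' (by positivity)]
      exact Real.log_le_log (norm_pos_iff.2 h0) (hbd N _ (circleMap_mem_sphere c hR.le φ))
    have h2 : (N : ℝ)⁻¹ * log ‖Φ N (circleMap c R φ)‖ ≤ (N : ℝ)⁻¹ * (log A + N * log M) :=
      mul_le_mul_of_nonneg_left h1 (by positivity)
    have h3 : (N : ℝ)⁻¹ * (log A + N * log M) = (N : ℝ)⁻¹ * log A + log M := by field_simp
    have h4 : (N : ℝ)⁻¹ * log A ≤ |log A| := by
      calc (N : ℝ)⁻¹ * log A ≤ (N : ℝ)⁻¹ * |log A| :=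
            mul_le_mul_of_nonneg_left (le_abs_self _) (by positivity)
        _ ≤ 1 * |log A| := mul_le_mul_of_nonneg_right (inv_le_one_of_one_le₀ hN') (abs_nonneg _)
        _ = |log A| := one_mul _
    have h5 := le_abs_self (log M)
    simp only [g]
    linarith
  have hC : 0 ≤ C := (abs_nonneg _).trans (hLC 0)
  have hub' : ∀ N : ℕ, 1 ≤ N → ∀ φ, g N φ ≤ |log A| + |log M| := by
    intro N hN φ
    by_cases h0 : Φ N (circleMap c R φ) = 0
    · simp only [g, h0, norm_zero, log_zero, mul_zero]; positivity
    · exact hub N hN φ h0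
  have hvb : ∀ N : ℕ, 1 ≤ N → ∀ φ, ‖v N φ‖ ≤ |log A| + |log M| + C := by
    intro N hN φ
    rw [Real.norm_eq_abs, abs_of_nonneg (le_max_right _ _)]
    refine max_le ?_ (by positivity)
    linarith [hub' N hN φ, neg_abs_le (L φ), hLC φ]
  have hconst : IntervalIntegrable (fun _ => |log A| + |log M| + C) volume (φ₀ - π) (φ₀ + π) :=
    intervalIntegrable_const
  have hnz : ∀ᵐ φ, ∀ᶠ N in atTop, φ ∈ Ioc (φ₀ - π) (φ₀ + π) → Φ N (circleMap c R φ) ≠ 0 := by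
    obtain ⟨N₀, hN₀⟩ := eventually_atTop.1 hlow
    have h1 : ∀ N, N₀ ≤ N → ∀ᵐ φ, φ ∈ Ioc (φ₀ - π) (φ₀ + π) → Φ N (circleMap c R φ) ≠ 0 := by
      intro N hN
      rw [← ae_restrict_iff' measurableSet_Ioc]
      apply ae_restrict_le_codiscreteWithin measurableSet_Ioc
      have h2 := (hΦ N).preimage_zero_mem_codiscreteWithin (x := c)
        (norm_pos_iff.1 ((exp_pos _).trans_le (hN₀ N hN))) (mem_closedBall_self hR.le)
        (isConnected_closedBall hR.le)
      have h3 : Φ N ⁻¹' {0}ᶜ ∈ codiscreteWithin (sphere c |R|) := by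
        rw [abs_of_pos hR]
        exact codiscreteWithin_mono sphere_subset_closedBall h2
      exact codiscreteWithin_mono (subset_univ _) (circleMap_preimage_codiscrete hR.ne' h3)
    have h3 : ∀ᵐ φ, ∀ N, N₀ ≤ N → φ ∈ Ioc (φ₀ - π) (φ₀ + π) → Φ N (circleMap c R φ) ≠ 0 := by
      rw [ae_all_iff]
      intro N
      by_cases hN : N₀ ≤ N
      · filter_upwards [h1 N hN] with φ hφ _ using hφ
      · exact Eventually.of_forall fun φ h => absurd h hN
    filter_upwards [h3] with φ hφ
    filter_upwards [eventually_ge_atTop N₀] with N hN using hφ N hN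
  have hv : Tendsto (fun N => ∫ φ in (φ₀ - π)..(φ₀ + π), v N φ) atTop
      (𝓝 (∫ φ in (φ₀ - π)..(φ₀ + π), (0 : ℝ))) := by
    refine intervalIntegral.tendsto_integral_filter_of_dominated_convergence
      (fun _ => |log A| + |log M| + C) ?_ ?_ hconst ?_
    · exact Eventually.of_forall fun N => (hvm N).aestronglyMeasurable
    · filter_upwards [eventually_ge_atTop 1] with N hN
      exact Eventually.of_forall fun φ _ => hvb N hN φ
    · filter_upwards [hev, hnz] with φ hφ hφ0 hmem
      rw [uIoc_of_le hle] at hmem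
      refine tendsto_const_nhds.congr' ?_
      filter_upwards [hφ hmem, eventually_ge_atTop 1, hφ0] with N h1 hN1 h3
      have hN0 : (0 : ℝ) < N := by exact_mod_cast hN1
      have h4 : log ‖Φ N (circleMap c R φ)‖ ≤ N * L φ := by
        rw [Real.log_le_iff_le_exp (norm_pos_iff.2 (h3 hmem))]
        exact h1
      refine (max_eq_right ?_).symm
      simp only [g]
      rw [sub_nonpos, inv_mul_le_iff₀ hN0]
      exact h4
  have hLi : IntervalIntegrable L volume (φ₀ - π) (φ₀ + π) :=
    (intervalIntegrable_const (c := C)).mono_fun hL.aestronglyMeasurable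
      (Eventually.of_forall fun φ => by
        simpa [Real.norm_eq_abs, abs_of_nonneg hC] using hLC φ)
  rw [intervalIntegral.integral_zero] at hv
  have hkey : ∀ᶠ N : ℕ in atTop, l ≤ (2 * π)⁻¹ * ((∫ φ in (φ₀ - π)..(φ₀ + π), L φ) +
      ∫ φ in (φ₀ - π)..(φ₀ + π), v N φ) := by
    filter_upwards [hlow, eventually_ge_atTop 1] with N hN hN1
    have hN0 : (0 : ℝ) < N := by exact_mod_cast hN1
    have hc0 : 0 < ‖Φ N c‖ := (exp_pos _).trans_le hN
    have h1 := (hΦ N).log_norm_le_circleAverage hR (norm_pos_iff.1 hc0)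
    have h2 : N * l ≤ log ‖Φ N c‖ := by
      rw [← Real.log_exp (N * l)]
      exact Real.log_le_log (exp_pos _) hN
    have hci : CircleIntegrable (fun z => log ‖Φ N z‖) c R := by
      refine MeromorphicOn.circleIntegrable_log_norm ?_
      rw [abs_of_pos hR]
      exact fun z hz => (hΦ N z (sphere_subset_closedBall hz)).meromorphicAt
    have hper : Function.Periodic (fun φ => log ‖Φ N (circleMap c R φ)‖) (2 * π) :=
      fun φ => by simp [periodic_circleMap c R φ]
    have h3 : circleAverage (fun z => log ‖Φ N z‖) c R =
        (2 * π)⁻¹ * ∫ φ in (φ₀ - π)..(φ₀ + π), log ‖Φ N (circleMap c R φ)‖ := by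
      rw [circleAverage, smul_eq_mul]
      congr 1
      have := hper.intervalIntegral_add_eq 0 (φ₀ - π)
      rw [zero_add] at this
      rw [this]
      congr 1
      ring
    have hgi : IntervalIntegrable (fun φ => log ‖Φ N (circleMap c R φ)‖) volume (φ₀ - π)
        (φ₀ + π) := by
      exact hper.intervalIntegrable₀ two_pi_pos.ne' hci _ _
    have hvi : IntervalIntegrable (v N) volume (φ₀ - π) (φ₀ + π) :=
      hconst.mono_fun (hvm N).aestronglyMeasurable
        (Eventually.of_forall fun φ => (hvb N hN1 φ).trans (le_abs_self _))
    have h4 : (N : ℝ)⁻¹ * ∫ φ in (φ₀ - π)..(φ₀ + π), log ‖Φ N (circleMap c R φ)‖ ≤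
        (∫ φ in (φ₀ - π)..(φ₀ + π), L φ) + ∫ φ in (φ₀ - π)..(φ₀ + π), v N φ := by
      rw [← intervalIntegral.integral_add hLi hvi, ← intervalIntegral.integral_const_mul]
      refine intervalIntegral.integral_mono_on hle (hgi.const_mul _) (hLi.add hvi) fun φ _ => ?_
      have := le_max_left (g N φ - L φ) 0
      simp only [v, g] at this ⊢
      linarith
    rw [h3] at h1
    have h5 : l ≤ (N : ℝ)⁻¹ * ((2 * π)⁻¹ * ∫ φ in (φ₀ - π)..(φ₀ + π),
        log ‖Φ N (circleMap c R φ)‖) := by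
      rw [le_inv_mul_iff₀ hN0]
      linarith
    have h6 := mul_le_mul_of_nonneg_left h4 (inv_pos.2 two_pi_pos).le
    linarith [mul_left_comm (N : ℝ)⁻¹ (2 * π)⁻¹ (∫ φ in (φ₀ - π)..(φ₀ + π),
      log ‖Φ N (circleMap c R φ)‖)]
  have hlim := (hv.const_add (∫ φ in (φ₀ - π)..(φ₀ + π), L φ)).const_mul (2 * π)⁻¹
  rw [add_zero] at hlim
  exact ge_of_tendsto hlim hkey

end

section

open MeasureTheory Set Metric Filter Topology Real

/-- Two-constants version of Jensen's inequality for a sequence of analytic functions. -/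
theorem le_two_constants_of_eventually_norm_le_exp {Φ : ℕ → ℂ → ℂ} {c : ℂ} {R φ₀ α l l₁ l₂ A M : ℝ}
    (hR : 0 < R) (hα : 0 ≤ α) (hαπ : α ≤ π)
    (hΦ : ∀ N, AnalyticOnNhd ℂ (Φ N) (closedBall c R))
    (hA : 0 < A) (hM : 0 < M) (hbd : ∀ N, ∀ z ∈ sphere c R, ‖Φ N z‖ ≤ A * M ^ N)
    (hlow : ∀ᶠ N : ℕ in atTop, exp (N * l) ≤ ‖Φ N c‖)
    (h1 : ∀ᵐ φ, φ ∈ Ioo (φ₀ - α) (φ₀ + α) →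
      ∀ᶠ N : ℕ in atTop, ‖Φ N (circleMap c R φ)‖ ≤ exp (N * l₁))
    (h2 : ∀ᵐ φ, ∀ᶠ N : ℕ in atTop, ‖Φ N (circleMap c R φ)‖ ≤ exp (N * l₂)) :
    π * l ≤ α * l₁ + (π - α) * l₂ := by
  classical
  let L : ℝ → ℝ := fun φ => (Ioo (φ₀ - α) (φ₀ + α)).indicator (fun _ => l₁ - l₂) φ + l₂
  have hL : Measurable L := (measurable_const.indicator measurableSet_Ioo).add_const _
  have key := le_integral_of_eventually_norm_le_exp (φ₀ := φ₀) (L := L) (C := |l₁| + |l₂|) hR hΦ hA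
    hM hbd hlow hL ?_ ?_
  · have hle : φ₀ - π ≤ φ₀ + π := by linarith [pi_pos]
    have hInt : ∫ φ in (φ₀ - π)..(φ₀ + π), L φ = 2 * α * (l₁ - l₂) + 2 * π * l₂ := by
      rw [intervalIntegral.integral_add, intervalIntegral.integral_const,
        intervalIntegral.integral_of_le hle, setIntegral_indicator measurableSet_Ioo]
      · have : Ioc (φ₀ - π) (φ₀ + π) ∩ Ioo (φ₀ - α) (φ₀ + α) = Ioo (φ₀ - α) (φ₀ + α) :=
          inter_eq_right.2 fun x hx => ⟨by linarith [hx.1], by linarith [hx.2]⟩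
        rw [this, setIntegral_const, measureReal_def, Real.volume_Ioo,
          ENNReal.toReal_ofReal (by linarith)]
        simp only [smul_eq_mul]
        ring
      · rw [intervalIntegrable_iff]
        refine Integrable.indicator ?_ measurableSet_Ioo
        exact intervalIntegrable_iff.1 intervalIntegrable_const
      · exact intervalIntegrable_const
    rw [hInt] at key
    have h3 : (2 * π)⁻¹ * (2 * α * (l₁ - l₂) + 2 * π * l₂) =
        π⁻¹ * (α * l₁ + (π - α) * l₂) := by
      have := pi_pos.ne'
      field_simp
      ring
    rw [h3, le_inv_mul_iff₀ pi_pos] at key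
    exact key
  · intro φ
    by_cases h : φ ∈ Ioo (φ₀ - α) (φ₀ + α)
    · simp only [L, indicator_of_mem h, sub_add_cancel]
      linarith [abs_nonneg l₂]
    · simp only [L, indicator_of_notMem h, zero_add]
      linarith [abs_nonneg l₁]
  · filter_upwards [h1, h2] with φ h1 h2 _
    by_cases h : φ ∈ Ioo (φ₀ - α) (φ₀ + α)
    · simp only [L, indicator_of_mem h, sub_add_cancel]
      exact h1 h
    · simp only [L, indicator_of_notMem h, zero_add]
      exact h2

end

section

open MeasureTheory Set Metric Filter Topology Real

/-- Harnack-type inequality for zero-free holomorphic functions. -/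
theorem norm_center_le_sq_mul_norm {g : ℂ → ℂ} {z₀ : ℂ} {r K : ℝ} (hr : 0 < r) (hK : 1 < K)
    (hg : DifferentiableOn ℂ g (ball z₀ r)) (h0 : ∀ z ∈ ball z₀ r, g z ≠ 0)
    (hb : ∀ z ∈ ball z₀ r, ‖g z‖ ≤ K * ‖g z₀‖) {z : ℂ} (hz : z ∈ closedBall z₀ (r / 2)) :
    ‖g z₀‖ ≤ K ^ 2 * ‖g z‖ := by
  have hz0 : z₀ ∈ ball z₀ r := mem_ball_self hr
  have hq : DifferentiableOn ℂ (fun z => deriv g z / g z) (ball z₀ r) :=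
    (hg.deriv isOpen_ball).div hg h0
  obtain ⟨F, hF0, hF⟩ := hq.isExactOn_ball.with_val_at z₀ 0
  have hconst : ∀ w ∈ ball z₀ r, g w * Complex.exp (-F w) = g z₀ := by
    have hd : ∀ w ∈ ball z₀ r, HasDerivAt (fun w => g w * Complex.exp (-F w)) 0 w := by
      intro w hw
      have h1 := (hg.differentiableAt (isOpen_ball.mem_nhds hw)).hasDerivAt
      have h2 := (hF w hw).neg.cexp
      refine (h1.mul h2).congr_deriv ?_
      have := h0 w hw
      field_simp
      simp
    intro w hw
    have := (convex_ball z₀ r).is_const_of_fderivWithin_eq_zero (𝕜 := ℂ)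
      (f := fun w => g w * Complex.exp (-F w))
      (fun w hw => (hd w hw).differentiableAt.differentiableWithinAt) (fun w hw => ?_) hw hz0
    · simpa [hF0] using this
    · rw [fderivWithin_of_isOpen isOpen_ball hw, (hd w hw).hasFDerivAt.fderiv]
      ext; simp
  have hnorm : ∀ w ∈ ball z₀ r, ‖g w‖ = ‖g z₀‖ * exp (F w).re := by
    intro w hw
    rw [← hconst w hw, norm_mul, Complex.norm_exp, mul_assoc, ← exp_add]
    simp
  have hpos : 0 < ‖g z₀‖ := norm_pos_iff.2 (h0 _ hz0)
  have hre : ∀ w ∈ ball z₀ r, (F w).re ≤ log K := by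
    intro w hw
    have h1 := hb w hw
    rw [hnorm w hw, mul_comm, mul_le_mul_iff_left₀ hpos] at h1
    exact (le_log_iff_exp_le (by linarith)).2 h1
  have hbc := Complex.borelCaratheodory_zero (f := fun w => F (z₀ + w)) (R := r) (M := log K)
    (z := z - z₀) (log_pos hK) ?_ ?_ hr ?_ (by simpa using hF0)
  · have hzn : ‖z - z₀‖ ≤ r / 2 := by rwa [mem_closedBall, dist_eq_norm] at hz
    have hle : ‖F z‖ ≤ 2 * log K := by
      simp only [add_sub_cancel] at hbc
      refine hbc.trans ?_
      rw [div_le_iff₀ (by linarith)]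
      have := log_pos hK
      nlinarith
    have hzr : z ∈ ball z₀ r := closedBall_subset_ball (by linarith) hz
    rw [hnorm z hzr]
    have h1 : -(2 * log K) ≤ (F z).re := by
      have := Complex.abs_re_le_norm (F z)
      linarith [neg_abs_le (F z).re]
    have h2 : exp (-(2 * log K)) ≤ exp (F z).re := exp_le_exp.2 h1
    have h3 : K ^ 2 * exp (-(2 * log K)) = 1 := by
      rw [exp_neg, mul_comm 2, exp_mul, exp_log (by linarith)]
      norm_cast
      have : K ^ 2 ≠ 0 := by positivity
      exact mul_inv_cancel₀ this
    calc ‖g z₀‖ = ‖g z₀‖ * (K ^ 2 * exp (-(2 * log K))) := by rw [h3, mul_one]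
      _ ≤ ‖g z₀‖ * (K ^ 2 * exp (F z).re) := by gcongr
      _ = _ := by ring
  · intro w hw
    have hw' : z₀ + w ∈ ball z₀ r := by simpa using hw
    exact ((hF _ hw').comp_const_add z₀ w).differentiableAt.differentiableWithinAt
  · intro w hw
    exact hre _ (by simpa using hw)
  · rw [mem_ball_zero_iff]
    rw [mem_closedBall, dist_eq_norm] at hz
    linarith

/-- Division by a zero close to the centre of a disc improves the ratio between the supremum and
the central value. -/
theorem exists_factor_of_zero {f : ℂ → ℂ} {z₀ u : ℂ} {R B : ℝ} (hR : 0 < R)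
    (hf : AnalyticOnNhd ℂ f (closedBall z₀ R)) (h0 : f z₀ ≠ 0)
    (hb : ∀ z ∈ closedBall z₀ R, ‖f z‖ ≤ B * ‖f z₀‖) (hu : u ∈ closedBall z₀ (R / 4))
    (hfu : f u = 0) : ∃ g : ℂ → ℂ, AnalyticOnNhd ℂ g (closedBall z₀ R) ∧ g z₀ ≠ 0 ∧
      (∀ z, f z = (z - u) * g z) ∧ ∀ z ∈ closedBall z₀ R, ‖g z‖ ≤ B / 3 * ‖g z₀‖ := by
  have hfac : ∀ z, f z = (z - u) * dslope f u z := fun z => by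
    have := sub_smul_dslope f u z
    simp only [hfu, sub_zero, smul_eq_mul] at this
    exact this.symm
  have hB : 0 ≤ B := by
    by_contra! h
    have := hb z₀ (mem_closedBall_self hR.le)
    nlinarith [norm_pos_iff.2 h0, norm_nonneg (f z₀)]
  have huR : u ∈ closedBall z₀ R := closedBall_subset_closedBall (by linarith) hu
  have han : AnalyticOnNhd ℂ (dslope f u) (closedBall z₀ R) := by
    obtain ⟨U, hU, hUf⟩ : ∃ U, IsOpen U ∧ closedBall z₀ R ⊆ U ∧ DifferentiableOn ℂ f U := by
      refine ⟨{z | AnalyticAt ℂ f z}, isOpen_analyticAt ℂ f, fun z hz => hf z hz,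
        fun z hz => hz.differentiableAt.differentiableWithinAt⟩
    have h1 : DifferentiableOn ℂ (dslope f u) U :=
      (Complex.differentiableOn_dslope (hU.mem_nhds (hUf.1 huR))).2 hUf.2
    exact (h1.analyticOnNhd hU).mono hUf.1
  have hg0 : dslope f u z₀ ≠ 0 := fun h => h0 (by rw [hfac, h, mul_zero])
  refine ⟨dslope f u, han, hg0, hfac, fun z hz => ?_⟩
  rw [mem_closedBall, dist_comm, dist_eq_norm] at hu
  have hcen : ‖f z₀‖ ≤ R / 4 * ‖dslope f u z₀‖ := by
    rw [hfac z₀, norm_mul]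
    gcongr
  refine Complex.norm_le_of_forall_mem_frontier_norm_le (U := ball z₀ R) isBounded_ball
    ?_ ?_ (by rwa [closure_ball _ hR.ne'])
  · refine DifferentiableOn.diffContOnCl ?_
    rw [closure_ball _ hR.ne']
    exact han.differentiableOn
  · intro w hw
    rw [frontier_ball _ hR.ne', mem_sphere, dist_eq_norm] at hw
    have h1 := hb w (by rw [mem_closedBall, dist_eq_norm]; exact hw.le)
    rw [hfac w, norm_mul] at h1
    have h2 : 3 * R / 4 ≤ ‖w - u‖ := by
      have := norm_sub_norm_le (w - z₀) (u - z₀)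
      rw [norm_sub_rev u z₀, sub_sub_sub_cancel_right] at this
      linarith
    have h3 : 3 * R / 4 * ‖dslope f u w‖ ≤ B * (R / 4 * ‖dslope f u z₀‖) :=
      (mul_le_mul_of_nonneg_right h2 (norm_nonneg _)).trans
        (h1.trans (mul_le_mul_of_nonneg_left hcen hB))
    have h4 : R * (3 * ‖dslope f u w‖) ≤ R * (B * ‖dslope f u z₀‖) := by linarith
    have h5 := le_of_mul_le_mul_left h4 hR
    linarith

/-- Lower bound for an analytic function in terms of its distance to a controlled number of
zeros. -/
theorem exists_multiset_lower_bound {z₀ : ℂ} {R : ℝ} (hR : 0 < R) (n : ℕ) :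
    ∀ f : ℂ → ℂ, AnalyticOnNhd ℂ f (closedBall z₀ R) → f z₀ ≠ 0 →
      (∀ z ∈ closedBall z₀ R, ‖f z‖ ≤ 3 ^ n * ‖f z₀‖) →
      ∃ s : Multiset ℂ, s.card ≤ n ∧ (∀ u ∈ s, u ∈ closedBall z₀ (R / 4)) ∧
        ∀ z ∈ closedBall z₀ (R / 8),
          ‖f z₀‖ * (s.map fun u => ‖z - u‖ / (R / 4)).prod ≤ 9 ^ (n + 1) * ‖f z‖ := by
  have hfree : ∀ (n : ℕ) (f : ℂ → ℂ), AnalyticOnNhd ℂ f (closedBall z₀ R) →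
      (∀ z ∈ closedBall z₀ R, ‖f z‖ ≤ 3 ^ n * ‖f z₀‖) →
      (∀ u ∈ closedBall z₀ (R / 4), f u ≠ 0) →
      ∀ z ∈ closedBall z₀ (R / 8), ‖f z₀‖ ≤ 9 ^ (n + 1) * ‖f z‖ := by
    intro n f hf hb hne z hz
    have hsub : ball z₀ (R / 4) ⊆ closedBall z₀ R :=
      ball_subset_closedBall.trans (closedBall_subset_closedBall (by linarith))
    have := norm_center_le_sq_mul_norm (g := f) (z₀ := z₀) (r := R / 4) (K := 3 ^ (n + 1))
      (by positivity) (one_lt_pow₀ (by norm_num) (by simp)) (hf.differentiableOn.mono hsub)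
      (fun z hz => hne z (ball_subset_closedBall hz)) (fun z hz => (hb z (hsub hz)).trans ?_)
      (z := z) (by rwa [div_div, show (4 : ℝ) * 2 = 8 by norm_num])
    · rwa [← pow_mul, mul_comm (n + 1) 2, pow_mul, show (3 : ℝ) ^ 2 = 9 by norm_num] at this
    · gcongr <;> norm_num
  induction n with
  | zero =>
    intro f hf h0 hb
    refine ⟨0, by simp, by simp, ?_⟩
    simp only [Multiset.map_zero, Multiset.prod_zero, mul_one]
    refine hfree 0 f hf hb fun u hu hfu => ?_
    obtain ⟨g, -, hg0, -, hgb⟩ := exists_factor_of_zero hR hf h0 hb hu hfu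
    have h1 := hgb z₀ (mem_closedBall_self hR.le)
    have h2 := norm_pos_iff.2 hg0
    rw [pow_zero] at h1
    linarith
  | succ n ih =>
    intro f hf h0 hb
    by_cases hne : ∀ u ∈ closedBall z₀ (R / 4), f u ≠ 0
    · exact ⟨0, by simp, by simp, by simpa using hfree (n + 1) f hf hb hne⟩
    push Not at hne
    obtain ⟨u, hu, hfu⟩ := hne
    obtain ⟨g, hg, hg0, hfg, hgb⟩ := exists_factor_of_zero hR hf h0 hb hu hfu
    obtain ⟨s, hs, hsu, hsb⟩ := ih g hg hg0 fun z hz => (hgb z hz).trans_eq (by ring)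
    refine ⟨u ::ₘ s, by simpa using hs, ?_, fun z hz => ?_⟩
    · intro v hv
      rcases Multiset.mem_cons.1 hv with rfl | hv
      exacts [hu, hsu v hv]
    · rw [Multiset.map_cons, Multiset.prod_cons, hfg z₀, hfg z, norm_mul, norm_mul]
      have h1 : ‖z₀ - u‖ ≤ R / 4 := by rwa [mem_closedBall, dist_comm, dist_eq_norm] at hu
      have h2 := hsb z hz
      set P := (s.map fun u => ‖z - u‖ / (R / 4)).prod
      have hP : 0 ≤ P := Multiset.prod_nonneg fun a ha => by
        obtain ⟨u, -, rfl⟩ := Multiset.mem_map.1 ha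
        positivity
      calc ‖z₀ - u‖ * ‖g z₀‖ * (‖z - u‖ / (R / 4) * P)
          ≤ R / 4 * ‖g z₀‖ * (‖z - u‖ / (R / 4) * P) := by gcongr
        _ = ‖z - u‖ * (‖g z₀‖ * P) := by field_simp
        _ ≤ ‖z - u‖ * (9 ^ (n + 1) * ‖g z‖) := by gcongr
        _ ≤ 9 ^ (n + 1 + 1) * (‖z - u‖ * ‖g z‖) := by
          rw [pow_succ _ (n + 1)]
          have : 0 ≤ 9 ^ (n + 1) * (‖z - u‖ * ‖g z‖) := by positivity
          nlinarith

end

section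

open MeasureTheory Set Metric Filter Topology Real

theorem exists_lintegral_log_le (x₀ : ℝ) {R : ℝ} (hR : 0 < R) : ∃ C : NNReal, ∀ a : ℝ,
    |a - x₀| ≤ R / 4 →
    ∫⁻ t in Icc (x₀ - R / 8) (x₀ + R / 8), ENNReal.ofReal (log (R / 2) - log (t - a)) ≤ C := by
  obtain ⟨B, hB⟩ := (isCompact_Icc (a := -R) (b := R)).exists_bound_of_continuousOn
    continuous_mul_log.continuousOn
  refine ⟨(R * |log (R / 2)| + 2 * B + R).toNNReal, fun a ha => ?_⟩
  have hle : x₀ - R / 8 ≤ x₀ + R / 8 := by linarith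
  rw [abs_le] at ha
  have hlog : IntervalIntegrable (fun t => log (t - a)) volume (x₀ - R / 8) (x₀ + R / 8) := by
    have := (intervalIntegral.intervalIntegrable_log' (a := x₀ - R / 8 - a)
      (b := x₀ + R / 8 - a)).comp_sub_right a
    simpa using this
  have hInt : IntervalIntegrable (fun t => log (R / 2) - log (t - a)) volume
      (x₀ - R / 8) (x₀ + R / 8) := intervalIntegrable_const.sub hlog
  rw [← ofReal_integral_eq_lintegral_ofReal]
  · refine ENNReal.ofReal_le_ofReal ?_
    rw [integral_Icc_eq_integral_Ioc, ← intervalIntegral.integral_of_le hle,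
      intervalIntegral.integral_sub intervalIntegrable_const hlog,
      intervalIntegral.integral_const, intervalIntegral.integral_comp_sub_right, integral_log]
    have h1 := hB (x₀ + R / 8 - a) ⟨by linarith, by linarith⟩
    have h2 := hB (x₀ - R / 8 - a) ⟨by linarith, by linarith⟩
    rw [Real.norm_eq_abs, abs_le] at h1 h2
    simp only [smul_eq_mul]
    have h3 := mul_le_mul_of_nonneg_left (le_abs_self (log (R / 2))) hR.le
    have h4 := mul_nonneg hR.le (abs_nonneg (log (R / 2)))
    have h5 := mul_le_mul_of_nonneg_left (le_abs_self (log (R / 2))) (by linarith : 0 ≤ R / 4)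
    nlinarith
  · exact (intervalIntegrable_iff_integrableOn_Icc_of_le hle).1 hInt
  · filter_upwards [ae_restrict_mem measurableSet_Icc,
      ae_restrict_of_ae ((countable_singleton a).ae_notMem volume)] with t ht hta
    rw [mem_singleton_iff] at hta
    simp only [Pi.zero_apply, sub_nonneg]
    rw [← Real.log_abs (t - a)]
    refine Real.log_le_log (abs_pos.2 (sub_ne_zero.2 hta)) ?_
    rw [abs_le]
    constructor <;> linarith [ht.1, ht.2]

theorem volume_re_image_eq_zero {Φ : ℕ → ℂ → ℂ} {z₀ : ℂ} {R A M b : ℝ} (hR : 0 < R) (hA : 0 < A)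
    (hM : 0 < M) (hb : 0 < b) (hΦ : ∀ N, AnalyticOnNhd ℂ (Φ N) (closedBall z₀ R))
    (hbd : ∀ N, ∀ z ∈ closedBall z₀ R, ‖Φ N z‖ ≤ A * M ^ N) (hlow : ∀ N, b ^ N ≤ ‖Φ N z₀‖)
    {S : Set ℂ} (hS : S ⊆ closedBall z₀ (R / 8))
    (hz : ∀ z ∈ S, ∀ ε > 0, ∀ᶠ N in atTop, ‖Φ N z‖ ≤ ε ^ N) : volume (Complex.re '' S) = 0 := by
  obtain ⟨k, hk⟩ := pow_unbounded_of_one_lt (max A 1 * M / b) (by norm_num : (1 : ℝ) < 3)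
  have hpos : ∀ N, 0 < ‖Φ N z₀‖ := fun N => (pow_pos hb N).trans_le (hlow N)
  have hratio : ∀ N, 1 ≤ N → ∀ z ∈ closedBall z₀ R, ‖Φ N z‖ ≤ 3 ^ (k * N) * ‖Φ N z₀‖ := by
    intro N hN z hz
    have h1 : A ≤ max A 1 ^ N := (le_max_left _ _).trans
      (le_self_pow₀ (le_max_right _ _) (by omega))
    calc ‖Φ N z‖ ≤ A * M ^ N := hbd N z hz
      _ ≤ max A 1 ^ N * M ^ N := by gcongr
      _ = (max A 1 * M / b * b) ^ N := by rw [div_mul_cancel₀ _ hb.ne', mul_pow]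
      _ ≤ (3 ^ k * b) ^ N := by gcongr
      _ = 3 ^ (k * N) * b ^ N := by rw [mul_pow, pow_mul]
      _ ≤ _ := by gcongr; exact hlow N
  choose s hs hsu hsb using fun N : ℕ => exists_multiset_lower_bound hR (k * (N + 1)) (Φ (N + 1))
    (hΦ _) (norm_pos_iff.1 (hpos _)) (hratio (N + 1) (by omega))
  set x₀ := z₀.re
  set I := Icc (x₀ - R / 8) (x₀ + R / 8)
  let w : ℂ → ℝ → ENNReal := fun u t => ENNReal.ofReal (log (R / 2) - log (t - u.re))
  have hwm : ∀ u, Measurable (w u) := fun u => by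
    refine Measurable.ennreal_ofReal ?_
    exact measurable_const.sub (Real.measurable_log.comp (measurable_id.sub_const _))
  obtain ⟨C, hC⟩ := exists_lintegral_log_le x₀ hR
  have hsum : ∀ s : Multiset ℂ, (∀ u ∈ s, u ∈ closedBall z₀ (R / 4)) →
      Measurable (fun t => (s.map fun u => w u t).sum) ∧
      ∫⁻ t in I, (s.map fun u => w u t).sum ≤ s.card * C := by
    intro s
    induction s using Multiset.induction_on with
    | empty => simp
    | cons u s ih =>
      intro h
      obtain ⟨h1, h2⟩ := ih fun v hv => h v (Multiset.mem_cons_of_mem hv)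
      simp only [Multiset.map_cons, Multiset.sum_cons, Multiset.card_cons, Nat.cast_add,
        Nat.cast_one]
      refine ⟨(hwm u).add h1, ?_⟩
      rw [lintegral_add_left (hwm u), add_mul, one_mul, add_comm]
      refine add_le_add h2 (hC _ ?_)
      have h3 := h u (Multiset.mem_cons_self u s)
      rw [mem_closedBall, dist_eq_norm] at h3
      exact (Complex.abs_re_le_norm (u - z₀)).trans h3
  have hprod : ∀ (t : ℝ) (z : ℂ), z.re = t → t ∈ I → ∀ s : Multiset ℂ,
      (∀ u ∈ s, u ∈ closedBall z₀ (R / 4)) → (∀ u ∈ s, u.re ≠ t) →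
      (s.map fun u => w u t).sum ≠ ⊤ ∧ exp (-((s.map fun u => w u t).sum).toReal) ≤
        (s.map fun u => ‖z - u‖ / (R / 4)).prod := by
    intro t z hzt ht s
    induction s using Multiset.induction_on with
    | empty => simp
    | cons u s ih =>
      intro h h'
      obtain ⟨h1, h2⟩ := ih (fun v hv => h v (Multiset.mem_cons_of_mem hv))
        fun v hv => h' v (Multiset.mem_cons_of_mem hv)
      have hut := h' u (Multiset.mem_cons_self u s)
      simp only [Multiset.map_cons, Multiset.sum_cons, Multiset.prod_cons]
      have hw : w u t ≠ ⊤ := ENNReal.ofReal_ne_top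
      refine ⟨ENNReal.add_ne_top.2 ⟨hw, h1⟩, ?_⟩
      rw [ENNReal.toReal_add hw h1, neg_add, exp_add]
      refine mul_le_mul ?_ h2 (exp_pos _).le (by positivity)
      have habs : 0 < |t - u.re| := abs_pos.2 (sub_ne_zero.2 (Ne.symm hut))
      have h3 := h u (Multiset.mem_cons_self u s)
      rw [mem_closedBall, dist_eq_norm] at h3
      have h4 := abs_le.1 ((Complex.abs_re_le_norm (u - z₀)).trans h3)
      rw [Complex.sub_re] at h4
      have h5 : |t - u.re| ≤ R / 2 := by
        rw [abs_le]
        constructor <;> linarith [ht.1, ht.2, h4.1, h4.2]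
      have h6 : |t - u.re| ≤ ‖z - u‖ := by
        rw [← hzt, ← Complex.sub_re]
        exact Complex.abs_re_le_norm _
      simp only [w]
      rw [← Real.log_abs (t - u.re), ENNReal.toReal_ofReal
        (sub_nonneg.2 (Real.log_le_log habs h5)), neg_sub, exp_sub, exp_log habs,
        exp_log (by positivity)]
      gcongr
      linarith
  have hfat := ae_exists_frequently_le_of_lintegral_le (μ := volume.restrict I)
    (u := fun N t => ((N + 1 : ℕ) : ENNReal)⁻¹ * ((s N).map fun u => w u t).sum)
    (fun N => (hsum (s N) (hsu N)).1.const_mul _) (B := k * C)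
    (ENNReal.mul_ne_top (by simp) (by simp)) ?_
  · rw [ae_restrict_iff' measurableSet_Icc] at hfat
    have hcount : (⋃ N, Complex.re '' {u | u ∈ s N}).Countable :=
      countable_iUnion fun N => ((Multiset.finite_toSet (s N)).image _).countable
    have hae := hcount.ae_notMem volume
    refine measure_mono_null ?_ (ae_iff.1 (hfat.and hae))
    rintro t ⟨z, hzS, rfl⟩ hcon
    have hzb := hS hzS
    have htI : z.re ∈ I := by
      rw [mem_closedBall, dist_eq_norm] at hzb
      have := abs_le.1 ((Complex.abs_re_le_norm (z - z₀)).trans hzb)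
      rw [Complex.sub_re] at this
      exact ⟨by linarith [this.1], by linarith [this.2]⟩
    obtain ⟨c, hc, hfreq⟩ := hcon.1 htI
    set c' := c.toReal
    have hε : 0 < b * exp (-c') / 9 ^ k / 18 := by positivity
    have hev := (tendsto_add_atTop_nat 1).eventually (hz z hzS _ hε)
    obtain ⟨N, hN1, hN2⟩ := (hfreq.and_eventually hev).exists
    obtain ⟨h1, h2⟩ := hprod z.re z rfl htI (s N) (hsu N) fun u hu h => hcon.2
      (mem_iUnion.2 ⟨N, u, hu, h⟩)
    have h3 := hsb N z hzb
    have h4 : ((s N).map fun u => w u z.re).sum.toReal ≤ c' * (N + 1 : ℕ) := by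
      have h5 : ((s N).map fun u => w u z.re).sum ≤ c * (N + 1 : ℕ) := by
        rwa [mul_comm, ← div_eq_mul_inv, ENNReal.div_le_iff (by simp) (by simp)] at hN1
      have := ENNReal.toReal_mono (ENNReal.mul_ne_top hc (by simp)) h5
      rwa [ENNReal.toReal_mul, ENNReal.toReal_natCast] at this
    have h6 : exp (-c') ^ (N + 1) ≤ exp (-((s N).map fun u => w u z.re).sum.toReal) := by
      rw [← exp_nat_mul]
      refine exp_le_exp.2 ?_
      linarith
    have h7 : (b * exp (-c')) ^ (N + 1) ≤ 9 ^ (k * (N + 1) + 1) *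
        (b * exp (-c') / 9 ^ k / 18) ^ (N + 1) := by
      calc (b * exp (-c')) ^ (N + 1) = b ^ (N + 1) * exp (-c') ^ (N + 1) := mul_pow _ _ _
        _ ≤ ‖Φ (N + 1) z₀‖ * ((s N).map fun u => ‖z - u‖ / (R / 4)).prod :=
          mul_le_mul (hlow _) (h6.trans h2) (by positivity) (norm_nonneg _)
        _ ≤ 9 ^ (k * (N + 1) + 1) * ‖Φ (N + 1) z‖ := h3
        _ ≤ _ := by gcongr
    rw [div_pow, div_pow, ← pow_mul, pow_succ 9 (k * (N + 1))] at h7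
    have h8 : (9 : ℝ) ^ (k * (N + 1)) * 9 * ((b * exp (-c')) ^ (N + 1) / 9 ^ (k * (N + 1)) /
        18 ^ (N + 1)) = (b * exp (-c')) ^ (N + 1) * (9 / 18 ^ (N + 1)) := by
      field_simp
    rw [h8] at h7
    have h9 : (9 : ℝ) / 18 ^ (N + 1) < 1 := by
      rw [div_lt_one (by positivity)]
      calc (9 : ℝ) < 18 := by norm_num
        _ ≤ 18 ^ (N + 1) := le_self_pow₀ (by norm_num) (by omega)
    have h10 : 0 < (b * exp (-c')) ^ (N + 1) := by positivity
    nlinarith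
  · intro N
    have h1 := hsum (s N) (hsu N)
    rw [lintegral_const_mul _ h1.1]
    refine (mul_le_mul_right h1.2 _).trans ?_
    have h2 : (((s N).card : ℕ) : ENNReal) ≤ (k * (N + 1) : ℕ) := by exact_mod_cast hs N
    calc ((N + 1 : ℕ) : ENNReal)⁻¹ * (((s N).card : ENNReal) * C)
        ≤ ((N + 1 : ℕ) : ENNReal)⁻¹ * (((k * (N + 1) : ℕ) : ENNReal) * C) := by gcongr
      _ = (((N + 1 : ℕ) : ENNReal)⁻¹ * ((N + 1 : ℕ) : ENNReal)) * (k * C) := by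
        rw [Nat.cast_mul]; ring
      _ = k * C := by rw [ENNReal.inv_mul_cancel (by simp) (by simp), one_mul]

end

section

open MeasureTheory Set Metric Filter Topology Real

theorem ContinuousOn.slice_uncurry {α β γ : Type*} [TopologicalSpace α] [TopologicalSpace β]
    [TopologicalSpace γ] {H : α → β → γ} {s : Set α} {t : Set β}
    (hH : ContinuousOn (Function.uncurry H) (s ×ˢ t)) {w : α} (hw : w ∈ s) :
    ContinuousOn (H w) t :=
  hH.comp (f := fun x => (w, x)) (by fun_prop) fun _ hx => ⟨hw, hx⟩

theorem hasFDerivAt_intervalIntegral_of_continuousOn {V E : Type*} [NormedAddCommGroup V]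
    [NormedSpace ℝ V] [FiniteDimensional ℝ V] [NormedAddCommGroup E] [NormedSpace ℝ E]
    {F : V → ℝ → E} {F' : V → ℝ → V →L[ℝ] E} {W : Set V} (hW : IsOpen W)
    (hF : ContinuousOn (Function.uncurry F) (W ×ˢ Icc 0 1))
    (hF' : ContinuousOn (Function.uncurry F') (W ×ˢ Icc 0 1))
    (hd : ∀ w ∈ W, ∀ s ∈ Icc (0 : ℝ) 1, HasFDerivAt (fun w => F w s) (F' w s) w) :
    (∀ w ∈ W, HasFDerivAt (fun w => ∫ s in (0 : ℝ)..1, F w s) (∫ s in (0 : ℝ)..1, F' w s) w) ∧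
      ContinuousOn (fun w => ∫ s in (0 : ℝ)..1, F' w s) W := by
  have : ProperSpace V := FiniteDimensional.proper ℝ V
  have hI : uIoc (0 : ℝ) 1 ⊆ Icc 0 1 := by
    rw [uIoc_of_le zero_le_one]; exact Ioc_subset_Icc_self
  have hb : ∀ w ∈ W, ∃ r > 0, closedBall w r ⊆ W ∧ ∃ C, ∀ x ∈ closedBall w r,
      ∀ s ∈ Icc (0 : ℝ) 1, ‖F' x s‖ ≤ C := by
    intro w hw
    obtain ⟨r, hr, hrW⟩ := nhds_basis_closedBall.mem_iff.1 (hW.mem_nhds hw)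
    obtain ⟨C, hC⟩ := ((isCompact_closedBall w r).prod (isCompact_Icc (a := (0 : ℝ))
      (b := 1))).exists_bound_of_continuousOn (hF'.mono (prod_mono hrW subset_rfl))
    exact ⟨r, hr, hrW, C, fun x hx s hs => hC (x, s) ⟨hx, hs⟩⟩
  constructor
  · intro w hw
    obtain ⟨r, hr, hrW, C, hC⟩ := hb w hw
    refine intervalIntegral.hasFDerivAt_integral_of_dominated_of_fderiv_le (bound := fun _ => C)
      (closedBall_mem_nhds w hr) ?_ ?_ ?_ ?_ (by simp) ?_
    · filter_upwards [hW.mem_nhds hw] with x hx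
      exact ((hF.slice_uncurry hx).mono hI).aestronglyMeasurable measurableSet_uIoc
    · exact (hF.slice_uncurry hw).intervalIntegrable_of_Icc zero_le_one
    · exact ((hF'.slice_uncurry hw).mono hI).aestronglyMeasurable measurableSet_uIoc
    · exact Eventually.of_forall fun s hs x hx => hC x hx s (hI hs)
    · exact Eventually.of_forall fun s hs x hx => hd x (hrW hx) s (hI hs)
  · intro w hw
    obtain ⟨r, hr, hrW, C, hC⟩ := hb w hw
    refine (intervalIntegral.continuousAt_of_dominated_interval (bound := fun _ => C)
      ?_ ?_ (by simp) ?_).continuousWithinAt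
    · filter_upwards [hW.mem_nhds hw] with x hx
      exact ((hF'.slice_uncurry hx).mono hI).aestronglyMeasurable measurableSet_uIoc
    · filter_upwards [closedBall_mem_nhds w hr] with x hx
      exact Eventually.of_forall fun s hs => hC x hx s (hI hs)
    · refine Eventually.of_forall fun s hs => ?_
      have h1 : ContinuousOn (fun x => F' x s) W :=
        hF'.comp (f := fun x => (x, s)) (by fun_prop) fun x hx => ⟨hx, hI hs⟩
      exact h1.continuousAt (hW.mem_nhds hw)

/-- The radial graph `θ ↦ exp (X θ + i θ)`. -/
noncomputable def polarGraph (X : ℝ → ℝ) (θ : ℝ) : ℂ := Complex.exp (X θ + θ * Complex.I)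

theorem locallyLipschitz_polarGraph {X : ℝ → ℝ} {L : NNReal} (hX : LipschitzWith L X) :
    LocallyLipschitz (polarGraph X) := by
  have h1 : LocallyLipschitz Complex.exp :=
    (Complex.contDiff_exp (𝕜 := ℝ) (n := 1)).locallyLipschitz
  have h2 : LocallyLipschitz fun θ : ℝ => (X θ : ℂ) + θ * Complex.I := by
    have h3 : LipschitzWith (1 * L + 1) fun θ : ℝ => (X θ : ℂ) + θ * Complex.I := by
      refine LipschitzWith.add (f := fun θ => (X θ : ℂ)) (Complex.isometry_ofReal.lipschitz.comp hX)
        (LipschitzWith.of_dist_le_mul fun x y => ?_)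
      rw [dist_eq_norm, ← sub_mul, norm_mul, Complex.norm_I, mul_one, ← Complex.ofReal_sub,
        Complex.norm_real, NNReal.coe_one, one_mul, dist_eq_norm]
    exact h3.locallyLipschitz
  exact h1.comp h2

theorem hasDerivAt_polarGraph {X : ℝ → ℝ} {θ : ℝ} (hX : DifferentiableAt ℝ X θ) :
    HasDerivAt (polarGraph X) (polarGraph X θ * (deriv X θ + Complex.I)) θ := by
  have h1 : HasDerivAt (fun θ : ℝ => (X θ : ℂ) + θ * Complex.I) (deriv X θ + Complex.I) θ := by
    have := hX.hasDerivAt.ofReal_comp.add ((hasDerivAt_id θ).ofReal_comp.mul_const Complex.I)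
    rwa [Complex.ofReal_one, one_mul] at this
  exact h1.cexp

theorem integral_polarGraph_le {X : ℝ → ℝ} {L : NNReal} (hX : LipschitzWith L X)
    (hper : X π = X (-π)) {a b : ℂ → ℝ} {a' b' : ℂ → ℂ →L[ℝ] ℝ} {W : Set ℂ} (hWo : IsOpen W)
    (hW : ∀ σ ∈ Icc (0 : ℝ) 1, ∀ θ ∈ Icc (-π) π, (σ : ℂ) * polarGraph X θ ∈ W)
    (ha : ∀ w ∈ W, HasFDerivAt a (a' w) w) (hb : ∀ w ∈ W, HasFDerivAt b (b' w) w)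
    (ha' : ContinuousOn a' W) (hb' : ContinuousOn b' W)
    (hle : ∀ w ∈ W, a' w w ≤ b' w (w * Complex.I)) (hb0 : b 0 = 0)
    (hbB : ∀ w ∈ W, |b w| ≤ π / 2) :
    ∫ θ in (-π)..π, a (polarGraph X θ) ≤ 2 * π * a 0 + L * π ^ 2 := by
  have hpi : -π ≤ π := by linarith [pi_pos]
  have hmc : Continuous (polarGraph X) := (locallyLipschitz_polarGraph hX).continuous
  set m := polarGraph X with hm
  have hDL : ∀ θ, |deriv X θ| ≤ L := fun θ => by
    simpa using norm_deriv_le_of_lipschitz (x₀ := θ) hX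
  have hcont : ContinuousOn (fun p : ℝ × ℝ => (p.1 : ℂ) * m p.2) (Icc 0 1 ×ˢ Icc (-π) π) := by
    fun_prop
  have hmaps : MapsTo (fun p : ℝ × ℝ => (p.1 : ℂ) * m p.2) (Icc 0 1 ×ˢ Icc (-π) π) W :=
    fun p hp => hW p.1 hp.1 p.2 hp.2
  have hac : ContinuousOn a W := fun w hw => (ha w hw).continuousAt.continuousWithinAt
  have hbc : ContinuousOn b W := fun w hw => (hb w hw).continuousAt.continuousWithinAt
  have hev : ∀ {g : ℂ → ℂ →L[ℝ] ℝ}, ContinuousOn g W → ∀ u : ℂ,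
      ContinuousOn (fun p : ℝ × ℝ => g (p.1 * m p.2) (m p.2 * u)) (Icc 0 1 ×ˢ Icc (-π) π) := by
    intro g hg u
    exact (hg.comp hcont hmaps).clm_apply (by fun_prop)
  have h1 := hW 1 (by simp)
  simp only [Complex.ofReal_one, one_mul] at h1
  have hsm : ∀ (g : ℂ →L[ℝ] ℝ) (r : ℝ) (u : ℂ), g (r * u) = r * g u := fun g r u => by
    rw [← Complex.real_smul, map_smul, smul_eq_mul]
  have hslice1 : ∀ {g : ℂ → ℂ →L[ℝ] ℝ}, ContinuousOn g W → ∀ u : ℂ, ∀ θ ∈ Icc (-π) π,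
      ContinuousOn (fun σ : ℝ => g (σ * m θ) (m θ * u)) (Icc 0 1) := fun hg u θ hθ =>
    (hev hg u).comp (f := fun σ => (σ, θ)) (by fun_prop) fun σ hσ => ⟨hσ, hθ⟩
  have hray : ∀ {g : ℂ → ℝ} {g' : ℂ → ℂ →L[ℝ] ℝ}, (∀ w ∈ W, HasFDerivAt g (g' w) w) →
      ContinuousOn g' W → ∀ θ ∈ Icc (-π) π,
      ∫ σ in (0 : ℝ)..1, g' (σ * m θ) (m θ * 1) = g (m θ) - g 0 := by
    intro g g' hg hg' θ hθ
    have := intervalIntegral.integral_eq_sub_of_hasDerivAt (a := 0) (b := 1)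
      (f := fun σ : ℝ => g (σ * m θ)) (f' := fun σ : ℝ => g' (σ * m θ) (m θ * 1)) ?_ ?_
    · simpa using this
    · intro σ hσ
      rw [uIcc_of_le zero_le_one] at hσ
      have h2 : HasDerivAt (fun σ : ℝ => (σ : ℂ) * m θ) (1 * m θ) σ :=
        (hasDerivAt_id σ).ofReal_comp.mul_const _
      have := (hg _ (hW σ hσ θ hθ)).comp_hasDerivAt σ h2
      rwa [mul_comm 1 (m θ)] at this
    · exact ((hslice1 hg' 1 θ hθ)).intervalIntegrable_of_Icc zero_le_one
  set k : ℝ → ℝ → ℝ := fun θ σ => b' (σ * m θ) (m θ * Complex.I) +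
    deriv X θ * b' (σ * m θ) (m θ * 1) with hk
  have hkint : ∀ θ ∈ Icc (-π) π, IntervalIntegrable (k θ) volume 0 1 := fun θ hθ =>
    ((hslice1 hb' Complex.I θ hθ).add
      (continuousOn_const.mul (hslice1 hb' 1 θ hθ))).intervalIntegrable_of_Icc zero_le_one
  have hstep1 : ∀ θ ∈ Icc (-π) π,
      a (m θ) - a 0 + deriv X θ * b (m θ) ≤ ∫ σ in (0 : ℝ)..1, k θ σ := by
    intro θ hθ
    have e1 := hray ha ha' θ hθ
    have e2 := hray hb hb' θ hθ
    rw [hb0, sub_zero] at e2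
    rw [← e1, ← e2, ← intervalIntegral.integral_const_mul, ← intervalIntegral.integral_add]
    · refine intervalIntegral.integral_mono_on_of_le_Ioo zero_le_one ?_ (hkint θ hθ) ?_
      · exact ((hslice1 ha' 1 θ hθ).add (continuousOn_const.mul
          (hslice1 hb' 1 θ hθ))).intervalIntegrable_of_Icc zero_le_one
      · intro σ hσ
        have h3 := hle _ (hW σ ⟨hσ.1.le, hσ.2.le⟩ θ hθ)
        rw [hsm, mul_assoc, hsm] at h3
        simp only [hk, mul_one]
        have := le_of_mul_le_mul_left h3 hσ.1
        linarith
    · exact (hslice1 ha' 1 θ hθ).intervalIntegrable_of_Icc zero_le_one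
    · exact (continuousOn_const.mul (hslice1 hb' 1 θ hθ)).intervalIntegrable_of_Icc zero_le_one
  have hXm : AEStronglyMeasurable (fun p : ℝ × ℝ => deriv X p.1)
      ((volume.restrict (Icc (-π) π)).prod (volume.restrict (Icc (0 : ℝ) 1))) :=
    ((measurable_deriv X).comp measurable_fst).aestronglyMeasurable
  have hswap : ContinuousOn Prod.swap (Icc (-π) π ×ˢ Icc (0 : ℝ) 1) := continuous_swap.continuousOn
  have hkI : Integrable (Function.uncurry k)
      ((volume.restrict (Icc (-π) π)).prod (volume.restrict (Icc (0 : ℝ) 1))) := by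
    have hc : ∀ u, ContinuousOn (fun p : ℝ × ℝ => b' (p.2 * m p.1) (m p.1 * u))
        (Icc (-π) π ×ˢ Icc (0 : ℝ) 1) := fun u =>
      (hev hb' u).comp (f := Prod.swap) hswap fun p hp => ⟨hp.2, hp.1⟩
    have hi : ∀ u, Integrable (fun p : ℝ × ℝ => b' (p.2 * m p.1) (m p.1 * u))
        ((volume.restrict (Icc (-π) π)).prod (volume.restrict (Icc (0 : ℝ) 1))) := by
      intro u
      rw [Measure.prod_restrict]
      exact (hc u).integrableOn_compact (isCompact_Icc.prod isCompact_Icc)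
    refine (hi Complex.I).add ?_
    exact (hi 1).bdd_mul (c := L) hXm (Eventually.of_forall fun p => hDL p.1)
  have hbσ : ∀ σ ∈ Icc (0 : ℝ) 1, 0 < σ →
      ∫ θ in (-π)..π, k θ σ = 0 := by
    intro σ hσ hσ0
    have hlip : LocallyLipschitzOn (Icc (-π) π) fun θ => b (σ * m θ) := by
      intro θ hθ
      have hw := hW σ hσ θ hθ
      have hs : HasStrictFDerivAt b (b' (σ * m θ)) (σ * m θ) :=
        hasStrictFDerivAt_of_hasFDerivAt_of_continuousAt
          (Filter.eventually_of_mem (hWo.mem_nhds hw) hb) (hb'.continuousAt (hWo.mem_nhds hw))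
      obtain ⟨K, t, ht, hK⟩ := hs.exists_lipschitzOnWith
      have hl : LocallyLipschitz fun θ => (σ : ℂ) * m θ := by
        have : LipschitzWith ‖(σ : ℂ)‖₊ fun z : ℂ => (σ : ℂ) * z :=
          LipschitzWith.of_dist_le_mul fun x y => by
            rw [dist_eq_norm, ← mul_sub, norm_mul, coe_nnnorm, dist_eq_norm]
        exact this.locallyLipschitz.comp (locallyLipschitz_polarGraph hX)
      obtain ⟨K₂, t₂, ht₂, hK₂⟩ := hl θ
      refine ⟨K * K₂, t₂ ∩ (fun θ => (σ : ℂ) * m θ) ⁻¹' t, mem_nhdsWithin_of_mem_nhds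
        (inter_mem ht₂ (hl.continuous.continuousAt ht)), ?_⟩
      exact hK.comp (hK₂.mono inter_subset_left) fun x hx => hx.2
    obtain ⟨K, hK⟩ := LocallyLipschitzOn.exists_lipschitzOnWith_of_compact isCompact_Icc hlip
    rw [← uIcc_of_le hpi] at hK
    have h5 := hK.absolutelyContinuousOnInterval.integral_deriv_eq_sub
    have h6 : m π = m (-π) := by
      simp only [hm, polarGraph, hper]
      rw [Complex.exp_add, Complex.exp_add]
      simp
    rw [h6, sub_self] at h5
    have h7 : ∫ θ in (-π)..π, deriv (fun θ => b (σ * m θ)) θ = ∫ θ in (-π)..π, σ * k θ σ := by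
      refine intervalIntegral.integral_congr_ae ?_
      filter_upwards [hX.ae_differentiableAt] with θ hd hθ
      rw [uIoc_of_le hpi] at hθ
      have h8 := (hb _ (hW σ hσ θ ⟨hθ.1.le, hθ.2⟩)).comp_hasDerivAt θ
        ((hasDerivAt_polarGraph hd).const_mul (σ : ℂ))
      refine (HasDerivAt.deriv h8).trans ?_
      change b' (σ * m θ) (σ * (m θ * _)) = _
      rw [hsm, mul_add, map_add, mul_comm (m θ) ((deriv X θ : ℝ) : ℂ), hsm]
      simp only [hk, mul_one]
      ring
    rw [h7, intervalIntegral.integral_const_mul] at h5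
    exact (mul_eq_zero.1 h5).resolve_left hσ0.ne'
  have hfub : ∫ θ in (-π)..π, ∫ σ in (0 : ℝ)..1, k θ σ = 0 := by
    simp_rw [intervalIntegral.integral_of_le hpi, intervalIntegral.integral_of_le zero_le_one,
      ← integral_Icc_eq_integral_Ioc]
    rw [integral_integral_swap hkI]
    refine (setIntegral_congr_ae (g := fun _ => (0 : ℝ)) measurableSet_Icc ?_).trans (by simp)
    filter_upwards [(countable_singleton (0 : ℝ)).ae_notMem volume] with σ hσ0 hσ
    rw [integral_Icc_eq_integral_Ioc, ← intervalIntegral.integral_of_le hpi]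
    exact hbσ σ hσ (lt_of_le_of_ne hσ.1 fun h => hσ0 h.symm)
  have hkI' : IntervalIntegrable (fun θ => ∫ σ in (0 : ℝ)..1, k θ σ) volume (-π) π := by
    rw [intervalIntegrable_iff_integrableOn_Icc_of_le hpi]
    simp_rw [intervalIntegral.integral_of_le zero_le_one, ← integral_Icc_eq_integral_Ioc]
    exact hkI.integral_prod_left
  have hai : IntervalIntegrable (fun θ => a (m θ)) volume (-π) π :=
    (hac.comp hmc.continuousOn fun θ hθ => h1 θ hθ).intervalIntegrable_of_Icc hpi
  calc ∫ θ in (-π)..π, a (m θ)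
      ≤ ∫ θ in (-π)..π, ((a 0 + L * (π / 2)) + ∫ σ in (0 : ℝ)..1, k θ σ) := by
        refine intervalIntegral.integral_mono_on hpi hai
          (intervalIntegrable_const.add hkI') fun θ hθ => ?_
        have h2 := hstep1 θ hθ
        have h3 : |deriv X θ * b (m θ)| ≤ L * (π / 2) := by
          rw [abs_mul]
          exact mul_le_mul (hDL θ) (hbB _ (h1 θ hθ)) (abs_nonneg _) L.2
        linarith [(abs_le.1 h3).1]
    _ = 2 * π * a 0 + L * π ^ 2 := by
        rw [intervalIntegral.integral_add intervalIntegrable_const hkI', hfub,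
          intervalIntegral.integral_const, smul_eq_mul]
        ring

end

section

open MeasureTheory Set Metric Filter Topology Real ComplexConjugate

theorem hasFDerivAt_wirtinger {f : ℂ → ℂ} {D D₂ z : ℂ} {ε : ℝ} {f₁ : ℂ → ℂ} (hε : 0 < ε)
    (hf : HasDerivAt f D z) (hf₁ : HasDerivAt f₁ D₂ z) (hz : f₁ z = D) :
    HasFDerivAt (fun w => conj (f w) * f₁ w / (f w * conj (f w) + ε))
      ((conj (f z) * D₂ / (f z * conj (f z) + ε) - (conj (f z) * D / (f z * conj (f z) + ε)) ^ 2) •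
        ContinuousLinearMap.id ℝ ℂ +
        ((ε * Complex.normSq D / (Complex.normSq (f z) + ε) ^ 2 : ℝ) : ℂ) •
        (Complex.conjCLE : ℂ →L[ℝ] ℂ)) z := by
  have hg : f z * conj (f z) + ε = ((Complex.normSq (f z) + ε : ℝ) : ℂ) := by
    rw [Complex.mul_conj]; push_cast; rfl
  have hg0 : f z * conj (f z) + ε ≠ 0 := by
    rw [hg, Complex.ofReal_ne_zero]
    have := Complex.normSq_nonneg (f z)
    positivity
  have h1 := hf.hasFDerivAt.restrictScalars ℝ
  have h2 := hf₁.hasFDerivAt.restrictScalars ℝ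
  have h3 : HasFDerivAt (fun w => conj (f w)) _ z :=
    (Complex.conjCLE : ℂ →L[ℝ] ℂ).hasFDerivAt.comp z h1
  have h4 := ((hasDerivAt_inv hg0).hasFDerivAt.restrictScalars ℝ).comp z
    ((h1.mul h3).add_const (ε : ℂ))
  refine ((h3.mul h2).mul h4).congr_fderiv (ContinuousLinearMap.ext fun h => ?_)
  simp
  rw [hz]
  have hk : ((Complex.normSq D : ℝ) : ℂ) = D * conj D := (Complex.mul_conj D).symm
  rw [hk]
  have hg' : ((Complex.normSq (f z) : ℝ) : ℂ) = f z * conj (f z) := (Complex.mul_conj _).symm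
  rw [hg']
  field_simp
  ring

theorem integral_log_polarGraph_le {O : Set ℂ} (hO : IsOpen O) {f : ℂ → ℂ}
    (hf : DifferentiableOn ℂ f O) {c ε C : ℝ} (hc : 0 ≤ c) (hε : 0 < ε) {X : ℝ → ℝ} {L : NNReal}
    (hX : LipschitzWith L X) (hper : X π = X (-π))
    (hW : ∀ σ ∈ Icc (0 : ℝ) 1, ∀ θ ∈ Icc (-π) π, (σ : ℂ) * polarGraph X θ ∈ O ∧
      0 < C - c * log (Complex.normSq (f (σ * polarGraph X θ)) + ε)) :
    ∫ θ in (-π)..π, log (1 + (C - c * log (Complex.normSq (f (polarGraph X θ)) + ε))) ≤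
      2 * π * log (1 + (C - c * log (Complex.normSq (f 0) + ε))) + L * π ^ 2 := by
  have hg0 : ∀ z, 0 < Complex.normSq (f z) + ε := fun z => by
    have := Complex.normSq_nonneg (f z); positivity
  set v : ℂ → ℝ := fun z => C - c * log (Complex.normSq (f z) + ε) with hv
  have hD := hf.deriv hO
  set D := deriv f
  set q : ℂ → ℂ := fun w => conj (f w) * D w / (f w * conj (f w) + ε) with hq
  set p : ℂ → ℂ := fun z => conj (f z) * deriv D z / (f z * conj (f z) + ε) - q z ^ 2 with hp
  set κ : ℂ → ℝ := fun z => ε * Complex.normSq (D z) / (Complex.normSq (f z) + ε) ^ 2 with hκ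
  set q' : ℂ → ℂ →L[ℝ] ℂ := fun z => p z • ContinuousLinearMap.id ℝ ℂ +
    (κ z : ℂ) • (Complex.conjCLE : ℂ →L[ℝ] ℂ) with hq'
  have hfa : ∀ z ∈ O, HasDerivAt f (D z) z := fun z hz =>
    (hf.differentiableAt (hO.mem_nhds hz)).hasDerivAt
  have hqd : ∀ z ∈ O, HasFDerivAt q (q' z) z := fun z hz =>
    hasFDerivAt_wirtinger hε (hfa z hz) (hD.differentiableAt (hO.mem_nhds hz)).hasDerivAt rfl
  have hκ0 : ∀ z, 0 ≤ κ z := fun z => by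
    have := hg0 z; have := Complex.normSq_nonneg (D z); positivity
  have hfc := hf.continuousOn
  have hDc := hD.continuousOn
  have hD2c := (hD.deriv hO).continuousOn
  have hgC : ∀ z, f z * conj (f z) + ε ≠ 0 := fun z => by
    rw [Complex.mul_conj, ← Complex.ofReal_add, Complex.ofReal_ne_zero]
    exact (hg0 z).ne'
  have hqc : ContinuousOn q O := fun z hz => (hqd z hz).continuousAt.continuousWithinAt
  have hcf : ContinuousOn (fun z => conj (f z)) O := Complex.continuous_conj.comp_continuousOn hfc
  have hpc : ContinuousOn p O :=
    ((hcf.mul hD2c).div ((hfc.mul hcf).add continuousOn_const) fun z _ => hgC z).sub (hqc.pow 2)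
  have hκc : ContinuousOn κ O :=
    (continuousOn_const.mul (Complex.continuous_normSq.comp_continuousOn hDc)).div
      (((Complex.continuous_normSq.comp_continuousOn hfc).add continuousOn_const).pow 2)
      fun z _ => (pow_pos (hg0 z) 2).ne'
  have hq'c : ContinuousOn q' O :=
    (hpc.smul continuousOn_const).add
      ((Complex.continuous_ofReal.comp_continuousOn hκc).smul continuousOn_const)
  set v' : ℂ → ℂ →L[ℝ] ℝ := fun z => (-2 * c) • (Complex.reCLM.comp
    (q z • ContinuousLinearMap.id ℝ ℂ)) with hv'
  have hvd : ∀ z ∈ O, HasFDerivAt v (v' z) z := by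
    intro z hz
    have h1 := ((hfa z hz).hasFDerivAt.restrictScalars ℝ)
    have h2 : HasFDerivAt (fun w => (f w * conj (f w)).re) _ z := Complex.reCLM.hasFDerivAt.comp z
      (h1.mul ((Complex.conjCLE : ℂ →L[ℝ] ℂ).hasFDerivAt.comp z h1))
    have h3 : (fun w => (f w * conj (f w)).re) = fun w => Complex.normSq (f w) := by
      ext w; rw [Complex.mul_conj, Complex.ofReal_re]
    rw [h3] at h2
    have h4 := (((h2.add_const ε).log (hg0 z).ne').const_mul c).const_sub C
    refine h4.congr_fderiv (ContinuousLinearMap.ext fun h => ?_)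
    have h5 : q z * h = ((Complex.normSq (f z) + ε : ℝ) : ℂ)⁻¹ * (conj (f z) * D z * h) := by
      simp only [hq]
      rw [Complex.mul_conj, ← Complex.ofReal_add, div_eq_inv_mul, mul_assoc]
    simp only [hv', _root_.smul_apply, ContinuousLinearMap.comp_apply,
      ContinuousLinearMap.id_apply, smul_eq_mul, Complex.reCLM_apply, h5]
    rw [← Complex.ofReal_inv, Complex.re_ofReal_mul]
    simp
    ring
  have hv'c : ContinuousOn v' O := by
    exact (continuousOn_const (c := -2 * c)).smul ((ContinuousLinearMap.compL ℝ ℂ ℂ ℝ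
      Complex.reCLM).continuous.comp_continuousOn (hqc.smul continuousOn_const))
  have hvc : ContinuousOn v O := fun z hz => (hvd z hz).continuousAt.continuousWithinAt
  set U := O ∩ v ⁻¹' Ioi 0
  have hU : IsOpen U := hvc.isOpen_inter_preimage hO isOpen_Ioi
  set W : Set ℂ := {w | ∀ s ∈ Icc (0 : ℝ) 1, (s : ℂ) * w ∈ U} with hWdef
  have hWo : IsOpen W := by
    rw [isOpen_iff_mem_nhds]
    intro w hw
    refine isCompact_Icc.eventually_forall_of_forall_eventually fun s hs => ?_
    exact (by fun_prop : Continuous fun z : ℂ × ℝ => (z.2 : ℂ) * z.1).continuousAt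
      (hU.mem_nhds (hw s hs))
  have hWU : ∀ w ∈ W, w ∈ U := fun w hw => by simpa using hw 1 (by simp)
  have hsc : ContinuousOn (fun x : ℂ × ℝ => (x.2 : ℂ) * x.1) (W ×ˢ Icc 0 1) := by fun_prop
  have hsm : MapsTo (fun x : ℂ × ℝ => (x.2 : ℂ) * x.1) (W ×ˢ Icc 0 1) O := fun x hx =>
    (hx.1 x.2 hx.2).1
  set Q' : ℂ → ℝ → ℂ →L[ℝ] ℂ := fun w s => (w * s) • q' (s * w) +
    q (s * w) • ContinuousLinearMap.id ℝ ℂ with hQ'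
  have hQ'c : ContinuousOn (Function.uncurry Q') (W ×ˢ Icc 0 1) := by
    refine ContinuousOn.add ?_ ?_
    · exact ContinuousOn.smul (f := fun x : ℂ × ℝ => x.1 * x.2) (by fun_prop)
        (hq'c.comp hsc hsm)
    · exact ContinuousOn.smul (hqc.comp hsc hsm) continuousOn_const
  obtain ⟨hJ, hJc⟩ := hasFDerivAt_intervalIntegral_of_continuousOn (F := fun w s => q (s * w) * w)
    (F' := Q') hWo ((hqc.comp hsc hsm).mul continuousOn_fst) hQ'c (by
      intro w hw s hs
      have h1 : HasFDerivAt (fun w : ℂ => (s : ℂ) * w) (s • ContinuousLinearMap.id ℝ ℂ) w := by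
        exact ((hasFDerivAt_id (𝕜 := ℝ) w).const_smul s).congr_of_eventuallyEq
          (Eventually.of_forall fun w => Complex.real_smul.symm)
      have h2 := ((hqd _ (hw s hs).1).comp w h1).mul (hasFDerivAt_id (𝕜 := ℝ) w)
      refine h2.congr_fderiv (ContinuousLinearMap.ext fun h => ?_)
      simp [hQ']
      ring)
  set J : ℂ → ℂ := fun w => ∫ s in (0 : ℝ)..1, q (s * w) * w with hJdef
  set J' : ℂ → ℂ →L[ℝ] ℂ := fun w => ∫ s in (0 : ℝ)..1, Q' w s with hJ'
  have happ : ∀ w ∈ W, ∀ h, J' w h = ∫ s in (0 : ℝ)..1, Q' w s h := fun w hw h => 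
    ContinuousLinearMap.intervalIntegral_apply
      ((hQ'c.slice_uncurry hw).intervalIntegrable_of_Icc zero_le_one) h
  have hJ1 : ∀ w ∈ W, J' w w = q w * w := by
    intro w hw
    rw [happ w hw]
    have := intervalIntegral.integral_eq_sub_of_hasDerivAt (a := 0) (b := 1)
      (f := fun s : ℝ => s * (q (s * w) * w)) (f' := fun s : ℝ => Q' w s w) ?_ ?_
    · simpa using this
    · intro s hs
      rw [uIcc_of_le zero_le_one] at hs
      have h2 : HasDerivAt (fun s : ℝ => (s : ℂ) * w) (1 * w) s :=
        (hasDerivAt_id s).ofReal_comp.mul_const _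
      have h3 := ((hqd _ (hw s hs).1).comp_hasDerivAt s h2).mul_const w
      have h4 := (hasDerivAt_id s).ofReal_comp.mul h3
      refine h4.congr_deriv ?_
      simp [hQ']
      ring
    · exact ((hQ'c.slice_uncurry hw).clm_apply continuousOn_const).intervalIntegrable_of_Icc
        zero_le_one
  have hJ2 : ∀ w ∈ W, (J' w (w * Complex.I)).im ≤ (q w * w).re := by
    intro w hw
    have hi : ∀ u, IntervalIntegrable (fun s => Q' w s u) volume 0 1 := fun u =>
      ((hQ'c.slice_uncurry hw).clm_apply continuousOn_const).intervalIntegrable_of_Icc zero_le_one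
    have e1 := Complex.imCLM.intervalIntegral_comp_comm (hi (w * Complex.I))
    have e2 := Complex.reCLM.intervalIntegral_comp_comm (hi w)
    rw [← happ w hw] at e1 e2
    rw [← hJ1 w hw]
    simp only [Complex.imCLM_apply, Complex.reCLM_apply] at e1 e2
    rw [← e1, ← e2]
    refine intervalIntegral.integral_mono_on zero_le_one
      (Complex.imCLM.integrable_comp (hi _).1 |> fun h => ⟨h, by simp⟩) 
      (Complex.reCLM.integrable_comp (hi _).1 |> fun h => ⟨h, by simp⟩) fun s hs => ?_
    have h3 : Q' w s (w * Complex.I) =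
        Complex.I * (Q' w s w - ((2 * s * κ (s * w) * Complex.normSq w : ℝ) : ℂ)) := by
      push_cast
      rw [← Complex.mul_conj w]
      simp [hQ', hq']
      ring
    rw [h3, Complex.I_mul_im, Complex.sub_re, Complex.ofReal_re]
    have := mul_nonneg (mul_nonneg (mul_nonneg zero_le_two hs.1) (hκ0 (s * w)))
      (Complex.normSq_nonneg w)
    linarith
  set b₀ : ℂ → ℝ := fun w => -2 * c * (J w).im with hb₀
  set b₀' : ℂ → ℂ →L[ℝ] ℝ := fun w => (-2 * c) • (Complex.imCLM.comp (J' w)) with hb₀'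
  have hbd : ∀ w ∈ W, HasFDerivAt b₀ (b₀' w) w := fun w hw => by
    exact (Complex.imCLM.hasFDerivAt.comp w (hJ w hw)).const_mul _
  have hb₀c : ContinuousOn b₀' W := by
    exact (continuousOn_const (c := -2 * c)).smul ((ContinuousLinearMap.compL ℝ ℂ ℂ ℝ
      Complex.imCLM).continuous.comp_continuousOn hJc)
  have h1v : ∀ w ∈ W, 0 < 1 + v w := fun w hw => by
    have : 0 < v w := (hWU w hw).2
    positivity
  have hb00 : b₀ 0 = 0 := by simp [hb₀, hJdef]
  have hmW : ∀ σ ∈ Icc (0 : ℝ) 1, ∀ θ ∈ Icc (-π) π, (σ : ℂ) * polarGraph X θ ∈ W := by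
    intro σ hσ θ hθ s hs
    rw [← mul_assoc, ← Complex.ofReal_mul]
    exact hW (s * σ) ⟨mul_nonneg hs.1 hσ.1, mul_le_one₀ hs.2 hσ.1 hσ.2⟩ θ hθ
  set a : ℂ → ℝ := fun w => log ((1 + v w) ^ 2 + b₀ w ^ 2) / 2 with hadef
  set E : ℂ → ℝ := fun w => (1 + v w) ^ 2 + b₀ w ^ 2
  have hE : ∀ w ∈ W, 0 < E w := fun w hw => by have := h1v w hw; positivity
  have hmain := integral_polarGraph_le hX hper (a := a) (b := fun w => arctan (b₀ w / (1 + v w)))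
    (a' := fun w => (E w)⁻¹ • ((1 + v w) • v' w + b₀ w • b₀' w))
    (b' := fun w => (E w)⁻¹ • ((1 + v w) • b₀' w - b₀ w • v' w)) hWo hmW ?_ ?_ ?_ ?_ ?_ ?_ ?_
  · have h1 : v 0 ∈ Ioi (0 : ℝ) := by
      have := hmW 0 (by simp) 0 ⟨by linarith [pi_pos], pi_pos.le⟩
      simpa using (hWU _ this).2
    have h2 : a 0 = log (1 + v 0) := by
      simp only [hadef, hb00]
      rw [zero_pow two_ne_zero, add_zero, log_pow]
      push_cast
      ring
    rw [h2] at hmain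
    refine le_trans ?_ hmain
    have hpi : -π ≤ π := by linarith [pi_pos]
    have hm1 : ∀ θ ∈ Icc (-π) π, polarGraph X θ ∈ W := fun θ hθ => by
      simpa using hmW 1 (by simp) θ hθ
    have hmc := (locallyLipschitz_polarGraph hX).continuous.continuousOn (s := Icc (-π) π)
    have hbc : ContinuousOn b₀ W := fun w hw => (hbd w hw).continuousAt.continuousWithinAt
    have hvW : ContinuousOn v W := hvc.mono fun w hw => (hWU w hw).1
    refine intervalIntegral.integral_mono_on hpi
      (ContinuousOn.intervalIntegrable_of_Icc hpi ?_)
      (ContinuousOn.intervalIntegrable_of_Icc hpi ?_) fun θ hθ => ?_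
    · exact ((continuousOn_const.add hvW).log fun w hw => (h1v w hw).ne').comp hmc hm1
    · exact ((((continuousOn_const.add hvW).pow 2).add (hbc.pow 2)).log fun w hw =>
        (hE w hw).ne').div_const 2 |>.comp hmc hm1
    · have h3 := h1v _ (hm1 θ hθ)
      have h4 := log_le_log (pow_pos h3 2)
        (le_add_of_nonneg_right (sq_nonneg (b₀ (polarGraph X θ))))
      rw [log_pow] at h4
      simp only [hadef]
      push_cast at h4
      simp only [hv] at h4 ⊢
      linarith
  · intro w hw
    have h1 := ((((hvd w (hWU w hw).1).const_add 1).pow 2).add ((hbd w hw).pow 2)).log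
      (hE w hw).ne'
    have h2 := h1.const_mul (1 / 2)
    have h3 : a = fun w => 1 / 2 * log ((1 + v w) ^ 2 + b₀ w ^ 2) := by
      ext w; simp only [hadef]; ring
    rw [h3]
    refine h2.congr_fderiv (ContinuousLinearMap.ext fun h => ?_)
    simp [E]
    ring
  · intro w hw
    have h1 := ((hbd w hw).mul ((hasDerivAt_inv (h1v w hw).ne').hasFDerivAt.comp w
      ((hvd w (hWU w hw).1).const_add 1))).arctan
    refine h1.congr_fderiv (ContinuousLinearMap.ext fun h => ?_)
    have := hE w hw
    have := h1v w hw
    simp [E]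
    field_simp
    ring
  · have hbc : ContinuousOn b₀ W := fun w hw => (hbd w hw).continuousAt.continuousWithinAt
    have hvW : ContinuousOn v W := hvc.mono fun w hw => (hWU w hw).1
    have hv'W : ContinuousOn v' W := hv'c.mono fun w hw => (hWU w hw).1
    exact ((((continuousOn_const.add hvW).pow 2).add (hbc.pow 2)).inv₀ fun w hw =>
      (hE w hw).ne').smul (((continuousOn_const.add hvW).smul hv'W).add (hbc.smul hb₀c))
  · have hbc : ContinuousOn b₀ W := fun w hw => (hbd w hw).continuousAt.continuousWithinAt
    have hvW : ContinuousOn v W := hvc.mono fun w hw => (hWU w hw).1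
    have hv'W : ContinuousOn v' W := hv'c.mono fun w hw => (hWU w hw).1
    exact ((((continuousOn_const.add hvW).pow 2).add (hbc.pow 2)).inv₀ fun w hw =>
      (hE w hw).ne').smul (((continuousOn_const.add hvW).smul hb₀c).sub (hbc.smul hv'W))
  · intro w hw
    have h1 := hJ1 w hw
    have h2 := hJ2 w hw
    have h3 := h1v w hw
    have e1 : b₀' w w = -2 * c * (q w * w).im := by simp [hb₀', h1]
    have e2 : v' w (w * Complex.I) = 2 * c * (q w * w).im := by
      simp only [hv', _root_.smul_apply, ContinuousLinearMap.comp_apply,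
        ContinuousLinearMap.id_apply, smul_eq_mul, Complex.reCLM_apply]
      rw [← mul_assoc, Complex.mul_I_re]
      ring
    have e3 : v' w w ≤ b₀' w (w * Complex.I) := by
      simp only [hv', hb₀', _root_.smul_apply, ContinuousLinearMap.comp_apply,
        ContinuousLinearMap.id_apply, smul_eq_mul, Complex.reCLM_apply, Complex.imCLM_apply]
      nlinarith
    simp only [_root_.smul_apply, _root_.add_apply, _root_.sub_apply, smul_eq_mul]
    rw [e1, e2]
    refine mul_le_mul_of_nonneg_left ?_ (inv_nonneg.2 (hE w hw).le)
    nlinarith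
  · simp [hb00]
  · exact fun w _ => (abs_lt.2 ⟨neg_pi_div_two_lt_arctan _, arctan_lt_pi_div_two _⟩).le

end

section

open MeasureTheory Set Metric Filter Topology Real ComplexConjugate

theorem exists_radial_graph {O C : Set ℂ} {η B : ℝ} (hη : 0 < η) (hne : C.Nonempty)
    (hCB : ∀ c ∈ C, ‖c‖ ≤ B) (hre : ∀ c ∈ C, 0 < c.re) (hCO : ∀ c ∈ C, c ∉ O)
    (hcone : ∀ c ∈ C, ∀ σ ∈ Ico (0 : ℝ) 1, ball ((σ : ℂ) * c) ((1 - σ) * η) ⊆ O) :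
    ∃ (X : ℝ → ℝ) (L : NNReal), LipschitzWith L X ∧ X π = X (-π) ∧
      (∀ σ ∈ Ico (0 : ℝ) 1, ∀ θ, (σ : ℂ) * polarGraph X θ ∈ O) ∧
      ∀ c ∈ C, polarGraph X c.arg = c := by
  have : Nonempty C := hne.to_subtype
  obtain ⟨c₀, hc₀⟩ := hne
  have hball : ball (0 : ℂ) η ⊆ O := by simpa using hcone c₀ hc₀ 0 (by simp)
  have hpos : ∀ c ∈ C, 0 < ‖c‖ := fun c hc => norm_pos_iff.2 fun h => by
    have := hre c hc; simp [h] at this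
  have hηc : ∀ c ∈ C, η ≤ ‖c‖ := fun c hc => by
    by_contra! h
    exact hCO c hc (hball (by simpa using h))
  have hB : 0 < B := (hpos c₀ hc₀).trans_le (hCB c₀ hc₀)
  have hηB : η ≤ B := (hηc c₀ hc₀).trans (hCB c₀ hc₀)
  set L : NNReal := ⟨B / η, by positivity⟩
  have hL : (L : ℝ) = B / η := rfl
  set g : C → ℝ → ℝ := fun c θ => max (log η) (log ‖(c : ℂ)‖ - L * |θ - (c : ℂ).arg|) with hg
  have hgB : ∀ c θ, g c θ ≤ log B := fun c θ => by
    refine max_le (log_le_log hη hηB) ?_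
    have := log_le_log (hpos c c.2) (hCB c c.2)
    have := mul_nonneg L.2 (abs_nonneg (θ - (c : ℂ).arg))
    change 0 ≤ (L : ℝ) * _ at this
    linarith
  have hbdd : ∀ θ, BddAbove (range fun c => g c θ) := fun θ => by
    refine ⟨log B, ?_⟩
    rintro _ ⟨c, rfl⟩
    exact hgB c θ
  set X : ℝ → ℝ := fun θ => ⨆ c, g c θ with hX
  have hlip : LipschitzWith L X := by
    refine LipschitzWith.of_le_add_mul L fun θ θ' => ciSup_le fun c => ?_
    refine le_trans ?_ (add_le_add_left (le_ciSup (hbdd θ') c) _)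
    rw [Real.dist_eq]
    have h0 : 0 ≤ L * |θ - θ'| := mul_nonneg L.2 (abs_nonneg _)
    refine max_le ?_ ?_
    · have := le_max_left (log η) (log ‖(c : ℂ)‖ - L * |θ' - (c : ℂ).arg|)
      simp only [hg]
      linarith
    · have h1 := le_max_right (log η) (log ‖(c : ℂ)‖ - L * |θ' - (c : ℂ).arg|)
      have h2 : |θ' - (c : ℂ).arg| ≤ |θ - (c : ℂ).arg| + |θ - θ'| := by
        have := abs_sub_le θ' θ (c : ℂ).arg
        rw [abs_sub_comm θ' θ] at this
        linarith
      have h3 := mul_le_mul_of_nonneg_left h2 L.2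
      change (L : ℝ) * _ ≤ L * _ at h3
      simp only [hg]
      linarith
  have hnorm : ∀ θ, ‖polarGraph X θ‖ = exp (X θ) := fun θ => by
    rw [polarGraph, Complex.norm_exp]; simp
  have hO : ∀ σ ∈ Ico (0 : ℝ) 1, ∀ θ, (σ : ℂ) * polarGraph X θ ∈ O := by
    intro σ hσ θ
    rcases hσ.1.eq_or_lt with h0 | h0
    · rw [← h0]
      exact hball (by simpa using hη)
    have h1 : log σ + X θ < X θ := by linarith [log_neg h0 hσ.2]
    obtain ⟨c, hc⟩ := exists_lt_of_lt_ciSup h1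
    set z := (σ : ℂ) * polarGraph X θ with hz
    have hzn : ‖z‖ = exp (log σ + X θ) := by
      rw [hz, norm_mul, hnorm, exp_add, exp_log h0, Complex.norm_real, norm_of_nonneg h0.le]
    rcases lt_max_iff.1 hc with h | h
    · refine hball ?_
      rw [mem_ball_zero_iff, hzn]
      calc exp (log σ + X θ) < exp (log η) := exp_lt_exp.2 h
        _ = η := exp_log hη
    · set r := exp (log σ + X θ) with hr
      have hr0 : 0 < r := exp_pos _
      set Δ := |θ - (c : ℂ).arg|
      have hcp := hpos c c.2
      have h2 : r * (1 + L * Δ) < ‖(c : ℂ)‖ := by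
        calc r * (1 + L * Δ) ≤ r * exp (L * Δ) := by
              have := add_one_le_exp (L * Δ)
              gcongr
              linarith
          _ = exp (log σ + X θ + L * Δ) := by rw [hr, ← exp_add]
          _ < exp (log ‖(c : ℂ)‖) := exp_lt_exp.2 (by linarith)
          _ = _ := exp_log hcp
      have h3 : ‖(c : ℂ)‖ * Δ ≤ L * Δ * η := by
        have h4 : ‖(c : ℂ)‖ ≤ L * η := by
          rw [hL, div_mul_cancel₀ _ hη.ne']; exact hCB c c.2
        nlinarith [abs_nonneg (θ - (c : ℂ).arg)]
      have h5 : r * Δ < (1 - r / ‖(c : ℂ)‖) * η := by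
        rw [one_sub_div hcp.ne', div_mul_eq_mul_div, lt_div_iff₀ hcp]
        nlinarith
      refine hcone c c.2 (r / ‖(c : ℂ)‖) ⟨by positivity, ?_⟩ ?_
      · rw [div_lt_one hcp]
        have : 0 ≤ r * (L * Δ) := by positivity
        linarith
      · rw [mem_ball, dist_eq_norm]
        refine lt_of_le_of_lt ?_ h5
        have e1 : z = r * Complex.exp (θ * Complex.I) := by
          rw [hz, polarGraph, Complex.exp_add, ← mul_assoc, hr, exp_add, exp_log h0]
          push_cast
          ring
        have e2 : ((r / ‖(c : ℂ)‖ : ℝ) : ℂ) * c = r * Complex.exp ((c : ℂ).arg * Complex.I) := by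
          have : ((‖(c : ℂ)‖ : ℝ) : ℂ) ≠ 0 := by exact_mod_cast hcp.ne'
          push_cast
          field_simp
          rw [mul_assoc, Complex.norm_mul_exp_arg_mul_I]
        rw [e1, e2, ← mul_sub, norm_mul, Complex.norm_real, norm_of_nonneg hr0.le]
        refine mul_le_mul_of_nonneg_left ?_ hr0.le
        have e3 : Complex.exp (θ * Complex.I) - Complex.exp ((c : ℂ).arg * Complex.I) =
            Complex.exp ((c : ℂ).arg * Complex.I) *
              (Complex.exp (Complex.I * ((θ - (c : ℂ).arg : ℝ) : ℂ)) - 1) := by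
          rw [mul_sub, ← Complex.exp_add]
          push_cast
          ring_nf
        rw [e3, norm_mul, Complex.norm_exp_ofReal_mul_I, one_mul]
        exact Real.norm_exp_I_mul_ofReal_sub_one_le
  refine ⟨X, L, hlip, ?_, hO, fun c hc => ?_⟩
  · have h : ∀ θ, |θ| = π → X θ = log η := by
      intro θ hθ
      refine (iSup_congr fun c => max_eq_left ?_).trans ciSup_const
      have h1 := Complex.abs_arg_lt_pi_div_two_iff.2 (Or.inl (hre c c.2))
      have h2 : π / 2 ≤ |θ - (c : ℂ).arg| := by
        have := abs_sub_abs_le_abs_sub θ (c : ℂ).arg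
        linarith
      have h3 : log ‖(c : ℂ)‖ ≤ log η + log (B / η) := by
        rw [log_div hB.ne' hη.ne', add_sub_cancel]
        exact log_le_log (hpos c c.2) (hCB c c.2)
      have h4 : log (B / η) ≤ B / η - 1 := log_le_sub_one_of_pos (by positivity)
      have h5 : 1 ≤ π / 2 := by linarith [two_le_pi]
      have h6 : B / η * 1 ≤ L * |θ - (c : ℂ).arg| :=
        mul_le_mul le_rfl (h5.trans h2) zero_le_one (by positivity)
      linarith
    rw [h π (abs_of_pos pi_pos), h (-π) (by rw [abs_neg, abs_of_pos pi_pos])]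
  · have h1 : log ‖c‖ ≤ X c.arg := by
      refine le_trans ?_ (le_ciSup (hbdd c.arg) ⟨c, hc⟩)
      refine le_trans ?_ (le_max_right _ _)
      simp
    have h2 : X c.arg ≤ log ‖c‖ := by
      by_contra! h
      have := hO (exp (log ‖c‖ - X c.arg)) ⟨(exp_pos _).le, exp_lt_one_iff.2 (by linarith)⟩ c.arg
      refine hCO c hc ?_
      rwa [polarGraph, Complex.exp_add, ← mul_assoc, ← Complex.ofReal_exp, ← Complex.ofReal_mul,
        ← exp_add, sub_add_cancel, exp_log (hpos c hc), Complex.norm_mul_exp_arg_mul_I] at this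
    rw [polarGraph, ← le_antisymm h1 h2, Complex.exp_add, ← Complex.ofReal_exp,
      exp_log (hpos c hc), Complex.norm_mul_exp_arg_mul_I]

end

section

open MeasureTheory Set Metric Filter Topology Real ComplexConjugate

theorem LocallyLipschitz.volume_image_eq_zero {f : ℝ → ℝ} (hf : LocallyLipschitz f) {N : Set ℝ}
    (hN : volume N = 0) : volume (f '' N) = 0 := by
  choose K t ht hK using hf
  obtain ⟨s, hs, hcov⟩ := TopologicalSpace.countable_cover_nhds ht
  have h : f '' N ⊆ ⋃ x ∈ s, f '' (N ∩ t x) := by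
    rintro _ ⟨y, hy, rfl⟩
    have : y ∈ ⋃ x ∈ s, t x := hcov ▸ mem_univ y
    simp only [mem_iUnion] at this ⊢
    obtain ⟨x, hx, hyx⟩ := this
    exact ⟨x, hx, y, ⟨hy, hyx⟩, rfl⟩
  refine measure_mono_null h ((measure_biUnion_null_iff hs).2 fun x _ => ?_)
  have h1 := ((hK x).mono inter_subset_right (s := N ∩ t x)).hausdorffMeasure_image_le zero_le_one
  rw [hausdorffMeasure_real, measure_mono_null inter_subset_left hN, mul_zero] at h1
  exact le_antisymm h1 bot_le

theorem volume_im_image_eq_zero_of_radial {O C : Set ℂ} {Φ : ℕ → ℂ → ℂ} {M b η B : ℝ}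
    (hO : IsOpen O) (hΦ : ∀ N, DifferentiableOn ℂ (Φ N) O) (hb : 0 < b)
    (hbd : ∀ Q ⊆ O, IsCompact Q → ∃ A, 0 < A ∧ ∀ N, ∀ w ∈ Q, ‖Φ N w‖ ≤ A * M ^ N)
    (hM : 0 < M) (hlow : ∀ N, b ^ N ≤ ‖Φ N 0‖) (hη : 0 < η)
    (hCB : ∀ c ∈ C, ‖c‖ ≤ B) (hre : ∀ c ∈ C, 0 < c.re) (hCO : ∀ c ∈ C, c ∉ O)
    (hcone : ∀ c ∈ C, ∀ σ ∈ Ico (0 : ℝ) 1, ball ((σ : ℂ) * c) ((1 - σ) * η) ⊆ O)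
    (hrad : ∀ c ∈ C, ∀ ε > 0, ∀ᶠ σ : ℝ in 𝓝[<] 1, ∀ᶠ N in atTop, ‖Φ N (σ * c)‖ ≤ ε ^ N) :
    volume (Complex.im '' C) = 0 := by
  rcases C.eq_empty_or_nonempty with rfl | hne
  · simp
  obtain ⟨X, L, hX, hper, hXO, hXC⟩ := exists_radial_graph hη hne hCB hre hCO hcone
  set s : ℕ → ℝ := fun j => 1 - 1 / ((j : ℝ) + 2) with hs
  have hs0 : ∀ j, 0 < s j := fun j => by
    simp only [hs]
    rw [sub_pos, div_lt_one (by positivity)]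
    linarith [j.cast_nonneg (α := ℝ)]
  have hs1 : ∀ j, s j < 1 := fun j => by
    have : 0 < 1 / ((j : ℝ) + 2) := by positivity
    simp only [hs]; linarith
  have hst : Tendsto s atTop (𝓝[<] 1) := by
    refine tendsto_nhdsWithin_iff.2 ⟨?_, Eventually.of_forall hs1⟩
    have : Tendsto (fun j : ℕ => 1 / ((j : ℝ) + 2)) atTop (𝓝 0) := by
      simp only [one_div]
      exact tendsto_inv_atTop_zero.comp
        (tendsto_atTop_add_const_right _ _ tendsto_natCast_atTop_atTop)
    simpa [hs] using (tendsto_const_nhds (x := (1 : ℝ))).sub this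
  set Y : ℕ → ℝ → ℝ := fun j θ => log (s j) + X θ with hY
  have hYX : ∀ j θ, polarGraph (Y j) θ = s j * polarGraph X θ := fun j θ => by
    simp only [polarGraph, hY]
    rw [Complex.ofReal_add, add_assoc, Complex.exp_add, ← Complex.ofReal_exp, exp_log (hs0 j)]
  have hYL : ∀ j, LipschitzWith L (Y j) := fun j => by
    have := (LipschitzWith.const (log (s j))).add hX
    rwa [zero_add] at this
  have hYO : ∀ j, ∀ σ ∈ Icc (0 : ℝ) 1, ∀ θ, (σ : ℂ) * polarGraph (Y j) θ ∈ O := by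
    intro j σ hσ θ
    rw [hYX, ← mul_assoc, ← Complex.ofReal_mul]
    exact hXO _ ⟨mul_nonneg hσ.1 (hs0 j).le,
      (mul_le_of_le_one_left (hs0 j).le hσ.2).trans_lt (hs1 j)⟩ θ
  have hYO1 : ∀ j θ, polarGraph (Y j) θ ∈ O := fun j θ => by
    simpa using hYO j 1 (by simp) θ
  have hYc : ∀ j, Continuous (polarGraph (Y j)) := fun j =>
    (locallyLipschitz_polarGraph (hYL j)).continuous
  set c : ℕ → ℝ := fun N => (2 * (N : ℝ))⁻¹ with hc
  set e : ℕ → ℝ := fun N => exp (-(2 * (N : ℝ) ^ 2)) with he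
  set C' : ℝ := log (max M 1) + 1 with hC'
  have hC1 : 1 ≤ C' := by
    have := log_nonneg (le_max_right M 1)
    linarith
  set V : ℕ → ℂ → ℝ := fun N z => C' - c N * log (Complex.normSq (Φ N z) + e N) with hV
  have he0 : ∀ N, 0 < e N := fun N => exp_pos _
  have he1 : ∀ N, e N ≤ 1 := fun N => exp_le_one_iff.2 (by have := sq_nonneg (N : ℝ); linarith)
  have harg : ∀ N z, 0 < Complex.normSq (Φ N z) + e N := fun N z =>
    add_pos_of_nonneg_of_pos (Complex.normSq_nonneg _) (he0 N)
  -- positivity on compact sets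
  have hVpos : ∀ Q ⊆ O, IsCompact Q → ∀ᶠ N : ℕ in atTop, ∀ z ∈ Q, 0 < V N z := by
    intro Q hQ hQc
    obtain ⟨A, hA, hAb⟩ := hbd Q hQ hQc
    set A' := max A 1
    set M' := max M 1
    have hA1 : 1 ≤ A' := le_max_right _ _
    have hM1 : 1 ≤ M' := le_max_right _ _
    have hlim : ∀ᶠ N : ℕ in atTop, log (2 * A' ^ 2) < 2 * (N : ℝ) := by
      have : Tendsto (fun N : ℕ => 2 * (N : ℝ)) atTop atTop :=
        tendsto_natCast_atTop_atTop.const_mul_atTop two_pos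
      exact this.eventually_gt_atTop _
    filter_upwards [hlim, eventually_gt_atTop 0] with N hN hN0 z hz
    have hN0' : (0 : ℝ) < N := by exact_mod_cast hN0
    have h1 : Complex.normSq (Φ N z) + e N ≤ 2 * A' ^ 2 * M' ^ (2 * N) := by
      have h2 : ‖Φ N z‖ ≤ A' * M' ^ N := (hAb N z hz).trans
        (mul_le_mul (le_max_left _ _) (pow_le_pow_left₀ hM.le (le_max_left _ _) N)
          (pow_nonneg hM.le _) (by positivity))
      have h3 : 1 ≤ A' * M' ^ N := one_le_mul_of_one_le_of_one_le hA1 (one_le_pow₀ hM1)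
      rw [Complex.normSq_eq_norm_sq]
      have h4 : ‖Φ N z‖ ^ 2 ≤ (A' * M' ^ N) ^ 2 := pow_le_pow_left₀ (norm_nonneg _) h2 2
      have h5 : 1 ≤ (A' * M' ^ N) ^ 2 := one_le_pow₀ h3
      calc _ ≤ 2 * (A' * M' ^ N) ^ 2 := by linarith [he1 N]
        _ = _ := by ring
    have h2 : log (Complex.normSq (Φ N z) + e N) ≤ log (2 * A' ^ 2) + 2 * N * log M' := by
      refine (log_le_log (harg N z) h1).trans ?_
      rw [log_mul (by positivity) (by positivity), log_pow]
      push_cast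
      rfl
    have h3 : c N * log (Complex.normSq (Φ N z) + e N) <
        c N * (2 * N + 2 * N * log M') :=
      mul_lt_mul_of_pos_left (by linarith) (by simp only [hc]; positivity)
    have h4 : c N * (2 * N + 2 * N * log M') = 1 + log M' := by
      simp only [hc]; field_simp
    simp only [hV, hC']
    linarith
  set Bd : ℝ := 2 * π * log (1 + (C' - log b)) + L * π ^ 2
  set μ : Measure ℝ := volume.restrict (Ioc (-π) π)
  have hππ : -π ≤ π := by linarith [pi_pos]
  set u : ℕ → ℕ → ℝ → ENNReal := fun j N θ =>
    ENNReal.ofReal (log (1 + V N (polarGraph (Y j) θ))) with hu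
  have hVc : ∀ j N, Continuous fun θ => V N (polarGraph (Y j) θ) := fun j N => by
    have h1 : Continuous fun θ => Φ N (polarGraph (Y j) θ) :=
      (hΦ N).continuousOn.comp_continuous (hYc j) (hYO1 j)
    exact continuous_const.sub (continuous_const.mul
      (((Complex.continuous_normSq.comp h1).add continuous_const).log fun θ => (harg N _).ne'))
  have hum : ∀ j N, Measurable (u j N) := fun j N =>
    (measurable_log.comp ((hVc j N).measurable.const_add 1)).ennreal_ofReal
  have hInt : ∀ j, ∀ᶠ N in atTop, ∫⁻ θ, u j N θ ∂μ ≤ ENNReal.ofReal Bd := by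
    intro j
    set Q := (fun p : ℝ × ℝ => (p.1 : ℂ) * polarGraph (Y j) p.2) '' (Icc 0 1 ×ˢ Icc (-π) π)
    have hQ : Q ⊆ O := by
      rintro _ ⟨p, hp, rfl⟩
      exact hYO j _ hp.1 _
    have hQc : IsCompact Q := by
      refine (isCompact_Icc.prod isCompact_Icc).image ?_
      exact (Complex.continuous_ofReal.comp continuous_fst).mul ((hYc j).comp continuous_snd)
    filter_upwards [hVpos Q hQ hQc, eventually_gt_atTop 0] with N hN hN0
    have hN0' : (0 : ℝ) < N := by exact_mod_cast hN0
    have hmem : ∀ σ ∈ Icc (0 : ℝ) 1, ∀ θ ∈ Icc (-π) π, (σ : ℂ) * polarGraph (Y j) θ ∈ Q :=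
      fun σ hσ θ hθ => ⟨(σ, θ), ⟨hσ, hθ⟩, rfl⟩
    have hmain := integral_log_polarGraph_le hO (hΦ N) (c := c N) (C := C')
      (by simp only [hc]; positivity) (he0 N) (hYL j) (by simp only [hY, hper])
      fun σ hσ θ hθ => ⟨hQ (hmem σ hσ θ hθ), hN _ (hmem σ hσ θ hθ)⟩
    have hpos1 : ∀ θ ∈ Icc (-π) π, 0 < V N (polarGraph (Y j) θ) := fun θ hθ => by
      simpa using hN _ (hmem 1 (by simp) θ hθ)
    have h0 : 0 < V N 0 := by
      simpa using hN _ (hmem 0 (by simp) π ⟨hππ, le_rfl⟩)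
    have h0' : V N 0 ≤ C' - log b := by
      have h1 : log (b ^ (2 * N)) ≤ log (Complex.normSq (Φ N 0) + e N) := by
        refine log_le_log (by positivity) ?_
        rw [Complex.normSq_eq_norm_sq, mul_comm 2 N, pow_mul]
        have := pow_le_pow_left₀ (by positivity) (hlow N) 2
        linarith [he0 N]
      rw [log_pow] at h1
      have h2 : c N * (((2 * N : ℕ) : ℝ) * log b) = log b := by
        simp only [hc]; push_cast; field_simp
      have h3 := mul_le_mul_of_nonneg_left h1 (show 0 ≤ c N by simp only [hc]; positivity)
      simp only [hV]
      linarith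
    have hcont : ContinuousOn (fun θ => log (1 + V N (polarGraph (Y j) θ))) (Icc (-π) π) :=
      (continuous_const.add (hVc j N)).continuousOn.log fun θ hθ => by
        have := hpos1 θ hθ
        exact (by linarith : (0 : ℝ) < 1 + V N (polarGraph (Y j) θ)).ne'
    rw [← ofReal_integral_eq_lintegral_ofReal, ← intervalIntegral.integral_of_le hππ]
    · refine ENNReal.ofReal_le_ofReal (hmain.trans ?_)
      have := log_le_log (by linarith) (add_le_add_right h0' 1)
      have h2π : 0 ≤ 2 * π := by positivity
      simp only [Bd]
      gcongr
    · exact (hcont.integrableOn_Icc).mono_set Ioc_subset_Icc_self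
    · refine (ae_restrict_iff' measurableSet_Ioc).2 (Eventually.of_forall fun θ hθ => ?_)
      exact log_nonneg (by linarith [hpos1 θ (Ioc_subset_Icc_self hθ)])
  set F : ℕ → ℝ → ENNReal := fun j θ => liminf (fun N => u j N θ) atTop with hF
  have hFm : ∀ j, Measurable (F j) := fun j => Measurable.liminf (hum j)
  have hFi : ∀ j, ∫⁻ θ, F j θ ∂μ ≤ ENNReal.ofReal Bd := fun j =>
    (lintegral_liminf_le (hum j)).trans (liminf_le_of_frequently_le' (hInt j).frequently)
  have hG : ∫⁻ θ, liminf (fun j => F j θ) atTop ∂μ ≤ ENNReal.ofReal Bd :=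
    (lintegral_liminf_le hFm).trans
      (liminf_le_of_frequently_le' (Eventually.of_forall hFi).frequently)
  have hae := ae_lt_top (Measurable.liminf hFm) (hG.trans_lt ENNReal.ofReal_lt_top).ne
  have htop : ∀ z ∈ C, liminf (fun j => F j z.arg) atTop = ⊤ := by
    intro z hz
    refine ENNReal.eq_top_of_forall_nnreal_le fun T => ?_
    refine le_liminf_of_le (by isBoundedDefault) ?_
    set a : ℝ := exp T with ha
    filter_upwards [hst.eventually (hrad z hz (exp (-a)) (exp_pos _))] with j hj
    refine le_liminf_of_le (by isBoundedDefault) ?_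
    have hlim : ∀ᶠ N : ℕ in atTop, a ≤ (N : ℝ) :=
      tendsto_natCast_atTop_atTop.eventually_ge_atTop a
    filter_upwards [hj, hlim, eventually_gt_atTop 0] with N hN haN hN0
    have hN0' : (0 : ℝ) < N := by exact_mod_cast hN0
    rw [← ENNReal.ofReal_coe_nnreal]
    refine ENNReal.ofReal_le_ofReal ?_
    rw [le_log_iff_exp_le]
    all_goals
      have hz' : polarGraph (Y j) z.arg = s j * z := by rw [hYX, hXC z hz]
      have h1 : Complex.normSq (Φ N (s j * z)) + e N ≤ 2 * exp (-(2 * N * a)) := by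
        rw [Complex.normSq_eq_norm_sq]
        have h2 : ‖Φ N (s j * z)‖ ^ 2 ≤ exp (-(2 * N * a)) := by
          refine (pow_le_pow_left₀ (norm_nonneg _) hN 2).trans_eq ?_
          rw [← exp_nat_mul, ← exp_nat_mul]
          push_cast
          ring_nf
        have h3 : e N ≤ exp (-(2 * N * a)) := exp_le_exp.2 (by nlinarith)
        linarith
      have h4 : log (Complex.normSq (Φ N (s j * z)) + e N) ≤ log 2 + -(2 * N * a) := by
        refine (log_le_log (harg _ _) h1).trans_eq ?_
        rw [log_mul (by norm_num) (exp_pos _).ne', log_exp]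
      have h5 := mul_le_mul_of_nonneg_left h4 (show 0 ≤ c N by simp only [hc]; positivity)
      have h6 : c N * (log 2 + -(2 * N * a)) = c N * log 2 - a := by
        simp only [hc]; field_simp; ring
      have h7 : c N * log 2 ≤ 1 := by
        have h8 : c N ≤ 1 := by
          simp only [hc]
          refine inv_le_one_of_one_le₀ ?_
          have : (1 : ℝ) ≤ N := by exact_mod_cast hN0
          linarith
        have h9 : log 2 ≤ 1 := by linarith [log_two_lt_d9]
        exact mul_le_one₀ h8 (log_nonneg one_le_two) h9
      have h10 : a ≤ V N (polarGraph (Y j) z.arg) := by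
        rw [hz']; simp only [hV]; linarith
    · exact h10.trans (by linarith)
    · have := exp_pos T
      linarith
  have hnull : volume (Complex.arg '' C) = 0 := by
    rw [ae_iff] at hae
    have hsub : Complex.arg '' C ⊆
        {θ | ¬ liminf (fun j => F j θ) atTop < ⊤} ∩ Ioc (-π) π := by
      rintro _ ⟨z, hz, rfl⟩
      exact ⟨by simp [htop z hz], Complex.arg_mem_Ioc z⟩
    refine measure_mono_null hsub ?_
    rwa [Measure.restrict_apply₀' measurableSet_Ioc.nullMeasurableSet] at hae
  have him : LocallyLipschitz fun θ => (polarGraph X θ).im :=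
    (Complex.imCLM.lipschitz.locallyLipschitz).comp (locallyLipschitz_polarGraph hX)
  refine measure_mono_null ?_ (him.volume_image_eq_zero hnull)
  rintro _ ⟨z, hz, rfl⟩
  exact ⟨z.arg, ⟨z, hz, rfl⟩, by simp [hXC z hz]⟩

end

section

open MeasureTheory Set Metric Filter Topology

variable {n m : ℕ}

theorem isCompact_polyHull {Γ : Set (EuclideanSpace ℂ (Fin n))} (hΓ : IsCompact Γ) :
    IsCompact (polyHull Γ) := by
  refine Metric.isCompact_of_isClosed_isBounded ?_ ?_
  · have : polyHull Γ = ⋂ p : MvPolynomial (Fin n) ℂ, {z | ‖polyEval p z‖ ≤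
        sSup ((fun w => ‖polyEval p w‖) '' Γ)} := by
      ext z
      simp only [mem_iInter]
      rfl
    rw [this]
    exact isClosed_iInter fun p => isClosed_le (continuous_polyEval p).norm continuous_const
  · have h : ∀ j : Fin n, ∃ C : ℝ, 0 ≤ C ∧ ∀ z ∈ polyHull Γ, ‖z j‖ ≤ C := by
      intro j
      obtain ⟨C, hC⟩ := hΓ.exists_bound_of_continuousOn
        (continuous_polyEval (MvPolynomial.X j)).continuousOn
      refine ⟨max C 0, le_max_right _ _, fun z hz => ?_⟩
      have := norm_polyEval_le hz (MvPolynomial.X j) (le_max_right C 0)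
        fun y hy => (hC y hy).trans (le_max_left _ _)
      simpa [polyEval] using this
    choose C hC0 hC using h
    refine (isBounded_closedBall (x := (0 : EuclideanSpace ℂ (Fin n)))
      (r := √(∑ j, C j ^ 2))).subset fun z hz => ?_
    rw [mem_closedBall_zero_iff, EuclideanSpace.norm_eq]
    gcongr with j
    exact hC j z hz

/-- The part of the fiber of `f` over `w` that lies in the polynomially convex hull. -/
def hullFiber (Γ : Set (EuclideanSpace ℂ (Fin n))) (f : MvPolynomial (Fin n) ℂ) (w : ℂ) :
    Set (EuclideanSpace ℂ (Fin n)) :=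
  {x ∈ polyHull Γ | polyEval f x = w}

theorem isCompact_hullFiber_preimage {Γ : Set (EuclideanSpace ℂ (Fin n))} (hΓ : IsCompact Γ)
    (f : MvPolynomial (Fin n) ℂ) {S : Set (EuclideanSpace ℂ (Fin n))} (hS : IsClosed S) :
    IsCompact {w | (hullFiber Γ f w ∩ S).Nonempty} := by
  have : {w | (hullFiber Γ f w ∩ S).Nonempty} = polyEval f '' (polyHull Γ ∩ S) := by
    ext w
    constructor
    · rintro ⟨x, ⟨hx, rfl⟩, hxS⟩
      exact ⟨x, ⟨hx, hxS⟩, rfl⟩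
    · rintro ⟨x, ⟨hx, hxS⟩, rfl⟩
      exact ⟨x, ⟨hx, rfl⟩, hxS⟩
  rw [this]
  exact ((isCompact_polyHull hΓ).inter_right hS).image (continuous_polyEval f)

theorem eventually_hullFiber_subset {Γ : Set (EuclideanSpace ℂ (Fin n))} (hΓ : IsCompact Γ)
    (f : MvPolynomial (Fin n) ℂ) {c : ℂ} {U : Set (EuclideanSpace ℂ (Fin n))} (hU : IsOpen U)
    (h : hullFiber Γ f c ⊆ U) : ∀ᶠ w in 𝓝 c, hullFiber Γ f w ⊆ U := by
  have h1 := (isCompact_hullFiber_preimage hΓ f hU.isClosed_compl).isClosed.isOpen_compl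
  have h2 : c ∈ {w | (hullFiber Γ f w ∩ Uᶜ).Nonempty}ᶜ := by
    rintro ⟨x, hx, hxU⟩
    exact hxU (h hx)
  filter_upwards [h1.mem_nhds h2] with w hw x hx
  by_contra hxU
  exact hw ⟨x, hx, hxU⟩

theorem exists_polyEval_eq_one_eq_zero (x : EuclideanSpace ℂ (Fin n))
    {S : Set (EuclideanSpace ℂ (Fin n))} (hS : S.Finite) (hx : x ∉ S) :
    ∃ p : MvPolynomial (Fin n) ℂ, polyEval p x = 1 ∧ ∀ y ∈ S, polyEval p y = 0 := by
  induction S, hS using Set.Finite.induction_on with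
  | empty => exact ⟨1, by simp [polyEval], by simp⟩
  | @insert a S ha _ ih =>
    simp only [mem_insert_iff, not_or] at hx
    obtain ⟨p, hp1, hp0⟩ := ih hx.2
    obtain ⟨j, hj⟩ : ∃ j, x j ≠ a j := by
      by_contra! h
      exact hx.1 (PiLp.ext h)
    have hj' : x j - a j ≠ 0 := sub_ne_zero.2 hj
    refine ⟨p * (MvPolynomial.C (x j - a j)⁻¹ * (MvPolynomial.X j - MvPolynomial.C (a j))), ?_, ?_⟩
    · have : MvPolynomial.eval (fun i => x i) p = 1 := hp1
      simp [polyEval, this, hj']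
    · rintro y (rfl | hy)
      · simp [polyEval]
      · have : MvPolynomial.eval (fun i => y i) p = 0 := hp0 y hy
        simp [polyEval, this]

theorem exists_polyEval_eq {ι : Type*} [Fintype ι] {y : ι → EuclideanSpace ℂ (Fin n)}
    (hy : Function.Injective y) (v : ι → ℂ) {S : Set (EuclideanSpace ℂ (Fin n))} (hS : S.Finite)
    (hyS : ∀ i, y i ∉ S) :
    ∃ p : MvPolynomial (Fin n) ℂ, (∀ i, polyEval p (y i) = v i) ∧ ∀ x ∈ S, polyEval p x = 0 := by
  classical
  have h : ∀ i, ∃ p : MvPolynomial (Fin n) ℂ, polyEval p (y i) = 1 ∧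
      ∀ x ∈ S ∪ y '' {i}ᶜ, polyEval p x = 0 := fun i => by
    refine exists_polyEval_eq_one_eq_zero _ (hS.union (toFinite _)) ?_
    rintro (h | ⟨j, hj, hji⟩)
    · exact hyS i h
    · exact hj (hy hji)
  choose p hp1 hp0 using h
  refine ⟨∑ i, MvPolynomial.C (v i) * p i, fun i => ?_, fun x hx => ?_⟩
  · have : ∀ j, MvPolynomial.eval (fun k => y i k) (p j) = if j = i then 1 else 0 := fun j => by
      split_ifs with h
      · subst h; exact hp1 _
      · exact hp0 j _ (Or.inr ⟨i, fun h' => h h'.symm, rfl⟩)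
    simp [polyEval, this]
  · have : ∀ j, MvPolynomial.eval (fun k => x k) (p j) = 0 := fun j => hp0 j _ (Or.inl hx)
    simp [polyEval, this]

/-- The product of the differences of the values of `g` at the entries of a tuple. -/
noncomputable def diffProd (m : ℕ) (g : MvPolynomial (Fin n) ℂ) : MvPolynomial (Fin m × Fin n) ℂ :=
  ∏ i, ∏ j ∈ Finset.Ioi i, (polyAt i g - polyAt j g)

theorem tupleEval_mul (G H : MvPolynomial (Fin m × Fin n) ℂ)
    (x : Fin m → EuclideanSpace ℂ (Fin n)) :
    tupleEval (G * H) x = tupleEval G x * tupleEval H x := by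
  simp [tupleEval]

theorem tupleEval_prod {ι : Type*} (s : Finset ι) (G : ι → MvPolynomial (Fin m × Fin n) ℂ)
    (x : Fin m → EuclideanSpace ℂ (Fin n)) :
    tupleEval (∏ i ∈ s, G i) x = ∏ i ∈ s, tupleEval (G i) x := by
  simp [tupleEval]

theorem tupleEval_diffProd (g : MvPolynomial (Fin n) ℂ) (x : Fin m → EuclideanSpace ℂ (Fin n)) :
    tupleEval (diffProd m g) x =
      ∏ i, ∏ j ∈ Finset.Ioi i, (polyEval g (x i) - polyEval g (x j)) := by
  simp only [diffProd, tupleEval_prod, ← tupleEval_polyAt]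
  simp [tupleEval]

theorem tupleEval_diffProd_eq_zero (g : MvPolynomial (Fin n) ℂ)
    {x : Fin m → EuclideanSpace ℂ (Fin n)} (hx : ¬ Function.Injective x) :
    tupleEval (diffProd m g) x = 0 := by
  rw [Function.not_injective_iff] at hx
  obtain ⟨i, j, hij, hne⟩ := hx
  rw [tupleEval_diffProd]
  rcases hne.lt_or_gt with h | h
  · exact Finset.prod_eq_zero (Finset.mem_univ i)
      (Finset.prod_eq_zero (Finset.mem_Ioi.2 h) (by rw [hij, sub_self]))
  · exact Finset.prod_eq_zero (Finset.mem_univ j)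
      (Finset.prod_eq_zero (Finset.mem_Ioi.2 h) (by rw [hij, sub_self]))

theorem tupleEval_diffProd_ne_zero {g : MvPolynomial (Fin n) ℂ}
    {x : Fin m → EuclideanSpace ℂ (Fin n)} (hx : Function.Injective fun i => polyEval g (x i)) :
    tupleEval (diffProd m g) x ≠ 0 := by
  rw [tupleEval_diffProd]
  refine Finset.prod_ne_zero_iff.2 fun i _ => Finset.prod_ne_zero_iff.2 fun j hj => ?_
  exact sub_ne_zero.2 fun h => (Finset.mem_Ioi.1 hj).ne (hx h)

theorem natCast_le_encard_iff {α : Type*} {S : Set α} :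
    (m : ℕ∞) ≤ S.encard ↔ ∃ y : Fin m → α, Function.Injective y ∧ ∀ i, y i ∈ S := by
  constructor
  · intro h
    obtain ⟨T, hTS, hT⟩ := exists_subset_encard_eq h
    have hfin : T.Finite := finite_of_encard_eq_coe hT
    have hcard : Nat.card T = m := by
      rw [Nat.card_coe_set_eq, Set.ncard, hT]; rfl
    have := hfin.to_subtype
    let e := (Finite.equivFinOfCardEq hcard).symm
    exact ⟨fun i => e i, Subtype.val_injective.comp e.injective, fun i => hTS (e i).2⟩
  · rintro ⟨y, hy, hyS⟩
    have := hy.encard_range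
    refine le_trans ?_ (encard_le_encard (range_subset_iff.2 hyS))
    simpa using this

theorem not_injective_of_encard_lt {α : Type*} {S : Set α} (h : S.encard < m) {x : Fin m → α}
    (hx : ∀ i, x i ∈ S) : ¬ Function.Injective x := fun hi =>
  h.not_ge (natCast_le_encard_iff.2 ⟨x, hi, hx⟩)

theorem exists_bound_tupleEval {S : Set (EuclideanSpace ℂ (Fin n))} (hS : IsCompact S)
    (G : MvPolynomial (Fin m × Fin n) ℂ) :
    ∃ M, 0 < M ∧ ∀ x, (∀ i, x i ∈ S) → ‖tupleEval G x‖ ≤ M := by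
  obtain ⟨M, hM⟩ := (isCompact_univ_pi fun _ : Fin m => hS).exists_bound_of_continuousOn
    (continuous_tupleEval G).continuousOn
  exact ⟨max M 1, by positivity, fun x hx => (hM x fun i _ => hx i).trans (le_max_left _ _)⟩

theorem exists_analytic_family_compl {Γ : Set (EuclideanSpace ℂ (Fin n))} (hΓ : IsCompact Γ)
    (hne : Γ.Nonempty) (f : MvPolynomial (Fin n) ℂ) {c : ℂ} (hc : c ∉ polyEval f '' Γ)
    {y : Fin m → EuclideanSpace ℂ (Fin n)} (hy : ∀ i, y i ∈ hullFiber Γ f c)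
    (G : MvPolynomial (Fin m × Fin n) ℂ) :
    ∃ (Φ : ℕ → ℂ → ℂ) (M : ℝ), 0 < M ∧
      (∀ N, DifferentiableOn ℂ (Φ N) (polyEval f '' Γ)ᶜ) ∧
      (∀ N, ‖tupleEval G y‖ ^ N ≤ ‖Φ N c‖) ∧
      (∀ Q ⊆ (polyEval f '' Γ)ᶜ, IsCompact Q →
        ∃ A, 0 < A ∧ ∀ N, ∀ w ∈ Q, ‖Φ N w‖ ≤ A * M ^ N) ∧
      ∀ w ∉ polyEval f '' Γ, ∀ r₀ r, 0 ≤ r₀ → r₀ < r →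
        (∀ x, (∀ i, x i ∈ hullFiber Γ f w) → ‖tupleEval G x‖ ≤ r₀) →
        ∀ᶠ N in atTop, ‖Φ N w‖ ≤ r ^ N := by
  obtain ⟨M, hM0, hM⟩ := exists_bound_tupleEval hΓ G
  have hK : IsOpen (polyEval f '' Γ)ᶜ :=
    (hΓ.image (continuous_polyEval f)).isClosed.isOpen_compl
  have hG : ∀ x : Fin m → EuclideanSpace ℂ (Fin n), (∀ i, x i ∈ Γ) →
      (∃ i, polyEval f (x i) ∈ (polyEval f '' Γ)ᶜ) → ‖tupleEval G x‖ ≤ 0 := by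
    rintro x hx ⟨i, hi⟩
    exact absurd ⟨x i, hx i, rfl⟩ hi
  obtain ⟨Φ, h1, h2, h3, h4⟩ := exists_analytic_family hΓ hne f hK hc y (fun i => (hy i).1)
    (fun i => (hy i).2) G le_rfl hM hG
  refine ⟨fun N => if N = 0 then 1 else Φ N, M, hM0, fun N => ?_, fun N => ?_,
    fun Q hQ hQc => ?_, fun w hw r₀ r hr₀ hr h => ?_⟩
  · dsimp only
    split_ifs
    · exact differentiableOn_const 1
    · exact h1 N
  · rcases eq_or_ne N 0 with rfl | hN
    · simp
    · simpa [hN] using h2 N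
  · obtain ⟨A, hA, hAb⟩ := h3 Q hQ hQc
    refine ⟨max A 1, by positivity, fun N w hw => ?_⟩
    rcases eq_or_ne N 0 with rfl | hN
    · simp
    · simp only [hN, if_false]
      exact (hAb N w hw).trans (by gcongr; exact le_max_left _ _)
  · filter_upwards [h4 w hw hw r₀ r hr₀ hr (hr₀.trans_lt hr) h, eventually_ne_atTop 0] with N hN hN0
    simpa [hN0] using hN

theorem exists_counting_family {Γ : Set (EuclideanSpace ℂ (Fin n))} (hΓ : IsCompact Γ)
    (hne : Γ.Nonempty) (f : MvPolynomial (Fin n) ℂ) {c : ℂ} (hc : c ∉ polyEval f '' Γ)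
    (hm : (m : ℕ∞) ≤ (hullFiber Γ f c).encard) :
    ∃ (g : MvPolynomial (Fin n) ℂ) (Φ : ℕ → ℂ → ℂ) (M b : ℝ), 0 < M ∧ 0 < b ∧
      (∀ N, DifferentiableOn ℂ (Φ N) (polyEval f '' Γ)ᶜ) ∧
      (∀ N, b ^ N ≤ ‖Φ N c‖) ∧
      (∀ Q ⊆ (polyEval f '' Γ)ᶜ, IsCompact Q →
        ∃ A, 0 < A ∧ ∀ N, ∀ w ∈ Q, ‖Φ N w‖ ≤ A * M ^ N) ∧
      ∀ w ∉ polyEval f '' Γ, ∀ r₀ r, 0 ≤ r₀ → r₀ < r →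
        (∀ x, (∀ i, x i ∈ hullFiber Γ f w) → ‖tupleEval (diffProd m g) x‖ ≤ r₀) →
        ∀ᶠ N in atTop, ‖Φ N w‖ ≤ r ^ N := by
  obtain ⟨y, hyi, hy⟩ := natCast_le_encard_iff.1 hm
  obtain ⟨g, hg, -⟩ := exists_polyEval_eq hyi (fun i => ((i : ℕ) : ℂ)) finite_empty (by simp)
  have hne0 : tupleEval (diffProd m g) y ≠ 0 := tupleEval_diffProd_ne_zero fun i j hij => by
    simp only [hg] at hij
    exact Fin.ext (by exact_mod_cast hij)
  obtain ⟨Φ, M, hM, h1, h2, h3, h4⟩ := exists_analytic_family_compl hΓ hne f hc hy (diffProd m g)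
  exact ⟨g, Φ, M, _, hM, norm_pos_iff.2 hne0, h1, h2, h3, h4⟩

end

section

open MeasureTheory Set Metric Filter Topology

variable {n m : ℕ} {Γ : Set (EuclideanSpace ℂ (Fin n))} {f : MvPolynomial (Fin n) ℂ}

theorem isOpen_compl_image_polyEval (hΓ : IsCompact Γ) (f : MvPolynomial (Fin n) ℂ) :
    IsOpen (polyEval f '' Γ)ᶜ :=
  (hΓ.image (continuous_polyEval f)).isClosed.isOpen_compl

theorem volume_re_image_encard_lt (hΓ : IsCompact Γ) (hne : Γ.Nonempty) {z₀ : ℂ} {R : ℝ}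
    (hR : 0 < R) (hball : closedBall z₀ R ⊆ (polyEval f '' Γ)ᶜ)
    (hm : (m : ℕ∞) ≤ (hullFiber Γ f z₀).encard) :
    volume (Complex.re '' {w ∈ closedBall z₀ (R / 8) | (hullFiber Γ f w).encard < m}) = 0 := by
  obtain ⟨g, Φ, M, b, hM, hb, hΦ, hlow, hbd, hup⟩ := exists_counting_family hΓ hne f
    (hball (mem_closedBall_self hR.le)) hm
  obtain ⟨A, hA, hAb⟩ := hbd _ hball (isCompact_closedBall _ _)
  refine volume_re_image_eq_zero hR hA hM hb (fun N z hz => ?_) hAb hlow (fun w hw => hw.1)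
    fun w hw ε hε => ?_
  · exact (hΦ N).analyticAt ((isOpen_compl_image_polyEval hΓ f).mem_nhds (hball hz))
  · refine hup w (hball (closedBall_subset_closedBall (by linarith) hw.1)) 0 ε le_rfl hε
      fun x hx => ?_
    rw [tupleEval_diffProd_eq_zero _ (not_injective_of_encard_lt hw.2 hx), norm_zero]

theorem volume_re_image_ne_zero {U : Set ℂ} (hU : IsOpen U) (hne : U.Nonempty) :
    volume (Complex.re '' U) ≠ 0 := by
  have h : IsOpen (Complex.re '' U) := Complex.isOpenMap_re U hU
  exact (h.measure_pos volume (hne.image _)).ne'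

theorem encard_hullFiber_le_of_isOpen (hΓ : IsCompact Γ) (hne : Γ.Nonempty) {U V : Set ℂ}
    (hU : IsPreconnected U) (hUK : U ⊆ (polyEval f '' Γ)ᶜ) (hUo : IsOpen U)
    (hV : IsOpen V) (hVU : (V ∩ U).Nonempty)
    (h : ∀ w ∈ V, (hullFiber Γ f w).encard ≤ m) : ∀ w ∈ U, (hullFiber Γ f w).encard ≤ m := by
  set A := interior {w | (hullFiber Γ f w).encard ≤ m} with hA
  have hAm : ∀ w ∈ A, (hullFiber Γ f w).encard ≤ m := fun w hw => by
    have : w ∈ {w | (hullFiber Γ f w).encard ≤ m} := interior_subset hw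
    exact this
  suffices U ⊆ A from fun w hw => hAm w (this hw)
  refine hU.subset_of_closure_inter_subset isOpen_interior ?_ ?_
  · obtain ⟨v, hv, hvU⟩ := hVU
    exact ⟨v, hvU, interior_maximal h hV hv⟩
  · rintro w ⟨hwA, hwU⟩
    by_contra hw
    obtain ⟨R, hR, hRU⟩ := nhds_basis_closedBall.mem_iff.1 (hUo.mem_nhds hwU)
    have hw' : ¬ ball w (R / 32) ⊆ {w | (hullFiber Γ f w).encard ≤ m} := fun hsub =>
      hw (mem_interior.2 ⟨_, hsub, isOpen_ball, mem_ball_self (by positivity)⟩)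
    obtain ⟨z₀, hz₀, hzm⟩ := not_subset.1 hw'
    have hzm' : ((m + 1 : ℕ) : ℕ∞) ≤ (hullFiber Γ f z₀).encard := by
      have : (m : ℕ∞) < (hullFiber Γ f z₀).encard := not_le.1 (by simpa using hzm)
      push_cast
      exact Order.add_one_le_of_lt this
    rw [mem_ball] at hz₀
    have hb : closedBall z₀ (R / 2) ⊆ (polyEval f '' Γ)ᶜ :=
      (closedBall_subset_closedBall' (by linarith)).trans (hRU.trans hUK)
    have hnull := volume_re_image_encard_lt hΓ hne (by positivity) hb hzm'
    obtain ⟨v, hvb, hvA⟩ := mem_closure_iff.1 hwA (ball w (R / 32)) isOpen_ball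
      (mem_ball_self (by positivity))
    refine volume_re_image_ne_zero (isOpen_ball.inter isOpen_interior) ⟨v, hvb, hvA⟩
      (measure_mono_null (image_mono ?_) hnull)
    rintro u ⟨hub, huA⟩
    refine ⟨?_, ?_⟩
    · rw [mem_ball] at hub
      rw [mem_closedBall]
      have := dist_triangle_right u z₀ w
      linarith
    · refine (hAm u huA).trans_lt ?_
      exact_mod_cast Nat.lt_succ_self m

theorem ae_eventually_encard_lt (hΓ : IsCompact Γ) (hne : Γ.Nonempty) (f : MvPolynomial (Fin n) ℂ)
    (m : ℕ) : ∀ᵐ t : ℝ, ∀ w ∉ polyEval f '' Γ, w.re = t → (hullFiber Γ f w).encard < m →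
      ∀ᶠ w' in 𝓝 w, (hullFiber Γ f w').encard < m := by
  set Z : Set ℂ := {w | w ∉ polyEval f '' Γ ∧ (hullFiber Γ f w).encard < m ∧
    ¬ ∀ᶠ w' in 𝓝 w, (hullFiber Γ f w').encard < m} with hZ
  suffices h : OuterMeasure.comap Complex.re (volume : Measure ℝ).toOuterMeasure Z = 0 by
    rw [ae_iff]
    refine measure_mono_null ?_ h
    intro t ht
    simp only [mem_ofPred_eq] at ht
    push Not at ht
    obtain ⟨w, hw, hwt, hwm, hwe⟩ := ht
    exact ⟨w, ⟨hw, hwm, by simpa using hwe⟩, hwt⟩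
  refine measure_null_of_locally_null Z fun w hw => ?_
  obtain ⟨hwK, hwm, hwe⟩ := hw
  obtain ⟨R, hR, hRU⟩ := nhds_basis_closedBall.mem_iff.1
    ((isOpen_compl_image_polyEval hΓ f).mem_nhds hwK)
  obtain ⟨z₀, hzm, hz₀⟩ := ((not_eventually.1 hwe).and_eventually
    (ball_mem_nhds w (by positivity : 0 < R / 32))).exists
  have hb : closedBall z₀ (R / 2) ⊆ (polyEval f '' Γ)ᶜ :=
    (closedBall_subset_closedBall' (by linarith)).trans hRU
  have hnull := volume_re_image_encard_lt hΓ hne (by positivity) hb (not_lt.1 hzm)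
  refine ⟨Z ∩ ball w (R / 32), inter_mem_nhdsWithin _ (ball_mem_nhds w (by positivity)), ?_⟩
  change volume (Complex.re '' (Z ∩ ball w (R / 32))) = 0
  refine measure_mono_null (image_mono ?_) hnull
  rintro u ⟨huZ, hub⟩
  refine ⟨?_, huZ.2.1⟩
  rw [mem_ball] at hub
  rw [mem_closedBall]
  have := dist_triangle_right u z₀ w
  linarith

theorem norm_exp_mul_I_sub_le (a b : ℝ) :
    ‖Complex.exp (a * Complex.I) - Complex.exp (b * Complex.I)‖ ≤ |a - b| := by
  have h : Complex.exp (a * Complex.I) - Complex.exp (b * Complex.I) =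
      Complex.exp (b * Complex.I) * (Complex.exp (Complex.I * ((a - b : ℝ) : ℂ)) - 1) := by
    rw [mul_sub, ← Complex.exp_add]
    push_cast
    ring_nf
  rw [h, norm_mul, Complex.norm_exp_ofReal_mul_I, one_mul]
  exact Real.norm_exp_I_mul_ofReal_sub_one_le

theorem eventually_hullFiber_inter_ball_nonempty (hΓ : IsCompact Γ) (hne : Γ.Nonempty) {w₀ : ℂ}
    (hw₀ : w₀ ∉ polyEval f '' Γ) (hfin : (hullFiber Γ f w₀).Finite)
    {x : EuclideanSpace ℂ (Fin n)} (hx : x ∈ hullFiber Γ f w₀) {r : ℝ} (hr : 0 < r) :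
    ∀ᶠ w in 𝓝 w₀, (hullFiber Γ f w ∩ ball x r).Nonempty := by
  obtain ⟨g, hg1, hg0⟩ := exists_polyEval_eq_one_eq_zero x (hfin.subset (sdiff_subset (t := {x})))
    (by simp)
  set U₁ := ball x r ∩ {z | ‖polyEval g z - 1‖ < 1 / 10}
  set U₂ := {z | ‖polyEval g z‖ < 1 / 10}
  have hcg := continuous_polyEval g
  have hU : IsOpen (U₁ ∪ U₂) :=
    (isOpen_ball.inter (isOpen_lt (hcg.sub continuous_const).norm continuous_const)).union
      (isOpen_lt hcg.norm continuous_const)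
  have hsub : hullFiber Γ f w₀ ⊆ U₁ ∪ U₂ := fun z hz => by
    by_cases h : z = x
    · left
      subst h
      exact ⟨mem_ball_self hr, by simp [hg1]⟩
    · right
      simp [U₂, hg0 z ⟨hz, h⟩]
  obtain ⟨ρ, hρ, hρs⟩ := Metric.eventually_nhds_iff_ball.1
    ((eventually_hullFiber_subset hΓ f hU hsub).and
      ((isOpen_compl_image_polyEval hΓ f).mem_nhds hw₀))
  filter_upwards [ball_mem_nhds w₀ (by positivity : 0 < ρ / 4)] with w₁ hw₁
  by_contra hemp
  rw [mem_ball] at hw₁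
  set P : Set ℂ := {w | (hullFiber Γ f w ∩ {z | 1 / 2 ≤ (polyEval g z).re}).Nonempty} ∩
    closedBall w₀ (ρ / 2)
  have hPc : IsCompact P := (isCompact_hullFiber_preimage hΓ f
    (isClosed_le continuous_const (Complex.continuous_re.comp hcg))).inter_right isClosed_closedBall
  have hPne : P.Nonempty :=
    ⟨w₀, ⟨x, hx, by simp only [mem_ofPred_eq, hg1]; norm_num⟩, mem_closedBall_self (by positivity)⟩
  obtain ⟨p, hpP, hpd⟩ := hPc.exists_infDist_eq_dist hPne w₁
  have hbig : ∀ w ∈ ball w₀ ρ, ∀ z ∈ hullFiber Γ f w, ‖polyEval g z‖ ≤ 11 / 10 := by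
    intro w hw z hz
    rcases (hρs w hw).1 hz with h | h
    · have h1 : ‖polyEval g z - 1‖ < 1 / 10 := h.2
      have h2 := norm_le_norm_sub_add (polyEval g z) 1
      rw [norm_one] at h2
      linarith
    · have h1 : ‖polyEval g z‖ < 1 / 10 := h
      linarith
  have hU₁re : ∀ z ∈ U₁, 9 / 10 < (polyEval g z).re := fun z hz => by
    have h1 : ‖polyEval g z - 1‖ < 1 / 10 := hz.2
    have h2 := (Complex.abs_re_le_norm _).trans_lt h1
    rw [Complex.sub_re, Complex.one_re, abs_lt] at h2
    linarith
  have hU₂re : ∀ z ∈ U₂, (polyEval g z).re < 1 / 10 := fun z hz =>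
    (Complex.re_le_norm _).trans_lt hz
  have hw₁P : w₁ ∉ P := by
    rintro ⟨⟨z, hz, hzg⟩, -⟩
    have hzg : 1 / 2 ≤ (polyEval g z).re := hzg
    rcases (hρs w₁ (mem_ball.2 (by linarith))).1 hz with h | h
    · exact hemp ⟨z, hz, h.1⟩
    · have := hU₂re z h
      linarith
  set d := dist w₁ p
  have hd : 0 < d := dist_pos.2 fun h => hw₁P (h ▸ hpP)
  have hdρ : d < ρ / 4 := by
    refine lt_of_le_of_lt ?_ hw₁
    rw [← hpd]
    exact infDist_le_dist_of_mem
      ⟨⟨x, hx, by simp only [mem_ofPred_eq, hg1]; norm_num⟩, mem_closedBall_self (by positivity)⟩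
  have hpw : dist p w₀ < ρ / 2 := by
    have := dist_triangle_left p w₀ w₁
    change _ ≤ d + _ at this
    linarith
  have hsmall : ∀ w ∈ ball w₁ d, ∀ z ∈ hullFiber Γ f w, ‖polyEval g z‖ ≤ 1 / 10 := by
    intro w hw z hz
    rw [mem_ball] at hw
    have hww : dist w w₀ < ρ / 2 := by
      have := dist_triangle w w₁ w₀
      linarith
    rcases (hρs w (mem_ball.2 (by linarith))).1 hz with h | h
    · exfalso
      have hwP : w ∈ P := ⟨⟨z, hz, by
        have := hU₁re z h
        simp only [mem_ofPred_eq]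
        linarith⟩, hww.le⟩
      have := infDist_le_dist_of_mem hwP (x := w₁)
      rw [hpd, dist_comm w₁ w] at this
      change d ≤ _ at this
      linarith
    · exact le_of_lt h
  obtain ⟨⟨z, hz, hzg⟩, -⟩ := hpP
  have hzg : 1 / 2 ≤ (polyEval g z).re := hzg
  have hz9 : 9 / 10 ≤ ‖polyEval g z‖ := by
    rcases (hρs p (mem_ball.2 (by linarith))).1 hz with h | h
    · exact (hU₁re z h).le.trans (Complex.re_le_norm _)
    · have := hU₂re z h
      linarith
  have hcb : closedBall p d ⊆ ball w₀ ρ := fun w hw => by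
    rw [mem_closedBall] at hw
    rw [mem_ball]
    have := dist_triangle w p w₀
    linarith
  have hcbK : closedBall p d ⊆ (polyEval f '' Γ)ᶜ := fun w hw => (hρs w (hcb hw)).2
  obtain ⟨Φ, M, hM, hΦ, hlow, hbd, hup⟩ := exists_analytic_family_compl hΓ hne f
    (hcbK (mem_closedBall_self hd.le)) (y := fun _ : Fin 1 => z) (fun _ => hz) (polyAt 0 g)
  simp only [tupleEval_polyAt] at hlow hup
  obtain ⟨A, hA, hAb⟩ := hbd _ hcbK (isCompact_closedBall _ _)
  have hexp : ∀ (N : ℕ) {a : ℝ}, 0 < a → Real.exp (N * Real.log a) = a ^ N := fun N a ha => by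
    rw [Real.exp_nat_mul, Real.exp_log ha]
  have key := le_two_constants_of_eventually_norm_le_exp (φ₀ := (w₁ - p).arg) (α := 1)
    (l := Real.log (9 / 10)) (l₁ := Real.log (11 / 100)) (l₂ := Real.log (111 / 100)) hd zero_le_one
    (by linarith [Real.two_le_pi])
    (fun N w hw => (hΦ N).analyticAt ((isOpen_compl_image_polyEval hΓ f).mem_nhds (hcbK hw)))
    hA hM (fun N w hw => hAb N w (sphere_subset_closedBall hw))
    (Eventually.of_forall fun N => by
      rw [hexp N (by norm_num)]
      exact (pow_le_pow_left₀ (by norm_num) hz9 N).trans (hlow N))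
    (Eventually.of_forall fun φ hφ => by
      simp only [hexp _ (by norm_num : (0 : ℝ) < 11 / 100)]
      have hmem : circleMap p d φ ∈ closedBall p d :=
        sphere_subset_closedBall (circleMap_mem_sphere p hd.le φ)
      refine hup _ (hcbK hmem) (1 / 10) (11 / 100) (by norm_num) (by norm_num) fun y hy => ?_
      refine hsmall _ ?_ _ (hy 0)
      rw [mem_ball, dist_eq_norm]
      have h1 : w₁ - p = d * Complex.exp ((w₁ - p).arg * Complex.I) := by
        conv_lhs => rw [← Complex.norm_mul_exp_arg_mul_I (w₁ - p), ← dist_eq_norm]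
      have h2 : circleMap p d φ - w₁ = d * (Complex.exp (φ * Complex.I) -
          Complex.exp ((w₁ - p).arg * Complex.I)) := by
        rw [circleMap, mul_sub, ← h1]
        ring
      rw [h2, norm_mul, Complex.norm_real, Real.norm_of_nonneg hd.le]
      have h3 := norm_exp_mul_I_sub_le φ (w₁ - p).arg
      have h4 : |φ - (w₁ - p).arg| < 1 := abs_lt.2 ⟨by linarith [hφ.1], by linarith [hφ.2]⟩
      exact mul_lt_of_lt_one_right hd (h3.trans_lt h4))
    (Eventually.of_forall fun φ => by
      simp only [hexp _ (by norm_num : (0 : ℝ) < 111 / 100)]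
      have hmem : circleMap p d φ ∈ closedBall p d :=
        sphere_subset_closedBall (circleMap_mem_sphere p hd.le φ)
      exact hup _ (hcbK hmem) (11 / 10) (111 / 100) (by norm_num) (by norm_num) fun y hy =>
        hbig _ (hcb hmem) _ (hy 0))
  have h1 := Real.one_sub_inv_le_log_of_pos (by norm_num : (0 : ℝ) < 9 / 10)
  have h2 := Real.log_le_sub_one_of_pos (by norm_num : (0 : ℝ) < 11 / 100)
  have h3 := Real.log_le_sub_one_of_pos (by norm_num : (0 : ℝ) < 111 / 100)
  have h4 := Real.pi_lt_d2
  have h5 := Real.pi_gt_three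
  nlinarith

end

section

open MeasureTheory Set Metric Filter Topology

variable {n m : ℕ} {Γ : Set (EuclideanSpace ℂ (Fin n))} {f : MvPolynomial (Fin n) ℂ}

theorem exists_sphere_inter_finite {F : ℝ → ℂ} {L : NNReal} (hF : LipschitzWith L F) (c : ℂ)
    {r : ℝ} (hr : 0 < r) : ∃ R ∈ Ioo 0 r, (sphere c R ∩ F '' Icc 0 1).Finite := by
  have h := ((LipschitzWith.dist_left c).comp hF).ae_finite_fiber
  obtain ⟨R, hR, hRf⟩ := (Measure.dense_of_ae h).exists_mem_open isOpen_Ioo (nonempty_Ioo.2 hr)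
  refine ⟨R, hRf, (Set.Finite.image F hR).subset ?_⟩
  rintro _ ⟨hw, τ, hτ, rfl⟩
  exact ⟨τ, ⟨hτ, hw⟩, rfl⟩

theorem exists_ball_norm_tupleEval_le (hΓ : IsCompact Γ) (c : ℂ)
    {G : MvPolynomial (Fin m × Fin n) ℂ}
    (hG : ∀ x, (∀ i, x i ∈ Γ) → (∃ i, polyEval f (x i) = c) → tupleEval G x = 0) {δ : ℝ}
    (hδ : 0 < δ) : ∃ r > 0, ∀ x, (∀ i, x i ∈ Γ) → (∃ i, polyEval f (x i) ∈ ball c r) →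
      ‖tupleEval G x‖ ≤ δ := by
  have hS : IsCompact ({x | ∀ i, x i ∈ Γ} ∩ {x | δ ≤ ‖tupleEval G x‖}) := by
    have := (isCompact_univ_pi fun _ : Fin m => hΓ).inter_right
      (isClosed_le continuous_const (continuous_tupleEval G).norm : IsClosed {x | δ ≤ _})
    simpa [Set.pi] using this
  have hT : IsClosed (⋃ i, (fun x : Fin m → EuclideanSpace ℂ (Fin n) => polyEval f (x i)) ''
      ({x | ∀ i, x i ∈ Γ} ∩ {x | δ ≤ ‖tupleEval G x‖})) :=
    isClosed_iUnion_of_finite fun i => (hS.image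
      ((continuous_polyEval f).comp (continuous_apply i))).isClosed
  obtain ⟨r, hr, hrT⟩ := Metric.isOpen_iff.1 hT.isOpen_compl c (by
    simp only [mem_compl_iff, mem_iUnion, not_exists]
    rintro i ⟨x, ⟨hx, hxδ⟩, hxc⟩
    have hxδ : δ ≤ ‖tupleEval G x‖ := hxδ
    rw [hG x hx ⟨i, hxc⟩, norm_zero] at hxδ
    linarith)
  refine ⟨r, hr, fun x hx ⟨i, hi⟩ => ?_⟩
  by_contra! h
  exact hrT hi (mem_iUnion.2 ⟨i, x, ⟨hx, h.le⟩, rfl⟩)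

theorem encard_hullFiber_diff_le (hΓ : IsCompact Γ) (hne : Γ.Nonempty) {F : ℝ → ℂ} {L : NNReal}
    (hF : LipschitzWith L F) (hKF : polyEval f '' Γ ⊆ F '' Icc 0 1) {c : ℂ}
    (hc : (Γ ∩ polyEval f ⁻¹' {c}).Finite) {κ h : ℝ} (hκ : 0 < κ) (hh : 0 < h)
    (hfree : ∀ w ∈ ball c h, |(w - c).re| < κ * (w - c).im →
      w ∉ polyEval f '' Γ ∧ (hullFiber Γ f w).encard ≤ m) :
    (hullFiber Γ f c \ Γ).encard ≤ m := by
  by_contra! hlt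
  have hm : ((m + 1 : ℕ) : ℕ∞) ≤ (hullFiber Γ f c \ Γ).encard := by
    push_cast
    exact Order.add_one_le_of_lt hlt
  obtain ⟨y, hyi, hy⟩ := natCast_le_encard_iff.1 hm
  obtain ⟨g, hg, -⟩ := exists_polyEval_eq hyi (fun i => ((i : ℕ) : ℂ)) finite_empty (by simp)
  obtain ⟨p, hp1, hp0⟩ := exists_polyEval_eq hyi (fun _ => 1) hc fun i hi => (hy i).2 hi.1
  set G : MvPolynomial (Fin (m + 1) × Fin n) ℂ := (∏ i, polyAt i p) * diffProd (m + 1) g with hGdef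
  have hGx : ∀ x, tupleEval G x = (∏ i, polyEval p (x i)) * tupleEval (diffProd (m + 1) g) x := by
    intro x
    rw [hGdef, tupleEval_mul, tupleEval_prod]
    simp only [tupleEval_polyAt]
  have hGy : tupleEval G y ≠ 0 := by
    rw [hGx]
    simp only [hp1, Finset.prod_const_one, one_mul]
    refine tupleEval_diffProd_ne_zero fun i j hij => ?_
    simp only [hg] at hij
    exact Fin.ext (by exact_mod_cast hij)
  have hb : 0 < ‖tupleEval G y‖ := norm_pos_iff.2 hGy
  set b := ‖tupleEval G y‖
  obtain ⟨M', hM', hM'b⟩ := exists_bound_tupleEval (isCompact_polyHull hΓ) G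
  obtain ⟨M, hM, hMb⟩ := exists_bound_tupleEval hΓ G
  have hbM : b ≤ M' := hM'b y fun i => (hy i).1.1
  set α := min 1 (κ / 2) with hα
  have hα0 : 0 < α := lt_min one_pos (by positivity)
  have hα1 : α ≤ 1 := min_le_left _ _
  set D := Real.pi * Real.log (b / 2) - (Real.pi - α) * Real.log (M' + 1) with hD
  set δ := min (b / 2) (Real.exp (D / α) / 4) with hδ
  have hδ0 : 0 < δ := by positivity
  obtain ⟨r, hr, hrG⟩ := exists_ball_norm_tupleEval_le (f := f) hΓ c (G := G) (by
    rintro x hx ⟨i, hi⟩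
    rw [hGx, Finset.prod_eq_zero (Finset.mem_univ i) (hp0 _ ⟨hx i, hi⟩), zero_mul]) hδ0
  obtain ⟨R, ⟨hR0, hRr⟩, hRfin⟩ := exists_sphere_inter_finite hF c (lt_min hr hh)
  obtain ⟨Φ, hΦ, hlow, hbd, hup⟩ := exists_analytic_family hΓ hne f (isOpen_ball (x := c) (ε := r))
    (mem_ball_self hr) y (fun i => (hy i).1.1) (fun i => (hy i).1.2) G hδ0.le hMb hrG
  have hcb : closedBall c R ⊆ ball c r := closedBall_subset_ball (hRr.trans_le (min_le_left _ _))
  obtain ⟨A, hA, hAb⟩ := hbd _ hcb (isCompact_closedBall _ _)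
  have hexp : ∀ (N : ℕ) {a : ℝ}, 0 < a → Real.exp (N * Real.log a) = a ^ N := fun N a ha => by
    rw [Real.exp_nat_mul, Real.exp_log ha]
  have hmem : ∀ φ, circleMap c R φ ∈ ball c r := fun φ =>
    hcb (sphere_subset_closedBall (circleMap_mem_sphere c hR0.le φ))
  have hδb : δ ≤ b / 2 := min_le_left _ _
  have key := le_two_constants_of_eventually_norm_le_exp (φ₀ := Real.pi / 2) (α := α)
    (l := Real.log (b / 2)) (l₁ := Real.log (2 * δ)) (l₂ := Real.log (M' + 1)) hR0 hα0.le
    (by linarith [Real.two_le_pi])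
    (fun N w hw => (hΦ N).analyticAt (isOpen_ball.mem_nhds (hcb hw)))
    hA hM (fun N w hw => hAb N w (sphere_subset_closedBall hw)) (by
      filter_upwards [eventually_gt_atTop 0] with N hN
      rw [hexp N (by positivity)]
      refine le_trans ?_ (hlow N)
      have h1 := pow_le_pow_left₀ hδ0.le hδb N
      have h2 : (2 : ℝ) ≤ 2 ^ N := le_self_pow₀ one_le_two hN.ne'
      have h3 : b ^ N = 2 ^ N * (b / 2) ^ N := by rw [← mul_pow]; congr 1; ring
      have h4 := mul_le_mul_of_nonneg_right h2 (pow_nonneg (by positivity : 0 ≤ b / 2) N)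
      change _ ≤ b ^ N - δ ^ N
      linarith)
    (Eventually.of_forall fun φ hφ => by
      simp only [hexp _ (by positivity : 0 < 2 * δ)]
      have hsin : Real.sin φ = Real.cos (φ - Real.pi / 2) := (Real.cos_sub_pi_div_two φ).symm
      have hcos : Real.cos φ = -Real.sin (φ - Real.pi / 2) := by
        rw [Real.sin_sub_pi_div_two, neg_neg]
      have hφ' : |φ - Real.pi / 2| < α := abs_lt.2 ⟨by linarith [hφ.1], by linarith [hφ.2]⟩
      have hfr := hfree (circleMap c R φ) (by
        rw [mem_ball, mem_sphere.1 (circleMap_mem_sphere c hR0.le φ)]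
        exact hRr.trans_le (min_le_right _ _)) (by
        have h1 : circleMap c R φ - c = R * Complex.exp (φ * Complex.I) := by
          rw [circleMap]; ring
        rw [h1, Complex.re_ofReal_mul, Complex.im_ofReal_mul, Complex.exp_ofReal_mul_I_re,
          Complex.exp_ofReal_mul_I_im, abs_mul, abs_of_pos hR0, ← mul_assoc, mul_comm κ, mul_assoc]
        refine mul_lt_mul_of_pos_left ?_ hR0
        have h2 : |Real.cos φ| ≤ |φ - Real.pi / 2| := by
          rw [hcos, abs_neg]
          exact Real.abs_sin_le_abs
        have h3 := Real.one_sub_sq_div_two_le_cos (x := φ - Real.pi / 2)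
        rw [← hsin] at h3
        have h4 : (φ - Real.pi / 2) ^ 2 ≤ 1 := (sq_le_one_iff_abs_le_one _).2 (by linarith)
        have h5 : α ≤ κ / 2 := min_le_right _ _
        nlinarith)
      refine hup _ (hmem φ) hfr.1 0 (2 * δ) le_rfl (by positivity) (by linarith) fun x hx => ?_
      have hx' : ∀ i, x i ∈ hullFiber Γ f (circleMap c R φ) := hx
      rw [hGx, tupleEval_diffProd_eq_zero _ (not_injective_of_encard_lt
        (hfr.2.trans_lt (by exact_mod_cast Nat.lt_succ_self m)) hx'), mul_zero, norm_zero])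
    (by
      have h0 : ∀ᵐ φ : ℝ, φ ∉ circleMap c R ⁻¹' (sphere c R ∩ F '' Icc 0 1) :=
        measure_eq_zero_iff_ae_notMem.1
          ((hRfin.countable.preimage_circleMap c hR0.ne').measure_zero _)
      filter_upwards [h0] with φ hφ
      simp only [hexp _ (by positivity : 0 < M' + 1)]
      refine hup _ (hmem φ) (fun hK => hφ ⟨circleMap_mem_sphere c hR0.le φ, hKF hK⟩) M' (M' + 1)
        hM'.le (by linarith) (by linarith) fun x hx => hM'b x fun i => (hx i).1)
  have h1 : Real.log (2 * δ) < D / α := by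
    rw [Real.log_lt_iff_lt_exp (by positivity)]
    have := min_le_right (b / 2) (Real.exp (D / α) / 4)
    have := Real.exp_pos (D / α)
    linarith
  rw [lt_div_iff₀ hα0] at h1
  linarith

end

section

open MeasureTheory Set Metric Filter Topology

variable {n m : ℕ} {Γ : Set (EuclideanSpace ℂ (Fin n))} {f : MvPolynomial (Fin n) ℂ}

theorem exists_forall_dist_lt_norm_tupleEval_sub_lt {S : Set (EuclideanSpace ℂ (Fin n))}
    (hS : IsCompact S) (G : MvPolynomial (Fin m × Fin n) ℂ) {ε : ℝ} (hε : 0 < ε) :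
    ∃ δ > 0, ∀ x p, (∀ i, x i ∈ S) → (∀ i, p i ∈ S) → (∀ i, dist (x i) (p i) < δ) →
      ‖tupleEval G x - tupleEval G p‖ < ε := by
  have hu := (isCompact_univ_pi fun _ : Fin m => hS).uniformContinuousOn_of_continuous
    (continuous_tupleEval G).continuousOn
  obtain ⟨δ, hδ, h⟩ := Metric.uniformContinuousOn_iff.1 hu ε hε
  refine ⟨δ, hδ, fun x p hx hp hxp => ?_⟩
  rw [← dist_eq_norm]
  exact h x (fun i _ => hx i) p (fun i _ => hp i) ((dist_pi_lt_iff hδ).2 hxp)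

theorem volume_re_image_radial (hΓ : IsCompact Γ) (hne : Γ.Nonempty) {z₀ : ℂ}
    (hz₀ : z₀ ∉ polyEval f '' Γ) (hm : (m : ℕ∞) ≤ (hullFiber Γ f z₀).encard) {η : ℝ} (hη : 0 < η) :
    volume (Complex.re '' {c ∈ polyEval f '' Γ | z₀.im < c.im ∧
      (∀ σ ∈ Ico (0 : ℝ) 1, ball (z₀ + σ * (c - z₀)) ((1 - σ) * η) ⊆ (polyEval f '' Γ)ᶜ) ∧
      ∃ T ⊆ polyHull Γ, T.encard < m ∧ ∀ ε > 0, ∀ᶠ σ : ℝ in 𝓝[<] 1,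
        ∀ x ∈ hullFiber Γ f (z₀ + σ * (c - z₀)), ∃ p ∈ T, dist x p < ε}) = 0 := by
  set C := {c ∈ polyEval f '' Γ | z₀.im < c.im ∧
      (∀ σ ∈ Ico (0 : ℝ) 1, ball (z₀ + σ * (c - z₀)) ((1 - σ) * η) ⊆ (polyEval f '' Γ)ᶜ) ∧
      ∃ T ⊆ polyHull Γ, T.encard < m ∧ ∀ ε > 0, ∀ᶠ σ : ℝ in 𝓝[<] 1,
        ∀ x ∈ hullFiber Γ f (z₀ + σ * (c - z₀)), ∃ p ∈ T, dist x p < ε}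
  obtain ⟨g, Φ, M, b, hM, hb, hΦ, hlow, hbd, hup⟩ := exists_counting_family hΓ hne f hz₀ hm
  set A : ℂ → ℂ := fun w => z₀ + Complex.I * w with hA
  have hAc : Continuous A := by fun_prop
  have hAd : ∀ u w, dist (A u) (A w) = dist u w := fun u w => by
    have h : A u - A w = Complex.I * (u - w) := by simp only [hA]; ring
    rw [dist_eq_norm, h, norm_mul, Complex.norm_I, one_mul, dist_eq_norm]
  have hAσ : ∀ (σ : ℝ) w, A (σ * w) = z₀ + σ * (A w - z₀) := fun σ w => by
    simp only [hA]; ring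
  have hO := isOpen_compl_image_polyEval hΓ f
  obtain ⟨B, hB⟩ := (hΓ.image (continuous_polyEval f)).isBounded.exists_norm_le
  have hK : ∀ c ∈ C, ∀ σ ∈ Ico (0 : ℝ) 1, z₀ + σ * (c - z₀) ∉ polyEval f '' Γ :=
    fun c hc σ hσ => hc.2.2.1 σ hσ (mem_ball_self (mul_pos (by linarith [hσ.2]) hη))
  have key := volume_im_image_eq_zero_of_radial (O := A ⁻¹' (polyEval f '' Γ)ᶜ) (C := A ⁻¹' C)
    (Φ := fun N w => Φ N (A w)) (M := M) (b := b) (η := η) (B := B + ‖z₀‖) (hO.preimage hAc)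
    (fun N => (hΦ N).comp (by fun_prop) fun w hw => hw) hb
    (fun Q hQ hQc => by
      obtain ⟨A', hA', h⟩ := hbd (A '' Q) (image_subset_iff.2 hQ) (hQc.image hAc)
      exact ⟨A', hA', fun N w hw => h N _ ⟨w, hw, rfl⟩⟩)
    hM (fun N => by simpa [hA] using hlow N) hη
    (fun w hw => by
      have h1 : ‖w‖ = ‖A w - z₀‖ := by simp [hA]
      rw [h1]
      exact (norm_sub_le _ _).trans (add_le_add_left (hB _ hw.1) _))
    (fun w hw => by
      have := hw.2.1
      simpa [hA] using this)
    (fun w hw h => h hw.1)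
    (fun w hw σ hσ u hu => by
      refine hw.2.2.1 σ hσ ?_
      rwa [mem_ball, ← hAσ, hAd, ← mem_ball])
    (fun w hw ε hε => by
      obtain ⟨T, hTX, hTm, hT⟩ := hw.2.2.2
      obtain ⟨δ, hδ, hδG⟩ := exists_forall_dist_lt_norm_tupleEval_sub_lt (isCompact_polyHull hΓ)
        (diffProd m g) (half_pos hε)
      filter_upwards [hT δ hδ, Ico_mem_nhdsLT (zero_lt_one (α := ℝ))] with σ hσT hσ
      rw [hAσ]
      refine hup _ (hK _ hw σ hσ) (ε / 2) ε (by positivity) (by linarith) fun x hx => ?_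
      choose p hpT hp using fun i => hσT (x i) (hx i)
      have h1 := hδG x p (fun i => (hx i).1) (fun i => hTX (hpT i)) hp
      rw [tupleEval_diffProd_eq_zero g (not_injective_of_encard_lt hTm hpT), sub_zero] at h1
      exact h1.le)
  have hlip : LocallyLipschitz fun s : ℝ => z₀.re - s :=
    (IsometryEquiv.subLeft z₀.re).isometry.lipschitz.locallyLipschitz
  refine measure_mono_null ?_ (hlip.volume_image_eq_zero key)
  rintro _ ⟨c, hc, rfl⟩
  have hAc' : A (-Complex.I * (c - z₀)) = c := by
    simp only [hA]
    linear_combination (-(c - z₀)) * Complex.I_sq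
  refine ⟨_, ⟨-Complex.I * (c - z₀), by rwa [mem_preimage, hAc'], rfl⟩, ?_⟩
  simp

/-- For almost every vertical line, the fibers below a point `c` of the polynomial image of `Γ`
cannot lose points when `c` is approached vertically from below. -/
theorem ae_le_encard_of_approach (hΓ : IsCompact Γ) (hne : Γ.Nonempty)
    (f : MvPolynomial (Fin n) ℂ) : ∀ᵐ t : ℝ, ∀ c ∈ polyEval f '' Γ, c.re = t →
      ∀ W : Set ℂ, IsOpen W → W.Nonempty → W ⊆ (polyEval f '' Γ)ᶜ →
        (∀ w ∈ W, w.im < c.im) → (∀ w ∈ W, ∀ σ ∈ Ico (0 : ℝ) 1, w + σ * (c - w) ∈ W) →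
        ∀ (m : ℕ), (∀ V ⊆ W, IsOpen V → V.Nonempty → ∃ w ∈ V, m ≤ (hullFiber Γ f w).encard) →
        ∀ T ⊆ polyHull Γ, (∀ ε > 0, ∀ᶠ w in 𝓝 c, w ∈ W →
          ∀ x ∈ hullFiber Γ f w, ∃ p ∈ T, dist x p < ε) → m ≤ T.encard := by
  classical
  let good : ℕ → ℕ → ℕ → Set ℂ := fun i k m =>
    {z ∈ ball (TopologicalSpace.denseSeq ℂ i) (1 / ((k : ℝ) + 1)) |
      z ∉ polyEval f '' Γ ∧ (m : ℕ∞) ≤ (hullFiber Γ f z).encard}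
  let z : ℕ → ℕ → ℕ → ℂ := fun i k m =>
    if h : (good i k m).Nonempty then h.some else 0
  have hz : ∀ i k m, (good i k m).Nonempty → z i k m ∈ good i k m := fun i k m h => by
    simp only [z, dif_pos h]
    exact h.some_mem
  let bad : ℕ → ℕ → ℕ → Set ℂ := fun i k m => {c ∈ polyEval f '' Γ | (z i k m).im < c.im ∧
      (∀ σ ∈ Ico (0 : ℝ) 1, ball (z i k m + σ * (c - z i k m)) ((1 - σ) * (1 / ((k : ℝ) + 1))) ⊆
        (polyEval f '' Γ)ᶜ) ∧
      ∃ T ⊆ polyHull Γ, T.encard < m ∧ ∀ ε > 0, ∀ᶠ σ : ℝ in 𝓝[<] 1,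
        ∀ x ∈ hullFiber Γ f (z i k m + σ * (c - z i k m)), ∃ p ∈ T, dist x p < ε}
  have hae : ∀ᵐ t : ℝ, ∀ i k m, (good i k m).Nonempty → t ∉ Complex.re '' bad i k m := by
    refine ae_all_iff.2 fun i => ae_all_iff.2 fun k => ae_all_iff.2 fun m => ?_
    by_cases h : (good i k m).Nonempty
    · have hg := hz i k m h
      refine (measure_eq_zero_iff_ae_notMem.1
        (volume_re_image_radial hΓ hne hg.2.1 hg.2.2 (by positivity))).mono fun t ht _ => ht
    · exact Eventually.of_forall fun t h' => absurd h' h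
  filter_upwards [hae] with t ht c hcK hct W hWo hWne hWK hWim hWσ m hm T hTX hT
  by_contra! hlt
  obtain ⟨w, hw⟩ := hWne
  obtain ⟨r, hr, hrW⟩ := Metric.isOpen_iff.1 hWo w hw
  obtain ⟨k, hk⟩ := exists_nat_one_div_lt (by positivity : 0 < r / 3)
  obtain ⟨i, hi⟩ := (TopologicalSpace.denseRange_denseSeq ℂ).exists_dist_lt w
    (by positivity : 0 < r / 3)
  set q := TopologicalSpace.denseSeq ℂ i
  set η := 1 / ((k : ℝ) + 1)
  have hη : 0 < η := by positivity
  have hqW : ∀ u, dist u q < 2 * η → u ∈ W := fun u hu => hrW (by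
    rw [mem_ball]
    have := dist_triangle_right u w q
    linarith)
  obtain ⟨z', hz'b, hz'm⟩ := hm (ball q η) (fun u hu => hqW u (by
    rw [mem_ball] at hu; linarith)) isOpen_ball ⟨q, mem_ball_self hη⟩
  have hgood : (good i k m).Nonempty :=
    ⟨z', hz'b, hWK (hqW _ (by rw [mem_ball] at hz'b; linarith)), hz'm⟩
  have hg := hz i k m hgood
  set z₀ := z i k m
  have hzq : dist z₀ q < η := hg.1
  have hzW : z₀ ∈ W := hqW _ (by linarith)
  refine ht i k m hgood ⟨c, ⟨hcK, hWim _ hzW, fun σ hσ u hu => hWK ?_, T, hTX, hlt, fun ε hε => ?_⟩,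
    hct⟩
  · have h1σ : 0 < 1 - σ := by linarith [hσ.2]
    have h1σ' : ((1 - σ : ℝ) : ℂ) ≠ 0 := by exact_mod_cast h1σ.ne'
    set v := (u - (z₀ + σ * (c - z₀))) / ((1 - σ : ℝ) : ℂ) with hv
    have hvn : ‖v‖ < η := by
      rw [hv, norm_div, Complex.norm_real, Real.norm_of_nonneg h1σ.le, div_lt_iff₀ h1σ,
        ← dist_eq_norm, mul_comm η]
      exact hu
    have huv : u = (z₀ + v) + σ * (c - (z₀ + v)) := by
      have : ((1 - σ : ℝ) : ℂ) * v = u - (z₀ + σ * (c - z₀)) := mul_div_cancel₀ _ h1σ'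
      push_cast at this
      linear_combination -this
    rw [huv]
    refine hWσ _ (hqW _ ?_) σ hσ
    have := dist_triangle (z₀ + v) z₀ q
    rw [dist_self_add_left] at this
    linarith
  · have hlim : Tendsto (fun σ : ℝ => z₀ + σ * (c - z₀)) (𝓝[<] 1) (𝓝 c) := by
      have h1 : Continuous fun σ : ℝ => z₀ + σ * (c - z₀) := by fun_prop
      have h2 := h1.tendsto 1
      simp only [Complex.ofReal_one, one_mul, add_sub_cancel] at h2
      exact h2.mono_left nhdsWithin_le_nhds
    filter_upwards [hlim.eventually (hT ε hε), Ico_mem_nhdsLT (zero_lt_one (α := ℝ))] with σ h hσ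
    exact h (hWσ _ hzW σ hσ)

end

section

open MeasureTheory Set Metric Filter Topology

variable {n m : ℕ} {Γ : Set (EuclideanSpace ℂ (Fin n))} {f : MvPolynomial (Fin n) ℂ}

/-- The part near `c` of an open vertical cone opening upwards from `c`. -/
def upCone (c : ℂ) (κ h : ℝ) : Set ℂ := {w ∈ ball c h | |(w - c).re| < κ * (w - c).im}

/-- The part near `c` of an open vertical cone opening downwards from `c`. -/
def downCone (c : ℂ) (κ h : ℝ) : Set ℂ := {w ∈ ball c h | |(w - c).re| < κ * (c - w).im}

theorem isOpen_upCone (c : ℂ) (κ h : ℝ) : IsOpen (upCone c κ h) :=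
  isOpen_ball.inter (isOpen_lt (f := fun w : ℂ => |(w - c).re|)
    (Complex.continuous_re.comp (continuous_sub_right c)).abs
    (continuous_const.mul (Complex.continuous_im.comp (continuous_sub_right c))))

theorem isOpen_downCone (c : ℂ) (κ h : ℝ) : IsOpen (downCone c κ h) :=
  isOpen_ball.inter (isOpen_lt (f := fun w : ℂ => |(w - c).re|)
    (Complex.continuous_re.comp (continuous_sub_right c)).abs
    (continuous_const.mul (Complex.continuous_im.comp (continuous_sub_left c))))

theorem convex_abs_re_lt (c : ℂ) (a : ℝ) : Convex ℝ {w : ℂ | |(w - c).re| < a * (w - c).im} := by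
  intro u hu v hv p q hp hq hpq
  simp only [mem_ofPred_eq, Complex.sub_re, Complex.sub_im, Complex.add_re, Complex.add_im,
    Complex.real_smul, Complex.re_ofReal_mul, Complex.im_ofReal_mul, abs_lt] at hu hv ⊢
  obtain rfl : q = 1 - p := by linarith
  rcases hp.eq_or_lt with rfl | hp'
  · constructor <;> nlinarith
  constructor <;>
    nlinarith [mul_lt_mul_of_pos_left hu.1 hp', mul_lt_mul_of_pos_left hu.2 hp',
      mul_le_mul_of_nonneg_left hv.1.le hq, mul_le_mul_of_nonneg_left hv.2.le hq]

theorem convex_upCone (c : ℂ) (κ h : ℝ) : Convex ℝ (upCone c κ h) :=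
  (convex_ball c h).inter (convex_abs_re_lt c κ)

theorem convex_downCone (c : ℂ) (κ h : ℝ) : Convex ℝ (downCone c κ h) := by
  have := (convex_ball c h).inter (convex_abs_re_lt c (-κ))
  have h : downCone c κ h = ball c h ∩ {w | |(w - c).re| < -κ * (w - c).im} := by
    ext w
    have h : -κ * (w - c).im = κ * (c - w).im := by
      rw [Complex.sub_im, Complex.sub_im]; ring
    simp only [downCone, mem_ofPred_eq, mem_inter_iff, h]
  rwa [h]

theorem add_mul_I_mem_upCone {c : ℂ} {κ h s : ℝ} (hκ : 0 < κ) (hs : 0 < s) (hsh : s < h) :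
    c + s * Complex.I ∈ upCone c κ h := by
  refine ⟨?_, ?_⟩
  · simpa [dist_eq_norm, abs_of_pos hs] using hsh
  · simpa using mul_pos hκ hs

theorem sub_mul_I_mem_downCone {c : ℂ} {κ h s : ℝ} (hκ : 0 < κ) (hs : 0 < s) (hsh : s < h) :
    c - s * Complex.I ∈ downCone c κ h := by
  refine ⟨?_, ?_⟩
  · simpa [dist_eq_norm, abs_of_pos hs] using hsh
  · simpa using mul_pos hκ hs

theorem im_lt_of_mem_downCone {c w : ℂ} {κ h : ℝ} (hκ : 0 < κ) (hw : w ∈ downCone c κ h) :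
    w.im < c.im := by
  have h1 := (abs_nonneg _).trans_lt hw.2
  have h2 := pos_of_mul_pos_right h1 hκ.le
  simpa using h2

theorem add_mul_sub_mem_downCone {c w : ℂ} {κ h σ : ℝ} (hw : w ∈ downCone c κ h)
    (hσ : σ ∈ Ico (0 : ℝ) 1) : w + σ * (c - w) ∈ downCone c κ h := by
  have h1 : w + σ * (c - w) - c = ((1 - σ : ℝ) : ℂ) * (w - c) := by push_cast; ring
  have h2 : c - (w + σ * (c - w)) = ((1 - σ : ℝ) : ℂ) * (c - w) := by push_cast; ring
  have h3 : 0 < 1 - σ := by linarith [hσ.2]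
  refine ⟨?_, ?_⟩
  · have := mem_ball_iff_norm.1 hw.1
    rw [mem_ball_iff_norm, h1, norm_mul, Complex.norm_real, Real.norm_of_nonneg h3.le]
    nlinarith [hσ.1, norm_nonneg (w - c)]
  · rw [h1, h2, Complex.re_ofReal_mul, Complex.im_ofReal_mul, abs_mul, abs_of_pos h3,
      mul_left_comm]
    exact mul_lt_mul_of_pos_left hw.2 h3

/-- The conditions on a point `c` that hold simultaneously along almost every vertical line. -/
structure GenericAt (Γ : Set (EuclideanSpace ℂ (Fin n))) (f : MvPolynomial (Fin n) ℂ) (c : ℂ) :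
    Prop where
  cone : ∃ κ > 0, ∃ h > 0, upCone c κ h ⊆ (polyEval f '' Γ)ᶜ ∧
    downCone c κ h ⊆ (polyEval f '' Γ)ᶜ ∧
    ∀ m : ℕ, (∀ w ∈ upCone c κ h, (hullFiber Γ f w).encard ≤ m) → (hullFiber Γ f c).Finite
  eventually_lt : c ∉ polyEval f '' Γ → ∀ m : ℕ, (hullFiber Γ f c).encard < m →
    ∀ᶠ w in 𝓝 c, (hullFiber Γ f w).encard < m
  approach : c ∈ polyEval f '' Γ → ∀ W : Set ℂ, IsOpen W → W.Nonempty →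
    W ⊆ (polyEval f '' Γ)ᶜ → (∀ w ∈ W, w.im < c.im) →
    (∀ w ∈ W, ∀ σ ∈ Ico (0 : ℝ) 1, w + σ * (c - w) ∈ W) →
    ∀ m : ℕ, (∀ V ⊆ W, IsOpen V → V.Nonempty → ∃ w ∈ V, m ≤ (hullFiber Γ f w).encard) →
    ∀ T ⊆ polyHull Γ, (∀ ε > 0, ∀ᶠ w in 𝓝 c, w ∈ W →
      ∀ x ∈ hullFiber Γ f w, ∃ p ∈ T, dist x p < ε) → m ≤ T.encard

theorem ae_genericAt (hΓ : IsCompact Γ) (hne : Γ.Nonempty) {L : NNReal}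
    {γ : ℝ → EuclideanSpace ℂ (Fin n)} (hΓγ : Γ ⊆ γ '' Icc 0 1)
    (hF : LipschitzWith L fun τ => polyEval f (γ τ)) :
    ∀ᵐ t : ℝ, ∀ c : ℂ, c.re = t → GenericAt Γ f c := by
  have hKF : polyEval f '' Γ ⊆ (fun τ => polyEval f (γ τ)) '' Icc 0 1 := by
    rintro _ ⟨x, hx, rfl⟩
    obtain ⟨τ, hτ, rfl⟩ := hΓγ hx
    exact ⟨τ, hτ, rfl⟩
  have hre : LipschitzWith L fun τ => (polyEval f (γ τ)).re := by
    refine LipschitzWith.of_dist_le_mul fun x y => (hF.dist_le_mul x y).trans' ?_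
    rw [dist_eq_norm, dist_eq_norm, ← Complex.sub_re]
    exact Complex.abs_re_le_norm _
  filter_upwards [hF.ae_cone, hre.ae_finite_fiber, ae_le_encard_of_approach hΓ hne f,
    ae_all_iff.2 (ae_eventually_encard_lt hΓ hne f)] with t h1 h2 h3 h4 c hc
  obtain ⟨κ, hκ, h, hh, hcone⟩ := h1 c hc
  have hup : upCone c κ h ⊆ (polyEval f '' Γ)ᶜ := fun w hw hwK => by
    obtain ⟨τ, hτ, rfl⟩ := hKF hwK
    refine (hcone τ hτ (mem_ball_iff_norm.1 hw.1)).not_gt (hw.2.trans_le ?_)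
    exact mul_le_mul_of_nonneg_left (le_abs_self _) hκ.le
  have hdown : downCone c κ h ⊆ (polyEval f '' Γ)ᶜ := fun w hw hwK => by
    obtain ⟨τ, hτ, rfl⟩ := hKF hwK
    refine (hcone τ hτ (mem_ball_iff_norm.1 hw.1)).not_gt (hw.2.trans_le ?_)
    refine mul_le_mul_of_nonneg_left ?_ hκ.le
    rw [← neg_sub, Complex.neg_im]
    exact neg_le_abs _
  have hfin : (Γ ∩ polyEval f ⁻¹' {c}).Finite := by
    refine (h2.image γ).subset ?_
    rintro x ⟨hx, hxc⟩
    obtain ⟨τ, hτ, rfl⟩ := hΓγ hx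
    exact ⟨τ, ⟨hτ, by rw [← hc, ← (hxc : _ = c)]⟩, rfl⟩
  refine ⟨⟨κ, hκ, h, hh, hup, hdown, fun m hm => ?_⟩, fun hcK m => h4 m c hcK hc,
    fun hcK => h3 c hcK hc⟩
  have := encard_hullFiber_diff_le hΓ hne hF hKF hfin hκ hh (m := m)
    fun w hw hw' => ⟨hup ⟨hw, hw'⟩, hm w ⟨hw, hw'⟩⟩
  refine ((finite_of_encard_le_coe this).union hfin).subset fun x hx => ?_
  by_cases hxΓ : x ∈ Γ
  · exact Or.inr ⟨hxΓ, hx.2⟩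
  · exact Or.inl ⟨hx, hxΓ⟩

/-- The fibers near `w` have uniformly bounded cardinality. -/
def FiberBdd (Γ : Set (EuclideanSpace ℂ (Fin n))) (f : MvPolynomial (Fin n) ℂ) (w : ℂ) : Prop :=
  ∃ m : ℕ, ∀ᶠ w' in 𝓝 w, (hullFiber Γ f w').encard ≤ m

theorem FiberBdd.exists_bound (hΓ : IsCompact Γ) (hne : Γ.Nonempty) {U : Set ℂ}
    (hU : Convex ℝ U) (hUo : IsOpen U) (hUK : U ⊆ (polyEval f '' Γ)ᶜ) {w : ℂ} (hw : w ∈ U)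
    (h : FiberBdd Γ f w) : ∃ m : ℕ, ∀ w ∈ U, (hullFiber Γ f w).encard ≤ m := by
  obtain ⟨m, hm⟩ := h
  obtain ⟨V, hV, hVo, hwV⟩ := _root_.eventually_nhds_iff.1 hm
  exact ⟨m, encard_hullFiber_le_of_isOpen hΓ hne hU.isPreconnected hUK hUo hVo ⟨w, hwV, hw⟩ hV⟩

theorem fiberBdd_of_isOpen {U : Set ℂ} (hUo : IsOpen U) {w : ℂ} (hw : w ∈ U)
    (h : ∀ w ∈ U, (hullFiber Γ f w).encard ≤ m) : FiberBdd Γ f w :=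
  ⟨m, mem_of_superset (hUo.mem_nhds hw) h⟩

theorem eventually_exists_dist_lt (hΓ : IsCompact Γ) (f : MvPolynomial (Fin n) ℂ) (c : ℂ) {ε : ℝ}
    (hε : 0 < ε) :
    ∀ᶠ w in 𝓝 c, ∀ x ∈ hullFiber Γ f w, ∃ p ∈ hullFiber Γ f c, dist x p < ε := by
  filter_upwards [eventually_hullFiber_subset hΓ f (isOpen_thickening (δ := ε))
    (self_subset_thickening hε _)] with w hw x hx
  exact mem_thickening_iff.1 (hw hx)

theorem fiberBdd_of_genericAt (hΓ : IsCompact Γ) (hne : Γ.Nonempty) {t : ℝ}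
    (hG : ∀ c : ℂ, c.re = t → GenericAt Γ f c) {c : ℂ} (hct : c.re = t)
    (hcK : c ∉ polyEval f '' Γ) : FiberBdd Γ f c := by
  by_contra hc
  set Bad : Set ℝ := {s | (⟨t, s⟩ : ℂ) ∉ polyEval f '' Γ ∧ ¬ FiberBdd Γ f ⟨t, s⟩} with hBad
  have hBne : Bad.Nonempty := ⟨c.im, by
    have : (⟨t, c.im⟩ : ℂ) = c := Complex.ext hct.symm rfl
    rw [hBad, mem_ofPred_eq, this]
    exact ⟨hcK, hc⟩⟩
  have hcomp := (isCompact_polyHull hΓ).image (continuous_polyEval f)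
  obtain ⟨B, hB⟩ := hcomp.isBounded.exists_norm_le
  have hBbd : BddAbove Bad := ⟨B, fun s hs => by
    by_contra! hBs
    refine hs.2 ⟨0, ?_⟩
    have : (⟨t, s⟩ : ℂ) ∈ (polyEval f '' polyHull Γ)ᶜ := fun hmem =>
      (hBs.trans_le ((le_abs_self s).trans (Complex.abs_im_le_norm ⟨t, s⟩))).not_ge (hB _ hmem)
    filter_upwards [hcomp.isClosed.isOpen_compl.mem_nhds this] with w hw
    simp only [Nat.cast_zero, nonpos_iff_eq_zero, encard_eq_zero]
    exact eq_empty_of_forall_notMem fun x hx => hw ⟨x, hx.1, hx.2⟩⟩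
  set s₀ := sSup Bad
  set c₀ : ℂ := ⟨t, s₀⟩ with hc₀
  have hmk : ∀ s : ℝ, (⟨t, s₀ + s⟩ : ℂ) = c₀ + s * Complex.I := fun s => by
    apply Complex.ext <;> simp [hc₀]
  have hgood : ∀ s : ℝ, 0 < s → c₀ + s * Complex.I ∉ polyEval f '' Γ →
      FiberBdd Γ f (c₀ + s * Complex.I) := fun s hs hK => by
    by_contra hb
    rw [← hmk] at hK hb
    linarith [le_csSup hBbd (show s₀ + s ∈ Bad from ⟨hK, hb⟩)]
  have hbad : ∀ r : ℝ, 0 < r → ∃ s : ℝ, 0 ≤ s ∧ s < r ∧ c₀ - s * Complex.I ∉ polyEval f '' Γ ∧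
      ¬ FiberBdd Γ f (c₀ - s * Complex.I) := fun r hr => by
    obtain ⟨s, hs, hsr⟩ := exists_lt_of_lt_csSup hBne (sub_lt_self s₀ hr)
    have h1 := hmk (s - s₀)
    rw [add_sub_cancel] at h1
    refine ⟨s₀ - s, sub_nonneg.2 (le_csSup hBbd hs), by linarith, ?_⟩
    have h2 : c₀ - ((s₀ - s : ℝ) : ℂ) * Complex.I = ⟨t, s⟩ := by
      rw [h1]; push_cast; ring
    rw [h2]
    exact hs
  obtain ⟨⟨κ, hκ, h, hh, hup, hdown, hS1⟩, -, happ⟩ := hG c₀ rfl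
  by_cases hK : c₀ ∈ polyEval f '' Γ
  · have hu := add_mul_I_mem_upCone (c := c₀) hκ (half_pos hh) (half_lt_self hh)
    obtain ⟨m, hm⟩ := (hgood _ (half_pos hh) (hup hu)).exists_bound hΓ hne
      (convex_upCone c₀ κ h) (isOpen_upCone c₀ κ h) hup hu
    have hfin := hS1 m hm
    obtain ⟨M, hM⟩ := ENat.ne_top_iff_exists.1 hfin.encard_lt_top.ne
    obtain ⟨s, hs0, hsh, hsK, hsb⟩ := hbad h hh
    have hs : 0 < s := hs0.lt_of_ne (by rintro rfl; simp [hK] at hsK)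
    have hd := sub_mul_I_mem_downCone (c := c₀) hκ hs hsh
    have := happ hK (downCone c₀ κ h) (isOpen_downCone c₀ κ h) ⟨_, hd⟩ hdown
      (fun w hw => im_lt_of_mem_downCone hκ hw) (fun w hw σ hσ => add_mul_sub_mem_downCone hw hσ)
      (M + 1) (fun V hVW hVo hVne => by
        by_contra! hlt
        obtain ⟨v, hv⟩ := hVne
        have hvb : FiberBdd Γ f v := fiberBdd_of_isOpen (m := M) hVo hv fun w hw => by
          have := hlt w hw
          push_cast at this
          exact ENat.lt_natCast_add_one_iff.1 this
        obtain ⟨m', hm'⟩ := hvb.exists_bound hΓ hne (convex_downCone c₀ κ h)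
          (isOpen_downCone c₀ κ h) hdown (hVW hv)
        exact hsb (fiberBdd_of_isOpen (isOpen_downCone c₀ κ h) hd hm'))
      (hullFiber Γ f c₀) (fun x hx => hx.1)
      (fun ε hε => (eventually_exists_dist_lt hΓ f c₀ hε).mono fun w hw _ => hw)
    rw [← hM] at this
    norm_cast at this
    omega
  · obtain ⟨r, hr, hrK⟩ := Metric.isOpen_iff.1 (isOpen_compl_image_polyEval hΓ f) c₀ hK
    have hu : c₀ + ((r / 2 : ℝ) : ℂ) * Complex.I ∈ ball c₀ r := by
      rw [mem_ball_iff_norm, add_sub_cancel_left, norm_mul, Complex.norm_I, mul_one,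
        Complex.norm_real, Real.norm_of_nonneg (by positivity)]
      linarith
    obtain ⟨m, hm⟩ := (hgood _ (half_pos hr) (hrK hu)).exists_bound hΓ hne
      (convex_ball c₀ r) isOpen_ball hrK hu
    obtain ⟨s, hs0, hsh, hsK, hsb⟩ := hbad r hr
    refine hsb (fiberBdd_of_isOpen isOpen_ball ?_ hm)
    rw [mem_ball_iff_norm, sub_sub_cancel_left, norm_neg, norm_mul, Complex.norm_I, mul_one,
      Complex.norm_real, Real.norm_of_nonneg hs0]
    exact hsh

theorem finite_hullFiber_of_genericAt (hΓ : IsCompact Γ) (hne : Γ.Nonempty) {t : ℝ}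
    (hG : ∀ c : ℂ, c.re = t → GenericAt Γ f c) {c : ℂ} (hct : c.re = t) :
    (hullFiber Γ f c).Finite := by
  by_cases hcK : c ∈ polyEval f '' Γ
  · obtain ⟨κ, hκ, h, hh, hup, -, hS1⟩ := (hG c hct).cone
    have hu := add_mul_I_mem_upCone (c := c) hκ (half_pos hh) (half_lt_self hh)
    obtain ⟨m, hm⟩ := (fiberBdd_of_genericAt hΓ hne hG (by simp [hct]) (hup hu)).exists_bound hΓ hne
      (convex_upCone c κ h) (isOpen_upCone c κ h) hup hu
    exact hS1 m hm
  · obtain ⟨m, hm⟩ := fiberBdd_of_genericAt hΓ hne hG hct hcK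
    exact finite_of_encard_le_coe hm.self_of_nhds

end

section

open MeasureTheory Set Metric Filter Topology

variable {n m : ℕ} {Γ : Set (EuclideanSpace ℂ (Fin n))} {f : MvPolynomial (Fin n) ℂ}

theorem Set.encard_add_one_le_of_separated {α : Type*} [MetricSpace α] {J S : Set α} {ρ : ℝ}
    (hsep : ∀ p ∈ J, ∀ q ∈ J, dist p q < 2 * ρ → p = q)
    (hJ : ∀ p ∈ J, ∃ s ∈ S, dist s p < ρ) {p x y : α} (hp : p ∈ J) (hx : x ∈ S) (hy : y ∈ S)
    (hxp : dist x p < ρ) (hyp : dist y p < ρ) (hxy : x ≠ y) : J.encard + 1 ≤ S.encard := by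
  classical
  choose! g hgS hg using hJ
  set g' : α → α := fun q => if q = p then x else g q with hg'
  have hd : ∀ q ∈ J, dist (g' q) q < ρ := fun q hq => by
    by_cases h : q = p
    · simpa [hg', h] using hxp
    · simpa [hg', h] using hg q hq
  have hclose : ∀ u, ∀ q ∈ J, ∀ q' ∈ J, dist u q < ρ → dist u q' < ρ → q = q' :=
    fun u q hq q' hq' h h' => hsep q hq q' hq' (by
      have := dist_triangle_left q q' u
      linarith)
  rw [← encard_sdiff_singleton_add_one hy]
  refine add_le_add ?_ le_rfl
  refine encard_le_encard_of_injOn (f := g') (t := S \ {y}) (fun q hq => ⟨?_, ?_⟩)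
    fun q hq q' hq' h =>
    hclose (g' q) q hq q' hq' (hd q hq) (by rw [h]; exact hd q' hq')
  · by_cases h : q = p
    · simpa [hg', h] using hx
    · simpa [hg', h] using hgS q hq
  · rintro (h : g' q = y)
    have hqp : q = p := hclose y q hq p hp (h ▸ hd q hq) hyp
    exact hxy (by simpa [hg', hqp] using h)

theorem dist_sub_mul_I (c : ℂ) {s : ℝ} (hs : 0 < s) : dist (c - s * Complex.I) c = s := by
  rw [dist_eq_norm, sub_sub_cancel_left, norm_neg, norm_mul, Complex.norm_I, mul_one,
    Complex.norm_real, Real.norm_of_nonneg hs.le]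

theorem exists_minimal_bound (hΓ : IsCompact Γ) (hne : Γ.Nonempty) {W : Set ℂ}
    (hW : Convex ℝ W) (hWo : IsOpen W) (hWK : W ⊆ (polyEval f '' Γ)ᶜ)
    (h : ∃ m : ℕ, ∀ w ∈ W, (hullFiber Γ f w).encard ≤ m) :
    ∃ m : ℕ, (∀ w ∈ W, (hullFiber Γ f w).encard ≤ m) ∧
      ∀ V ⊆ W, IsOpen V → V.Nonempty → ∃ w ∈ V, m ≤ (hullFiber Γ f w).encard := by
  classical
  refine ⟨Nat.find h, Nat.find_spec h, fun V hVW hVo hVne => ?_⟩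
  by_contra! hlt
  obtain ⟨v, hv⟩ := hVne
  obtain ⟨k, hk⟩ : ∃ k, Nat.find h = k + 1 := by
    refine Nat.exists_eq_succ_of_ne_zero fun h0 => ?_
    have := hlt v hv
    simp [h0] at this
  refine Nat.find_min h (m := k) (by omega) (encard_hullFiber_le_of_isOpen hΓ hne hW.isPreconnected
    hWK hWo hVo ⟨v, hv, hVW hv⟩ fun w hw => ?_)
  have := hlt w hw
  rw [hk] at this
  push_cast at this
  exact ENat.lt_natCast_add_one_iff.1 this

/-- Whether the fiber meets a given ball cannot change along a connected set of base points over
which all fibers avoid the boundary of the ball. -/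
theorem hullFiber_inter_ball_nonempty_of_isPreconnected (hΓ : IsCompact Γ) (hne : Γ.Nonempty)
    {W : Set ℂ} (hW : IsPreconnected W) (hWK : W ⊆ (polyEval f '' Γ)ᶜ)
    (hfin : ∀ w ∈ W, (hullFiber Γ f w).Finite) {p : EuclideanSpace ℂ (Fin n)} {ρ : ℝ}
    (hp : ∀ w ∈ W, ∀ x ∈ hullFiber Γ f w, dist x p ≤ ρ → dist x p < ρ) {w₀ w : ℂ} (hw₀ : w₀ ∈ W)
    (hw : w ∈ W) (h : (hullFiber Γ f w₀ ∩ ball p ρ).Nonempty) :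
    (hullFiber Γ f w ∩ ball p ρ).Nonempty := by
  set N := {w | (hullFiber Γ f w ∩ ball p ρ).Nonempty}
  set N' := {w | (hullFiber Γ f w ∩ closedBall p ρ).Nonempty}
  have hNN : N ⊆ N' := fun w ⟨x, hx, hxp⟩ => ⟨x, hx, ball_subset_closedBall hxp⟩
  have hN' : IsOpen N'ᶜ :=
    (isCompact_hullFiber_preimage hΓ f isClosed_closedBall).isClosed.isOpen_compl
  have hsub : ∀ w ∈ W, w ∈ N' → w ∈ interior N := fun w hw ⟨x, hx, hxp⟩ => by
    have hxp' := hp w hw x hx hxp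
    rw [mem_interior_iff_mem_nhds]
    filter_upwards [eventually_hullFiber_inter_ball_nonempty hΓ hne (hWK hw) (hfin w hw) hx
      (sub_pos.2 hxp')] with u ⟨y, hy, hyx⟩
    exact ⟨y, hy, ball_subset_ball' (by linarith) hyx⟩
  rcases isPreconnected_iff_subset_of_disjoint.1 hW (interior N) N'ᶜ isOpen_interior hN'
    (fun u hu => by
      by_cases h : u ∈ N'
      · exact Or.inl (hsub u hu h)
      · exact Or.inr h)
    (eq_empty_of_forall_notMem fun u hu => hu.2.2 (hNN (interior_subset hu.2.1))) with h1 | h1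
  · exact interior_subset (s := N) (h1 hw)
  · exact absurd (hNN h) (h1 hw₀)

theorem exists_eq_of_dist_lt_of_genericAt (hΓ : IsCompact Γ) (hne : Γ.Nonempty) {t : ℝ}
    (hG : ∀ c : ℂ, c.re = t → GenericAt Γ f c) {c : ℂ} (hct : c.re = t) :
    ∃ ρ > 0, ∃ δ > 0, ∀ s : ℝ, 0 < s → s < δ → ∀ p ∈ hullFiber Γ f c,
      ∀ x ∈ hullFiber Γ f (c - s * Complex.I), ∀ y ∈ hullFiber Γ f (c - s * Complex.I),
      dist x p < ρ → dist y p < ρ → x = y := by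
  have hfin := finite_hullFiber_of_genericAt hΓ hne hG hct
  obtain ⟨r, hr, hsep⟩ := hfin.exists_dist_separated
  obtain ⟨ρ, hρ, hρr⟩ : ∃ ρ > 0, 4 * ρ = r := ⟨r / 4, by positivity, by ring⟩
  refine ⟨ρ, hρ, ?_⟩
  by_cases hcK : c ∈ polyEval f '' Γ
  · obtain ⟨⟨κ, hκ, h, hh, -, hdown, -⟩, -, happ⟩ := hG c hct
    have happ := happ hcK (downCone c κ h) (isOpen_downCone c κ h)
      ⟨_, sub_mul_I_mem_downCone hκ (half_pos hh) (half_lt_self hh)⟩ hdown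
      (fun w hw => im_lt_of_mem_downCone hκ hw) (fun w hw σ hσ => add_mul_sub_mem_downCone hw hσ)
    have hd := sub_mul_I_mem_downCone (c := c) hκ (half_pos hh) (half_lt_self hh)
    obtain ⟨m, hm, hmV⟩ := exists_minimal_bound hΓ hne (convex_downCone c κ h)
      (isOpen_downCone c κ h) hdown
      ((fiberBdd_of_genericAt hΓ hne hG (by simp [hct]) (hdown hd)).exists_bound hΓ hne
        (convex_downCone c κ h) (isOpen_downCone c κ h) hdown hd)
    obtain ⟨δ', hδ', hδ'c⟩ := Metric.eventually_nhds_iff.1 (eventually_exists_dist_lt hΓ f c hρ)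
    set δ := min δ' h
    have hδ : 0 < δ := lt_min hδ' hh
    have hδh : downCone c κ δ ⊆ downCone c κ h := fun w hw =>
      ⟨ball_subset_ball (min_le_right _ _) hw.1, hw.2⟩
    have hnear : ∀ w ∈ downCone c κ δ, ∀ x ∈ hullFiber Γ f w, ∃ p ∈ hullFiber Γ f c, dist x p < ρ :=
      fun w hw => hδ'c (lt_of_lt_of_le hw.1 (min_le_left _ _))
    set J := {p ∈ hullFiber Γ f c | ∀ w ∈ downCone c κ δ, (hullFiber Γ f w ∩ ball p ρ).Nonempty}
    have hJ : ∀ p ∈ hullFiber Γ f c, ∀ w ∈ downCone c κ δ,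
        (hullFiber Γ f w ∩ ball p ρ).Nonempty → p ∈ J := fun p hp w₀ hw₀ h₀ =>
      ⟨hp, fun w hw => hullFiber_inter_ball_nonempty_of_isPreconnected hΓ hne
        (convex_downCone c κ δ).isPreconnected (hδh.trans hdown)
        (fun w hw => finite_of_encard_le_coe (hm w (hδh hw)))
        (fun w hw x hx hxp => by
          obtain ⟨q, hq, hxq⟩ := hnear w hw x hx
          rwa [hsep p hp q hq (by
            have := dist_triangle_left p q x
            linarith)]) hw₀ hw h₀⟩
    have hmJ : m ≤ J.encard := happ m hmV J (fun p hp => hp.1.1) fun ε hε => by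
      filter_upwards [eventually_exists_dist_lt hΓ f c (lt_min hε hρ), ball_mem_nhds c hδ]
        with w hw hwδ hwW x hx
      obtain ⟨p, hp, hxp⟩ := hw x hx
      exact ⟨p, hJ p hp w ⟨hwδ, hwW.2⟩ ⟨x, hx, hxp.trans_le (min_le_right _ _)⟩,
        hxp.trans_le (min_le_left _ _)⟩
    refine ⟨δ, hδ, fun s hs hsδ p hp x hx y hy hxp hyp => ?_⟩
    by_contra hxy
    have hsW := sub_mul_I_mem_downCone (c := c) hκ hs hsδ
    have h1 := encard_add_one_le_of_separated (J := J) (ρ := ρ)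
      (fun p hp q hq hpq => hsep p hp.1 q hq.1 (by linarith))
      (fun p hp => hp.2 _ hsW) (hJ p hp _ hsW ⟨x, hx, hxp⟩) hx hy hxp hyp hxy
    have h2 := h1.trans ((hm _ (hδh hsW)).trans hmJ)
    exact h2.not_gt
      (ENat.lt_add_one_iff (hfin.subset fun p hp => hp.1).encard_lt_top.ne |>.2 le_rfl)
  · obtain ⟨M, hM⟩ := ENat.ne_top_iff_exists.1 hfin.encard_lt_top.ne
    have h1 := (hG c hct).eventually_lt hcK (M + 1) (by
      rw [← hM]; exact_mod_cast M.lt_succ_self)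
    have h2 : ∀ᶠ w in 𝓝 c, ∀ p ∈ hullFiber Γ f c, (hullFiber Γ f w ∩ ball p ρ).Nonempty :=
      (eventually_all_finite hfin).2 fun p hp =>
        eventually_hullFiber_inter_ball_nonempty hΓ hne hcK hfin hp hρ
    obtain ⟨δ, hδ, hδc⟩ := Metric.eventually_nhds_iff.1 (h1.and h2)
    refine ⟨δ, hδ, fun s hs hsδ p hp x hx y hy hxp hyp => ?_⟩
    by_contra hxy
    obtain ⟨h3, h4⟩ := hδc (y := c - s * Complex.I) (by rwa [dist_sub_mul_I c hs])
    refine h3.not_ge ?_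
    push_cast
    rw [hM]
    exact encard_add_one_le_of_separated (ρ := ρ)
      (fun p hp q hq hpq => hsep p hp q hq (by linarith)) h4 hp hx hy hxp hyp hxy

end

section

open MeasureTheory Set Metric Filter Topology

variable {n m : ℕ} {Γ : Set (EuclideanSpace ℂ (Fin n))} {f : MvPolynomial (Fin n) ℂ}

theorem exists_dense_hOneZero (hΓ : IsCompact Γ) (hne : Γ.Nonempty) {L : NNReal}
    {γ : ℝ → EuclideanSpace ℂ (Fin n)} (hΓγ : Γ ⊆ γ '' Icc 0 1)
    (hF : LipschitzWith L fun τ => polyEval f (γ τ)) :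
    ∃ D : Set ℝ, Dense D ∧ ∀ t ∈ D, ∀ Y : Set (polyHull Γ), IsClosed Y →
      Y ⊆ (fun x : polyHull Γ => (polyEval f x).re) ⁻¹' {t} → SmallCochain.HOneZero Y := by
  have := isCompact_iff_compactSpace.1 (isCompact_polyHull hΓ)
  refine ⟨_, Measure.dense_of_ae (ae_genericAt hΓ hne hΓγ hF), fun t hG Y hY hYt => ?_⟩
  have hfib : ∀ x ∈ Y, ∀ τ, (polyEval f x).im = τ → (x : EuclideanSpace ℂ (Fin n)) ∈
      hullFiber Γ f ⟨t, τ⟩ := fun x hx τ hτ => ⟨x.2, Complex.ext (hYt hx) hτ⟩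
  refine SmallCochain.hOneZero_of_fibers hY (g := fun x : polyHull Γ => (polyEval f x).im)
    (Complex.continuous_im.comp ((continuous_polyEval f).comp continuous_subtype_val))
    (fun τ => ?_) fun τ => ?_
  · have hfin := finite_hullFiber_of_genericAt hΓ hne hG (c := ⟨t, τ⟩) rfl
    exact (hfin.preimage Subtype.val_injective.injOn).subset fun x hx => hfib x hx.1 τ hx.2
  · obtain ⟨ρ, hρ, δ, hδ, h⟩ := exists_eq_of_dist_lt_of_genericAt hΓ hne hG (c := ⟨t, τ⟩) rfl
    refine ⟨ρ, hρ, δ, hδ, fun s hs hsδ p hp hpτ x hx y hy hxτ hyτ hxp hyp => ?_⟩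
    have hcs : (⟨t, τ⟩ : ℂ) - s * Complex.I = ⟨t, τ - s⟩ := by
      apply Complex.ext <;> simp
    have h := h s hs hsδ p (hfib p hp τ hpτ)
    rw [hcs] at h
    exact Subtype.ext (h x (hfib x hx _ hxτ) y (hfib y hy _ hyτ) hxp hyp)

theorem exists_coord_separated {n : ℕ} {ε : ℝ} (hε : 0 < ε) :
    ∃ δ > 0, ∀ x y : EuclideanSpace ℂ (Fin n), (∀ j, |(x j).re - (y j).re| < δ) →
      (∀ j, |(x j).im - (y j).im| < δ) → dist x y < ε := by
  obtain ⟨C, hC⟩ : ∃ C, AntilipschitzWith C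
      (WithLp.ofLp : EuclideanSpace ℂ (Fin n) → Fin n → ℂ) := ⟨_, PiLp.antilipschitzWith_ofLp 2 _⟩
  refine ⟨ε / (2 * (C + 1)), by positivity, fun x y hre him => ?_⟩
  have h : dist x.ofLp y.ofLp ≤ 2 * (ε / (2 * (C + 1))) := by
    refine (dist_pi_le_iff (by positivity)).2 fun j => ?_
    rw [dist_eq_norm]
    refine (Complex.norm_le_abs_re_add_abs_im _).trans ?_
    rw [Complex.sub_re, Complex.sub_im]
    linarith [hre j, him j]
  have h2 : 2 * (ε / (2 * ((C : ℝ) + 1))) = ε / (C + 1) := by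
    field_simp
  rw [h2] at h
  calc dist x y ≤ C * dist x.ofLp y.ofLp := hC.le_mul_dist x y
    _ ≤ C * (ε / (C + 1)) := by gcongr
    _ < (C + 1) * (ε / (C + 1)) := by
      have : 0 < ε / ((C : ℝ) + 1) := by positivity
      nlinarith
    _ = ε := by field_simp

theorem polyHull_empty : polyHull (∅ : Set (EuclideanSpace ℂ (Fin n))) = ∅ := by
  refine eq_empty_of_forall_notMem fun x hx => ?_
  have := hx 1
  simp only [map_one, norm_one, image_empty, Real.sSup_empty] at this
  linarith

theorem cechH2_polyHull_subsingleton (hΓ : IsCompact Γ) {K : NNReal}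
    {γ : ℝ → EuclideanSpace ℂ (Fin n)} (hγ : LipschitzWith K γ) (hΓγ : Γ ⊆ γ '' Icc 0 1) :
    Subsingleton (CechPaper.CechH2 (polyHull Γ)) := by
  have := isCompact_iff_compactSpace.1 (isCompact_polyHull hΓ)
  refine SmallCochain.cechH2_subsingleton fun φ ε hε hφ => ?_
  rcases Γ.eq_empty_or_nonempty with rfl | hne
  · refine SmallCochain.triv_univ hε hφ (m := 0) (fun _ _ => 0) (fun _ => continuous_const)
      ⟨1, one_pos, fun x => ?_⟩ fun i => i.elim0
    exact (polyHull_empty.subset x.2).elim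
  let a : Bool → ℂ := fun b => if b then 1 else -Complex.I
  let e := Fintype.equivFin (Fin n × Bool)
  let F : Fin n × Bool → MvPolynomial (Fin n) ℂ := fun j =>
    MvPolynomial.C (a j.2) * MvPolynomial.X j.1
  have hF : ∀ j x, polyEval (F j) x = a j.2 * x j.1 := fun j x => by simp [F, polyEval]
  have ha : ∀ b, ‖a b‖ = 1 := fun b => by cases b <;> simp [a]
  refine SmallCochain.triv_univ hε hφ (fun i (x : polyHull Γ) => (polyEval (F (e.symm i)) x).re)
    (fun i => Complex.continuous_re.comp ((continuous_polyEval _).comp continuous_subtype_val))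
    ?_ fun i => exists_dense_hOneZero hΓ hne hΓγ (L := K) ?_
  · obtain ⟨δ, hδ, h⟩ := exists_coord_separated (n := n) hε
    refine ⟨δ, hδ, fun x y hxy => h x y (fun j => ?_) fun j => ?_⟩
    · simpa [hF, a] using hxy (e (j, true))
    · simpa [hF, a] using hxy (e (j, false))
  · refine LipschitzWith.of_dist_le_mul fun x y => (hγ.dist_le_mul x y).trans' ?_
    rw [hF, hF, dist_eq_norm, dist_eq_norm, ← mul_sub, norm_mul, ha, one_mul]
    exact PiLp.norm_apply_le (γ x - γ y) _

end

/-! **Statement 5.**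
If `Γ ⊂ ℂⁿ` is a compact subset of a continuum (compact connected set) of finite
one-dimensional Hausdorff measure, then the second Čech cohomology group with integer
coefficients of the polynomially convex hull `Γ̂` of `Γ` vanishes (a group vanishes iff
it is a subsingleton). -/

theorem H2_of_polyHull_vanishes
    {n : ℕ} (Γ : Set (EuclideanSpace ℂ (Fin n))) (hΓ : IsCompact Γ)
    (E : Set (EuclideanSpace ℂ (Fin n))) (hEc : IsCompact E) (hEconn : IsConnected E)
    (hΓE : Γ ⊆ E) (hlen : μH[1] E < ⊤) :
    Subsingleton (CechH2 (polyHull Γ)) := by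
  obtain ⟨K, γ, hγ, hEγ⟩ := ContinuumParam.exists_lipschitz_param hEc hEconn hlen
  exact cechH2_polyHull_subsingleton hΓ hγ (hΓE.trans hEγ)
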